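/- (Improved stability under a uniform L^∞ closeness bound.) Let N ≥ 2, 0 < s < 1, 1 ≤ q < 2*_s := 2N/(N−2s) and C₀ > 0. There exists a constant c > 0, depending only on N, s, q and C₀, with the following property: for every open bounded set Ω ⊆ ℝ^N with |Ω| = 1 that admits a continuous first minimizer u for λ_{s,q}(Ω) (with u = 0 outside Ω) whose Caffarelli–Silvestre extension U(x,z) = (P_z ∗ u)(x) satisfies sup_{x ∈ ℝ^N} |U(x,z) − u(x)| ≤ C₀ z^s for every z > 0, and for every open ball B ⊆ ℝ^N with |B| = 1, one has λ_{s,q}(Ω) − λ_{s,q}(B) ≥ c · A(Ω)^{2 + 1/s}. -/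

import Mathlib

open MeasureTheory Filter
open scoped ENNReal NNReal Topology FourierTransform RealInnerProductSpace

noncomputable section

/-- Euclidean space ℝ^N -/
abbrev Eu (N : ℕ) := EuclideanSpace ℝ (Fin N)

/-- Squared Gagliardo seminorm `[u]_{W^{s,2}}²`, as an extended nonnegative real. -/
def gagliardoSq (N : ℕ) (s : ℝ) (u : Eu N → ℝ) : ℝ≥0∞ :=
  ∫⁻ x, ∫⁻ y, ENNReal.ofReal (|u x - u y| ^ 2 / ‖x - y‖ ^ ((N : ℝ) + 2 * s))

/-- Squared Gagliardo seminorm, as a real number. -/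
def gagliardoSqR (N : ℕ) (s : ℝ) (u : Eu N → ℝ) : ℝ :=
  (gagliardoSq N s u).toReal

/-- The sharp fractional Poincaré–Sobolev constant
`λ_{s,q}(Ω) = inf { [u]_{W^{s,2}}² : u ∈ C_c^∞(Ω), ‖u‖_{L^q(Ω)} = 1 }`. -/
def sobolevConst (N : ℕ) (s q : ℝ) (Ω : Set (Eu N)) : ℝ :=
  sInf { c : ℝ | ∃ u : Eu N → ℝ, ContDiff ℝ (⊤ : ℕ∞) u ∧ HasCompactSupport u ∧
    tsupport u ⊆ Ω ∧ (∫ x in Ω, |u x| ^ q) = 1 ∧ c = gagliardoSqR N s u }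

/-- The Fraenkel asymmetry `A(Ω)`. -/
def asym (N : ℕ) (Ω : Set (Eu N)) : ℝ :=
  sInf { c : ℝ | ∃ (x₀ : Eu N) (r : ℝ), 0 < r ∧
    volume (Metric.ball x₀ r) = volume Ω ∧
    c = (volume (symmDiff Ω (Metric.ball x₀ r))).toReal / (volume Ω).toReal }

/-- The normalizing constant `β_{N,s}`. -/
def betaC (N : ℕ) (s : ℝ) : ℝ :=
  (∫ x : Eu N, ((1 : ℝ) + ‖x‖ ^ 2) ^ (-((N : ℝ) + 2 * s) / 2))⁻¹

/-- The Poisson kernel `P_z(x) = β_{N,s} z^{2s} (z² + |x|²)^{-(N+2s)/2}`. -/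
def poisson (N : ℕ) (s z : ℝ) (x : Eu N) : ℝ :=
  betaC N s * z ^ (2 * s) * ((z ^ 2 + ‖x‖ ^ 2) ^ (-((N : ℝ) + 2 * s) / 2))

/-- The Caffarelli–Silvestre extension `U(x,z) = (P_z ∗ u)(x)`. -/
def csExt (N : ℕ) (s : ℝ) (u : Eu N → ℝ) (x : Eu N) (z : ℝ) : ℝ :=
  ∫ y, poisson N s z (x - y) * u y

/-- A first minimizer for `λ_{s,q}(Ω)`: a nonnegative measurable function, vanishing a.e.
outside `Ω`, with unit `L^q` norm, realizing the infimum, and positive inside `Ω`. -/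
def IsFirstMinimizer (N : ℕ) (s q : ℝ) (Ω : Set (Eu N)) (u : Eu N → ℝ) : Prop :=
  Measurable u ∧ (∀ x, 0 ≤ u x) ∧ (∀ᵐ x, x ∉ Ω → u x = 0) ∧
  (∫ x in Ω, u x ^ q) = 1 ∧ gagliardoSqR N s u = sobolevConst N s q Ω ∧
  ∀ x ∈ Ω, 0 < u x

/-- The level `T` from (4.1): `T = sup { t > 0 : |{u > t}| ≥ |Ω| (1 - A(Ω)/9) }`. -/
def levelT (N : ℕ) (Ω : Set (Eu N)) (u : Eu N → ℝ) : ℝ :=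
  sSup { t : ℝ | 0 < t ∧
    volume Ω * ENNReal.ofReal (1 - asym N Ω / 9) ≤ volume {x | t < u x} }


section GagliardoBasics

variable {N : ℕ} {s : ℝ}

theorem measurable_gagliardo_integrand (s : ℝ) {u : Eu N → ℝ} (hu : Measurable u) :
    Measurable (fun z : Eu N × Eu N =>
      ENNReal.ofReal (|u z.1 - u z.2| ^ 2 / ‖z.1 - z.2‖ ^ ((N : ℝ) + 2 * s))) := by
  fun_prop

theorem gagliardoSq_eq_prod (s : ℝ) {u : Eu N → ℝ} (hu : Measurable u) :
    gagliardoSq N s u = ∫⁻ z : Eu N × Eu N,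
      ENNReal.ofReal (|u z.1 - u z.2| ^ 2 / ‖z.1 - z.2‖ ^ ((N : ℝ) + 2 * s)) := by
  rw [Measure.volume_eq_prod, lintegral_prod _ (measurable_gagliardo_integrand s hu).aemeasurable]
  rfl

theorem gagliardoSq_mono {f g : Eu N → ℝ} (h : ∀ x y, |f x - f y| ≤ |g x - g y|) :
    gagliardoSq N s f ≤ gagliardoSq N s g := by
  refine lintegral_mono fun x => lintegral_mono fun y => ENNReal.ofReal_le_ofReal ?_
  have := h x y
  gcongr

theorem gagliardoSq_const_mul (c : ℝ) {u : Eu N → ℝ} (hu : Measurable u) :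
    gagliardoSq N s (fun x => c * u x) = ENNReal.ofReal (c ^ 2) * gagliardoSq N s u := by
  rw [gagliardoSq_eq_prod s hu, gagliardoSq_eq_prod s (hu.const_mul c),
    ← lintegral_const_mul _ (measurable_gagliardo_integrand s hu)]
  refine lintegral_congr fun z => ?_
  rw [← ENNReal.ofReal_mul (sq_nonneg c), ← mul_sub, abs_mul, mul_pow, sq_abs c, mul_div_assoc]

theorem gagliardoSq_comp_add (u : Eu N → ℝ) (a : Eu N) :
    gagliardoSq N s (fun x => u (x + a)) = gagliardoSq N s u := by
  unfold gagliardoSq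
  rw [← lintegral_add_right_eq_self (fun x => ∫⁻ y, ENNReal.ofReal (|u x - u y| ^ 2 /
    ‖x - y‖ ^ ((N : ℝ) + 2 * s))) a]
  refine lintegral_congr fun x => ?_
  rw [← lintegral_add_right_eq_self (fun y => ENNReal.ofReal (|u (x + a) - u y| ^ 2 /
    ‖x + a - y‖ ^ ((N : ℝ) + 2 * s))) a]
  simp

theorem lintegral_comp_smul_eq (f : Eu N → ℝ≥0∞) {c : ℝ} (hc : 0 < c) :
    ∫⁻ x, f (c • x) = ENNReal.ofReal (c ^ (-(N : ℝ))) * ∫⁻ x, f x := by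
  have h1 := Measure.map_addHaar_smul (volume : Measure (Eu N)) hc.ne'
  have h2 : ∫⁻ x, f x ∂(Measure.map (c • ·) (volume : Measure (Eu N))) = ∫⁻ x, f (c • x) :=
    lintegral_map_equiv f (Homeomorph.smulOfNeZero c hc.ne').toMeasurableEquiv
  rw [← h2, h1, lintegral_smul_measure, smul_eq_mul]
  congr 2
  rw [finrank_euclideanSpace_fin, abs_of_pos (by positivity), Real.rpow_neg hc.le,
    Real.rpow_natCast]

theorem gagliardoSq_comp_smul (u : Eu N → ℝ) {c : ℝ} (hc : 0 < c) :
    gagliardoSq N s (fun x => u (c • x)) =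
      ENNReal.ofReal (c ^ (-((N : ℝ) - 2 * s))) * gagliardoSq N s u := by
  unfold gagliardoSq
  have h1 : ∀ x y : Eu N, ENNReal.ofReal (|u (c • x) - u (c • y)| ^ 2 /
      ‖x - y‖ ^ ((N : ℝ) + 2 * s)) = ENNReal.ofReal (c ^ ((N : ℝ) + 2 * s)) *
      ENNReal.ofReal (|u (c • x) - u (c • y)| ^ 2 / ‖c • x - c • y‖ ^ ((N : ℝ) + 2 * s)) := by
    intro x y
    rw [← ENNReal.ofReal_mul (by positivity), ← smul_sub, norm_smul, Real.norm_of_nonneg hc.le,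
      Real.mul_rpow hc.le (norm_nonneg _)]
    congr 1
    have : c ^ ((N : ℝ) + 2 * s) ≠ 0 := by positivity
    field_simp
  simp_rw [h1]
  have h2 : ∀ x : Eu N, ∫⁻ y, ENNReal.ofReal (c ^ ((N : ℝ) + 2 * s)) *
      ENNReal.ofReal (|u (c • x) - u (c • y)| ^ 2 / ‖c • x - c • y‖ ^ ((N : ℝ) + 2 * s)) =
      ENNReal.ofReal (c ^ ((N : ℝ) + 2 * s)) * (ENNReal.ofReal (c ^ (-(N : ℝ))) *
      ∫⁻ y, ENNReal.ofReal (|u (c • x) - u y| ^ 2 / ‖c • x - y‖ ^ ((N : ℝ) + 2 * s))) := by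
    intro x
    rw [lintegral_const_mul' _ _ ENNReal.ofReal_ne_top]
    congr 1
    exact lintegral_comp_smul_eq (fun y => ENNReal.ofReal (|u (c • x) - u y| ^ 2 /
      ‖c • x - y‖ ^ ((N : ℝ) + 2 * s))) hc
  simp_rw [h2]
  rw [lintegral_const_mul' _ _ ENNReal.ofReal_ne_top,
    lintegral_const_mul' _ _ ENNReal.ofReal_ne_top,
    lintegral_comp_smul_eq (fun x => ∫⁻ y, ENNReal.ofReal (|u x - u y| ^ 2 /
      ‖x - y‖ ^ ((N : ℝ) + 2 * s))) hc, ← mul_assoc, ← mul_assoc,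
      ← ENNReal.ofReal_mul (by positivity), ← ENNReal.ofReal_mul (by positivity),
      ← Real.rpow_add hc, ← Real.rpow_add hc]
  congr 3
  ring

theorem sq_abs_sup_add_sq_abs_inf_le (a b c d : ℝ) :
    |max a b - max c d| ^ 2 + |min a b - min c d| ^ 2 ≤ |a - c| ^ 2 + |b - d| ^ 2 := by
  simp only [sq_abs]
  rcases le_total a b with h1 | h1 <;> rcases le_total c d with h2 | h2 <;>
    simp only [h1, h2, max_eq_left, max_eq_right, min_eq_left, min_eq_right] <;>
    nlinarith [mul_nonneg (sub_nonneg.2 h1) (sub_nonneg.2 h2)]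

theorem gagliardoSq_sup_add_inf_le {f g : Eu N → ℝ} (hf : Measurable f) (hg : Measurable g) :
    gagliardoSq N s (fun x => max (f x) (g x)) + gagliardoSq N s (fun x => min (f x) (g x)) ≤
      gagliardoSq N s f + gagliardoSq N s g := by
  rw [gagliardoSq_eq_prod s hf, gagliardoSq_eq_prod s hg, gagliardoSq_eq_prod s (hf.max hg),
    gagliardoSq_eq_prod s (hf.min hg),
    ← lintegral_add_left (measurable_gagliardo_integrand s (hf.max hg)),
    ← lintegral_add_left (measurable_gagliardo_integrand s hf)]
  refine lintegral_mono fun z => ?_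
  rw [← ENNReal.ofReal_add (by positivity) (by positivity),
    ← ENNReal.ofReal_add (by positivity) (by positivity)]
  refine ENNReal.ofReal_le_ofReal ?_
  rw [← add_div, ← add_div]
  have := sq_abs_sup_add_sq_abs_inf_le (f z.1) (g z.1) (f z.2) (g z.2)
  gcongr

theorem gagliardoSq_le_liminf {u : ℕ → Eu N → ℝ} {v : Eu N → ℝ} (hu : ∀ n, Measurable (u n))
    (h : ∀ x, Tendsto (fun n => u n x) atTop (𝓝 (v x))) :
    gagliardoSq N s v ≤ liminf (fun n => gagliardoSq N s (u n)) atTop := by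
  have hv : Measurable v := measurable_of_tendsto_metrizable hu (tendsto_pi_nhds.2 h)
  simp_rw [gagliardoSq_eq_prod s hv, fun n => gagliardoSq_eq_prod s (hu n)]
  refine le_trans (le_of_eq ?_) (lintegral_liminf_le fun n =>
    measurable_gagliardo_integrand s (hu n))
  refine lintegral_congr fun z => ?_
  refine (Tendsto.liminf_eq ?_).symm
  exact ENNReal.tendsto_ofReal ((((h z.1).sub (h z.2)).abs.pow 2).div_const _)

theorem gagliardoSq_le_of_tendsto {u : ℕ → Eu N → ℝ} {v : Eu N → ℝ} {C : ℝ≥0∞}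
    (hu : ∀ n, Measurable (u n)) (h : ∀ x, Tendsto (fun n => u n x) atTop (𝓝 (v x)))
    (hC : ∀ n, gagliardoSq N s (u n) ≤ C) : gagliardoSq N s v ≤ C :=
  (gagliardoSq_le_liminf hu h).trans
    ((liminf_le_liminf (Eventually.of_forall hC)).trans (by simp))

/-- Averaging translates against a probability density does not increase the seminorm. -/
theorem gagliardoSq_average_le {φ g : Eu N → ℝ} (hφ : Continuous φ) (hφc : HasCompactSupport φ)
    (hφ0 : ∀ x, 0 ≤ φ x) (hφ1 : ∫ x, φ x = 1) (hg : Continuous g) :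
    gagliardoSq N s (fun x => ∫ t, φ t * g (x - t)) ≤ gagliardoSq N s g := by
  have hInt : ∀ x, Integrable (fun t => φ t * g (x - t)) := fun x =>
    (hφ.mul (hg.comp (by fun_prop))).integrable_of_hasCompactSupport hφc.mul_right
  have hφi : Integrable φ := hφ.integrable_of_hasCompactSupport hφc
  have hφl : ∫⁻ t, ENNReal.ofReal (φ t) = 1 := by
    rw [← ofReal_integral_eq_lintegral_ofReal hφi (Eventually.of_forall hφ0), hφ1]
    simp
  have hjen : ∀ x y, |(∫ t, φ t * g (x - t)) - ∫ t, φ t * g (y - t)| ^ 2 ≤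
      ∫ t, φ t * |g (x - t) - g (y - t)| ^ 2 := by
    intro x y
    rw [← integral_sub (hInt x) (hInt y), sq_abs]
    set w : Eu N → ℝ := fun t => g (x - t) - g (y - t) with hw
    have hwc : Continuous w := by fun_prop
    have h1 : Integrable (fun t => φ t * w t) :=
      (hφ.mul hwc).integrable_of_hasCompactSupport hφc.mul_right
    have h2 : Integrable (fun t => φ t * w t ^ 2) :=
      (hφ.mul (hwc.pow 2)).integrable_of_hasCompactSupport hφc.mul_right
    have h3 : (fun t => φ t * g (x - t) - φ t * g (y - t)) = fun t => φ t * w t := by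
      ext t; simp only [hw]; ring
    have h4 : (fun t => φ t * |g (x - t) - g (y - t)| ^ 2) = fun t => φ t * w t ^ 2 := by
      ext t; simp only [hw, sq_abs]
    rw [h3, h4]
    set m := ∫ t, φ t * w t with hm
    have h5 : 0 ≤ ∫ t, φ t * (w t - m) ^ 2 :=
      integral_nonneg fun t => mul_nonneg (hφ0 t) (sq_nonneg _)
    have h6 : (fun t => φ t * (w t - m) ^ 2) =
        fun t => (φ t * w t ^ 2 - (2 * m) * (φ t * w t)) + m ^ 2 * φ t := by
      ext t; ring
    have h7 : ∫ t, (φ t * w t ^ 2 - (2 * m) * (φ t * w t)) + m ^ 2 * φ t =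
        (∫ t, (φ t * w t ^ 2 - (2 * m) * (φ t * w t))) + ∫ t, m ^ 2 * φ t :=
      integral_add (h2.sub (h1.const_mul _)) (hφi.const_mul _)
    rw [h6, h7, integral_sub h2 (h1.const_mul _), integral_const_mul, integral_const_mul, hφ1,
      ← hm] at h5
    nlinarith
  have hpt : ∀ x y, ENNReal.ofReal (|(∫ t, φ t * g (x - t)) - ∫ t, φ t * g (y - t)| ^ 2 /
      ‖x - y‖ ^ ((N : ℝ) + 2 * s)) ≤ ∫⁻ t, ENNReal.ofReal (φ t) *
      ENNReal.ofReal (|g (x - t) - g (y - t)| ^ 2 / ‖x - y‖ ^ ((N : ℝ) + 2 * s)) := by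
    intro x y
    have h2 : Integrable (fun t => φ t * (|g (x - t) - g (y - t)| ^ 2 /
        ‖x - y‖ ^ ((N : ℝ) + 2 * s))) :=
      (hφ.mul (by fun_prop)).integrable_of_hasCompactSupport hφc.mul_right
    have h3 : ∀ t, ENNReal.ofReal (φ t) * ENNReal.ofReal (|g (x - t) - g (y - t)| ^ 2 /
        ‖x - y‖ ^ ((N : ℝ) + 2 * s)) = ENNReal.ofReal (φ t * (|g (x - t) - g (y - t)| ^ 2 /
        ‖x - y‖ ^ ((N : ℝ) + 2 * s))) := fun t => (ENNReal.ofReal_mul (hφ0 t)).symm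
    simp_rw [h3]
    rw [← ofReal_integral_eq_lintegral_ofReal h2
      (Eventually.of_forall fun t => mul_nonneg (hφ0 t) (by positivity))]
    refine ENNReal.ofReal_le_ofReal ?_
    simp_rw [← mul_div_assoc]
    rw [integral_div]
    have := hjen x y
    gcongr
  have hmeas : Measurable (fun z : (Eu N × Eu N) × Eu N => ENNReal.ofReal (φ z.2) *
      ENNReal.ofReal (|g (z.1.1 - z.2) - g (z.1.2 - z.2)| ^ 2 /
        ‖z.1.1 - z.1.2‖ ^ ((N : ℝ) + 2 * s))) := by
    have := hφ.measurable
    have := hg.measurable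
    fun_prop
  calc gagliardoSq N s (fun x => ∫ t, φ t * g (x - t))
      ≤ ∫⁻ x, ∫⁻ y, ∫⁻ t, ENNReal.ofReal (φ t) *
      ENNReal.ofReal (|g (x - t) - g (y - t)| ^ 2 / ‖x - y‖ ^ ((N : ℝ) + 2 * s)) :=
        lintegral_mono fun x => lintegral_mono fun y => hpt x y
    _ = ∫⁻ z : Eu N × Eu N, ∫⁻ t, ENNReal.ofReal (φ t) *
      ENNReal.ofReal (|g (z.1 - t) - g (z.2 - t)| ^ 2 / ‖z.1 - z.2‖ ^ ((N : ℝ) + 2 * s)) := by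
        rw [Measure.volume_eq_prod, lintegral_prod _ hmeas.lintegral_prod_right'.aemeasurable]
    _ = ∫⁻ t, ∫⁻ z : Eu N × Eu N, ENNReal.ofReal (φ t) *
      ENNReal.ofReal (|g (z.1 - t) - g (z.2 - t)| ^ 2 / ‖z.1 - z.2‖ ^ ((N : ℝ) + 2 * s)) :=
        lintegral_lintegral_swap hmeas.aemeasurable
    _ = ∫⁻ t, ENNReal.ofReal (φ t) * gagliardoSq N s g := by
        refine lintegral_congr fun t => ?_
        rw [lintegral_const_mul' _ _ ENNReal.ofReal_ne_top, ← gagliardoSq_comp_add g (-t),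
          gagliardoSq_eq_prod s (by have := hg.measurable; fun_prop)]
        simp only [sub_eq_add_neg]
    _ = gagliardoSq N s g := by
        rw [lintegral_mul_const _ hφ.measurable.ennreal_ofReal, hφl, one_mul]

end GagliardoBasics

section SobolevConstant

variable {N : ℕ} {s q : ℝ}

theorem volume_ball_eq (x : Eu N) {ρ : ℝ} (hρ : 0 < ρ) :
    volume (Metric.ball x ρ) =
      ENNReal.ofReal (ρ ^ N * (volume (Metric.ball (0 : Eu N) 1)).toReal) := by
  rw [Measure.addHaar_ball_of_pos _ _ hρ, finrank_euclideanSpace_fin, ENNReal.ofReal_mul (by positivity),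
    ENNReal.ofReal_toReal measure_ball_lt_top.ne]

theorem unit_ball_volume_pos : 0 < (volume (Metric.ball (0 : Eu N) 1)).toReal :=
  ENNReal.toReal_pos (Metric.measure_ball_pos _ _ one_pos).ne' measure_ball_lt_top.ne

/-- Pointwise lower bound for the inner integral of the seminorm of a function with unit
`L^q` norm. -/
theorem exists_inner_gagliardo_ge (hN : 1 ≤ N) (hs0 : 0 < s) (hq1 : 1 ≤ q) :
    ∃ c : ℝ, 0 < c ∧ ∀ u : Eu N → ℝ, Measurable u →
      ∫⁻ x, ENNReal.ofReal (|u x| ^ q) = 1 → ∀ x,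
      ENNReal.ofReal (c * |u x| ^ (2 + 2 * s * q / N)) ≤
        ∫⁻ y, ENNReal.ofReal (|u x - u y| ^ 2 / ‖x - y‖ ^ ((N : ℝ) + 2 * s)) := by
  set ω := (volume (Metric.ball (0 : Eu N) 1)).toReal with hω
  have hω0 : 0 < ω := unit_ball_volume_pos
  have hN0 : (0 : ℝ) < N := by exact_mod_cast hN
  have hq0 : 0 < q := by linarith
  refine ⟨1 / 4 * (2 / ω) ^ (-(1 + 2 * s / N)) * 2 ^ (-(2 * s * q / N)), by positivity, ?_⟩
  intro u hu hu1 x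
  rcases (abs_nonneg (u x)).eq_or_lt with h0 | ht
  · rw [← h0, Real.zero_rpow (by positivity)]
    simp
  set t := |u x| with htdef
  set V := (2 / t) ^ q with hV
  have hV0 : 0 < V := by positivity
  set ρ := (2 * V / ω) ^ (1 / (N : ℝ)) with hρ
  have hρ0 : 0 < ρ := by positivity
  have hρN : ρ ^ N * ω = 2 * V := by
    rw [hρ, ← Real.rpow_natCast, ← Real.rpow_mul (by positivity), one_div_mul_cancel hN0.ne',
      Real.rpow_one]
    field_simp
  set G : Set (Eu N) := {y | t / 2 ≤ |u y|} with hG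
  have hGm : MeasurableSet G := measurableSet_le measurable_const hu.abs
  have hGV : volume G ≤ ENNReal.ofReal V := by
    have h1 := mul_meas_ge_le_lintegral₀ (μ := volume)
      (f := fun x => ENNReal.ofReal (|u x| ^ q)) (by fun_prop) (ENNReal.ofReal ((t / 2) ^ q))
    rw [hu1] at h1
    have h2 : G ⊆ {x | ENNReal.ofReal ((t / 2) ^ q) ≤ ENNReal.ofReal (|u x| ^ q)} := by
      intro y hy
      have hy' : t / 2 ≤ |u y| := hy
      exact ENNReal.ofReal_le_ofReal (by gcongr)
    have h3 : ENNReal.ofReal ((t / 2) ^ q) * volume G ≤ 1 :=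
      (mul_le_mul_right (measure_mono h2) _).trans h1
    have h4 : ENNReal.ofReal V * ENNReal.ofReal ((t / 2) ^ q) = 1 := by
      rw [← ENNReal.ofReal_mul hV0.le, hV, ← Real.mul_rpow (by positivity) (by positivity)]
      have : 2 / t * (t / 2) = 1 := by field_simp
      simp [this]
    calc volume G = ENNReal.ofReal V * (ENNReal.ofReal ((t / 2) ^ q) * volume G) := by
          rw [← mul_assoc, h4, one_mul]
      _ ≤ ENNReal.ofReal V * 1 := by gcongr
      _ = ENNReal.ofReal V := mul_one _
  have hdiff : ENNReal.ofReal V ≤ volume (Metric.ball x ρ \ G) := by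
    have h1 : volume (Metric.ball x ρ) = ENNReal.ofReal V + ENNReal.ofReal V := by
      rw [volume_ball_eq x hρ0, hρN, ← ENNReal.ofReal_add hV0.le hV0.le, two_mul]
    have h2 : volume (Metric.ball x ρ) ≤ volume (Metric.ball x ρ \ G) + volume G := by
      refine (measure_mono ?_).trans (measure_union_le _ _)
      intro y hy
      by_cases h : y ∈ G
      · exact Or.inr h
      · exact Or.inl ⟨hy, h⟩
    rw [h1] at h2
    have h3 := h2.trans (add_le_add_right hGV _)
    exact (ENNReal.add_le_add_iff_right ENNReal.ofReal_ne_top).1 h3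
  have hval : 1 / 4 * (2 / ω) ^ (-(1 + 2 * s / N)) * 2 ^ (-(2 * s * q / N)) *
      t ^ (2 + 2 * s * q / N) = (t / 2) ^ 2 / ρ ^ ((N : ℝ) + 2 * s) * V := by
    have e1 : ρ ^ ((N : ℝ) + 2 * s) = (2 / ω) ^ (1 + 2 * s / N) * V ^ (1 + 2 * s / N) := by
      rw [hρ, ← Real.rpow_mul (by positivity), ← Real.mul_rpow (by positivity) hV0.le]
      congr 1
      · ring
      · field_simp
    have e2 : V ^ (1 + 2 * s / N) = V * (2 / t) ^ (2 * s * q / N) := by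
      rw [Real.rpow_add hV0, Real.rpow_one]
      congr 1
      rw [hV, ← Real.rpow_mul (by positivity)]
      congr 1
      ring
    have e3 : t ^ (2 + 2 * s * q / N) = t ^ 2 * t ^ (2 * s * q / N) := by
      rw [Real.rpow_add ht]
      norm_num
    rw [e1, e2, e3, Real.rpow_neg (by positivity), Real.rpow_neg (by positivity),
      Real.div_rpow (by positivity) ht.le]
    have p1 : (0 : ℝ) < 2 ^ (2 * s * q / N) := by positivity
    have p2 : (0 : ℝ) < t ^ (2 * s * q / N) := by positivity
    have p3 : (0 : ℝ) < (2 / ω) ^ (1 + 2 * s / N) := by positivity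
    field_simp
    norm_num
  rw [hval, ENNReal.ofReal_mul (by positivity)]
  calc ENNReal.ofReal ((t / 2) ^ 2 / ρ ^ ((N : ℝ) + 2 * s)) * ENNReal.ofReal V
      ≤ ENNReal.ofReal ((t / 2) ^ 2 / ρ ^ ((N : ℝ) + 2 * s)) * volume (Metric.ball x ρ \ G) := by
        gcongr
    _ = ∫⁻ y in Metric.ball x ρ \ G, ENNReal.ofReal ((t / 2) ^ 2 / ρ ^ ((N : ℝ) + 2 * s)) := by
        rw [setLIntegral_const]
    _ ≤ ∫⁻ y in Metric.ball x ρ \ G,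
          ENNReal.ofReal (|u x - u y| ^ 2 / ‖x - y‖ ^ ((N : ℝ) + 2 * s)) := by
        refine setLIntegral_mono' (Metric.isOpen_ball.measurableSet.diff hGm) fun y hy => ?_
        refine ENNReal.ofReal_le_ofReal ?_
        have hy1 : |u y| < t / 2 := not_le.1 hy.2
        have hxy : x ≠ y := by
          rintro rfl
          rw [← htdef] at hy1
          linarith
        have hxy' : 0 < ‖x - y‖ := norm_pos_iff.2 (sub_ne_zero.2 hxy)
        have hy2 : ‖x - y‖ ≤ ρ := by
          have := hy.1
          rw [Metric.mem_ball, dist_comm, dist_eq_norm] at this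
          exact this.le
        have h3 : t / 2 ≤ |u x - u y| := by
          have := abs_sub_abs_le_abs_sub (u x) (u y)
          rw [← htdef] at this
          linarith
        gcongr
    _ ≤ _ := setLIntegral_le_lintegral _ _

theorem exists_gagliardoSq_ge (hN : 2 ≤ N) (hs0 : 0 < s) (hs1 : s < 1) (hq1 : 1 ≤ q)
    (hq2 : q < 2 * N / ((N : ℝ) - 2 * s)) :
    ∃ c : ℝ, 0 < c ∧ ∀ (Ω : Set (Eu N)) (u : Eu N → ℝ), MeasurableSet Ω → volume Ω ≤ 1 →
      Measurable u → (∀ x, x ∉ Ω → u x = 0) → ∫⁻ x, ENNReal.ofReal (|u x| ^ q) = 1 →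
      ENNReal.ofReal c ≤ gagliardoSq N s u := by
  obtain ⟨c, hc, h⟩ := exists_inner_gagliardo_ge (N := N) (s := s) (by omega) hs0 hq1
  refine ⟨c, hc, fun Ω u hΩ hΩ1 hu hu0 hu1 => ?_⟩
  have hN0 : (2 : ℝ) ≤ N := by exact_mod_cast hN
  set r := 2 + 2 * s * q / N with hr
  have hq0 : 0 < q := by linarith
  have hrq : q ≤ r := by
    rw [lt_div_iff₀ (by linarith)] at hq2
    rw [hr, ← sub_nonneg]
    have : 2 + 2 * s * q / N - q = (2 * N - q * (N - 2 * s)) / N := by field_simp; ring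
    rw [this]
    apply div_nonneg <;> linarith
  have hrq1 : 1 ≤ r / q := by rwa [le_div_iff₀ hq0, one_mul]
  have hur : Measurable fun x => ENNReal.ofReal (|u x| ^ r) := by fun_prop
  have hon : ∫⁻ x in Ω, ENNReal.ofReal (|u x| ^ q) = 1 := by
    rw [← hu1]
    refine setLIntegral_eq_of_support_subset ?_
    intro x hx
    by_contra hxΩ
    apply hx
    simp [hu0 x hxΩ, Real.zero_rpow hq0.ne']
  have hkey : ENNReal.ofReal (r / q) ≤
      (∫⁻ x, ENNReal.ofReal (|u x| ^ r)) + ENNReal.ofReal (r / q - 1) := by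
    calc ENNReal.ofReal (r / q)
        = ∫⁻ x in Ω, ENNReal.ofReal (r / q) * ENNReal.ofReal (|u x| ^ q) := by
          rw [lintegral_const_mul' _ _ ENNReal.ofReal_ne_top, hon, mul_one]
      _ ≤ ∫⁻ x in Ω, ENNReal.ofReal (|u x| ^ r) + ENNReal.ofReal (r / q - 1) := by
          refine lintegral_mono fun x => ?_
          rw [← ENNReal.ofReal_mul (by positivity),
            ← ENNReal.ofReal_add (by positivity) (by linarith)]
          refine ENNReal.ofReal_le_ofReal ?_
          have h1 := one_add_mul_self_le_rpow_one_add (s := |u x| ^ q - 1)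
            (by have : 0 ≤ |u x| ^ q := by positivity
                linarith) hrq1
          have h2 : (1 + (|u x| ^ q - 1)) ^ (r / q) = |u x| ^ r := by
            rw [add_sub_cancel, ← Real.rpow_mul (abs_nonneg _)]
            congr 1
            field_simp
          rw [h2] at h1
          linarith
      _ ≤ (∫⁻ x in Ω, ENNReal.ofReal (|u x| ^ r)) + ENNReal.ofReal (r / q - 1) * volume Ω := by
          rw [lintegral_add_left hur, setLIntegral_const]
      _ ≤ (∫⁻ x, ENNReal.ofReal (|u x| ^ r)) + ENNReal.ofReal (r / q - 1) := by
          gcongr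
          · exact Measure.restrict_le_self
          · exact mul_le_of_le_one_right' hΩ1
  have hone : 1 ≤ ∫⁻ x, ENNReal.ofReal (|u x| ^ r) := by
    have : ENNReal.ofReal (r / q) = 1 + ENNReal.ofReal (r / q - 1) := by
      rw [← ENNReal.ofReal_one, ← ENNReal.ofReal_add zero_le_one (by linarith)]
      congr 1
      ring
    rw [this] at hkey
    exact (ENNReal.add_le_add_iff_right ENNReal.ofReal_ne_top).1 hkey
  calc ENNReal.ofReal c ≤ ENNReal.ofReal c * ∫⁻ x, ENNReal.ofReal (|u x| ^ r) :=
        le_mul_of_one_le_right' hone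
    _ = ∫⁻ x, ENNReal.ofReal (c * |u x| ^ r) := by
        rw [← lintegral_const_mul' _ _ ENNReal.ofReal_ne_top]
        simp_rw [ENNReal.ofReal_mul hc.le]
    _ ≤ gagliardoSq N s u := lintegral_mono fun x => h u hu hu1 x

end SobolevConstant

section TestFunctions

variable {N : ℕ} {s q : ℝ}

theorem integrable_truncated_kernel (hN : 1 ≤ N) (hs0 : 0 < s) (hs1 : s < 1) :
    Integrable (fun h : Eu N => (min ‖h‖ 1) ^ 2 / ‖h‖ ^ ((N : ℝ) + 2 * s)) := by
  have : Nonempty (Fin N) := ⟨⟨0, hN⟩⟩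
  have : Nontrivial (Eu N) := inferInstance
  rw [integrable_fun_norm_addHaar (volume : Measure (Eu N))
    (f := fun r : ℝ => (min r 1) ^ 2 / r ^ ((N : ℝ) + 2 * s)), finrank_euclideanSpace_fin]
  rw [← Set.Ioc_union_Ioi_eq_Ioi (zero_le_one (α := ℝ)), integrableOn_union]
  have hpow : ∀ y : ℝ, 0 < y → y ^ (N - 1) = y ^ ((N : ℝ) - 1) := by
    intro y hy
    rw [← Real.rpow_natCast, Nat.cast_sub hN, Nat.cast_one]
  constructor
  · have h1 : IntegrableOn (fun y : ℝ => y ^ (1 - 2 * s)) (Set.Ioc 0 1) :=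
      (intervalIntegrable_iff_integrableOn_Ioc_of_le zero_le_one).1
        (intervalIntegral.intervalIntegrable_rpow' (by linarith))
    refine h1.congr_fun (fun y hy => ?_) measurableSet_Ioc
    simp only [min_eq_left hy.2, smul_eq_mul]
    rw [hpow y hy.1, ← Real.rpow_natCast y 2, ← Real.rpow_sub hy.1, ← Real.rpow_add hy.1]
    congr 1
    push_cast
    ring
  · have h1 : IntegrableOn (fun y : ℝ => y ^ (-1 - 2 * s)) (Set.Ioi 1) :=
      integrableOn_Ioi_rpow_of_lt (by linarith) one_pos
    refine h1.congr_fun (fun y hy => ?_) measurableSet_Ioi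
    have hy1 : (1 : ℝ) < y := hy
    have hy0 : 0 < y := by linarith
    simp only [min_eq_right hy1.le, smul_eq_mul]
    rw [hpow y hy0, one_pow, one_div, ← Real.rpow_neg hy0.le, ← Real.rpow_add hy0]
    congr 1
    ring

theorem gagliardoSq_lt_top_of_lipschitz (hN : 1 ≤ N) (hs0 : 0 < s) (hs1 : s < 1)
    {u : Eu N → ℝ} {L : ℝ≥0} (hu : LipschitzWith L u) (hc : HasCompactSupport u) :
    gagliardoSq N s u < ∞ := by
  obtain ⟨M, hM⟩ := hc.exists_bound_of_continuous hu.continuous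
  set C : ℝ := max L (2 * M) with hC
  have hC0 : 0 ≤ C := le_max_of_le_left L.2
  set k : Eu N → ℝ := fun h => (min ‖h‖ 1) ^ 2 / ‖h‖ ^ ((N : ℝ) + 2 * s) with hk
  have hkm : Measurable k := by fun_prop
  have hk0 : ∀ h, 0 ≤ k h := fun h => by positivity
  have hJ : ∫⁻ h, ENNReal.ofReal (C ^ 2 * k h) < ∞ := by
    have := ((integrable_truncated_kernel hN hs0 hs1).const_mul (C ^ 2)).lintegral_lt_top
    exact this
  set J := ∫⁻ h, ENNReal.ofReal (C ^ 2 * k h) with hJdef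
  set K := tsupport u
  have hKm : MeasurableSet K := (isClosed_tsupport u).measurableSet
  have hKv : volume K < ∞ := hc.measure_lt_top
  have hdiff : ∀ x y, |u x - u y| ≤ C * min ‖x - y‖ 1 := by
    intro x y
    rcases le_total ‖x - y‖ 1 with h | h
    · rw [min_eq_left h]
      have h1 := hu.dist_le_mul x y
      rw [Real.dist_eq, dist_eq_norm] at h1
      exact h1.trans (by gcongr; exact le_max_left _ _)
    · rw [min_eq_right h, mul_one]
      have h1 := hM x
      have h2 := hM y
      have h3 := abs_sub (u x) (u y)
      rw [Real.norm_eq_abs] at h1 h2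
      exact le_max_of_le_right (by linarith)
  have hpt : ∀ x y, ENNReal.ofReal (|u x - u y| ^ 2 / ‖x - y‖ ^ ((N : ℝ) + 2 * s)) ≤
      K.indicator 1 x * ENNReal.ofReal (C ^ 2 * k (x - y)) +
      K.indicator 1 y * ENNReal.ofReal (C ^ 2 * k (x - y)) := by
    intro x y
    have h1 : ENNReal.ofReal (|u x - u y| ^ 2 / ‖x - y‖ ^ ((N : ℝ) + 2 * s)) ≤
        ENNReal.ofReal (C ^ 2 * k (x - y)) := by
      refine ENNReal.ofReal_le_ofReal ?_
      rw [hk, ← mul_div_assoc, ← mul_pow]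
      have := hdiff x y
      gcongr
    by_cases hx : x ∈ K
    · simp only [Set.indicator_of_mem hx, Pi.one_apply, one_mul]
      exact h1.trans le_self_add
    by_cases hy : y ∈ K
    · simp only [Set.indicator_of_mem hy, Pi.one_apply, one_mul]
      exact h1.trans le_add_self
    · rw [image_eq_zero_of_notMem_tsupport hx, image_eq_zero_of_notMem_tsupport hy]
      simp
  have hm : Measurable fun z : Eu N × Eu N => ENNReal.ofReal (C ^ 2 * k (z.1 - z.2)) := by
    fun_prop
  have hind : Measurable (K.indicator (1 : Eu N → ℝ≥0∞)) := measurable_one.indicator hKm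
  have hIK : ∫⁻ x, K.indicator (1 : Eu N → ℝ≥0∞) x = volume K := lintegral_indicator_one hKm
  have hm1 : Measurable fun z : Eu N × Eu N =>
      K.indicator (1 : Eu N → ℝ≥0∞) z.1 * ENNReal.ofReal (C ^ 2 * k (z.1 - z.2)) :=
    (hind.comp measurable_fst).mul hm
  have hm2 : Measurable fun z : Eu N × Eu N =>
      K.indicator (1 : Eu N → ℝ≥0∞) z.2 * ENNReal.ofReal (C ^ 2 * k (z.1 - z.2)) :=
    (hind.comp measurable_snd).mul hm
  calc gagliardoSq N s u
      ≤ ∫⁻ z : Eu N × Eu N, (K.indicator 1 z.1 * ENNReal.ofReal (C ^ 2 * k (z.1 - z.2)) +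
          K.indicator 1 z.2 * ENNReal.ofReal (C ^ 2 * k (z.1 - z.2))) := by
        rw [gagliardoSq_eq_prod s hu.continuous.measurable]
        exact lintegral_mono fun z => hpt z.1 z.2
    _ = (∫⁻ z : Eu N × Eu N, K.indicator 1 z.1 * ENNReal.ofReal (C ^ 2 * k (z.1 - z.2))) +
        ∫⁻ z : Eu N × Eu N, K.indicator 1 z.2 * ENNReal.ofReal (C ^ 2 * k (z.1 - z.2)) :=
        lintegral_add_left hm1 _
    _ = volume K * J + volume K * J := by
        congr 1
        · rw [Measure.volume_eq_prod, lintegral_prod _ hm1.aemeasurable]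
          have : ∀ x : Eu N, ∫⁻ y, K.indicator 1 x * ENNReal.ofReal (C ^ 2 * k (x - y)) =
              K.indicator 1 x * J := by
            intro x
            rw [lintegral_const_mul _ (by fun_prop),
              lintegral_sub_left_eq_self (fun h => ENNReal.ofReal (C ^ 2 * k h)) x]
          simp_rw [this]
          rw [lintegral_mul_const _ hind, hIK]
        · rw [Measure.volume_eq_prod, lintegral_prod_symm _ hm2.aemeasurable]
          have : ∀ y : Eu N, ∫⁻ x, K.indicator 1 y * ENNReal.ofReal (C ^ 2 * k (x - y)) =
              K.indicator 1 y * J := by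
            intro y
            rw [lintegral_const_mul _ (by fun_prop),
              lintegral_sub_right_eq_self (fun h => ENNReal.ofReal (C ^ 2 * k h)) y]
          simp_rw [this]
          rw [lintegral_mul_const _ hind, hIK]
    _ < ∞ := by
        have := ENNReal.mul_lt_top hKv hJ
        exact ENNReal.add_lt_top.2 ⟨this, this⟩

theorem sobolevConst_bddBelow (Ω : Set (Eu N)) :
    BddBelow { c : ℝ | ∃ u : Eu N → ℝ, ContDiff ℝ (⊤ : ℕ∞) u ∧ HasCompactSupport u ∧
      tsupport u ⊆ Ω ∧ (∫ x in Ω, |u x| ^ q) = 1 ∧ c = gagliardoSqR N s u } := by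
  refine ⟨0, ?_⟩
  rintro c ⟨u, -, -, -, -, rfl⟩
  exact ENNReal.toReal_nonneg

theorem gagliardoSqR_const_mul (c : ℝ) {u : Eu N → ℝ} (hu : Measurable u) :
    gagliardoSqR N s (fun x => c * u x) = c ^ 2 * gagliardoSqR N s u := by
  rw [gagliardoSqR, gagliardoSq_const_mul c hu, ENNReal.toReal_mul,
    ENNReal.toReal_ofReal (sq_nonneg c), gagliardoSqR]

/-- Homogeneous form of the Sobolev inequality for smooth test functions. -/
theorem sobolevConst_mul_le_of_smooth (hq : 0 < q) {Ω : Set (Eu N)} {ψ : Eu N → ℝ}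
    (hψ : ContDiff ℝ (⊤ : ℕ∞) ψ) (hc : HasCompactSupport ψ) (hΩ : tsupport ψ ⊆ Ω) :
    sobolevConst N s q Ω * (∫ x in Ω, |ψ x| ^ q) ^ (2 / q) ≤ gagliardoSqR N s ψ := by
  set J := ∫ x in Ω, |ψ x| ^ q with hJ
  have hJ0 : 0 ≤ J := integral_nonneg fun x => by positivity
  rcases hJ0.eq_or_lt with h0 | hpos
  · rw [← h0, Real.zero_rpow (by positivity), mul_zero]
    exact ENNReal.toReal_nonneg
  set c := J ^ (-(1 / q)) with hcdef
  have hc0 : 0 < c := by positivity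
  have hle : sobolevConst N s q Ω ≤ gagliardoSqR N s (fun x => c * ψ x) := by
    refine csInf_le (sobolevConst_bddBelow Ω) ⟨_, contDiff_const.mul hψ, hc.mul_left, ?_, ?_, rfl⟩
    · exact (closure_mono (Function.support_mul_subset_right _ _)).trans hΩ
    · simp_rw [abs_mul, abs_of_pos hc0, Real.mul_rpow hc0.le (abs_nonneg _)]
      rw [integral_const_mul, ← hJ, hcdef, ← Real.rpow_mul hJ0, neg_mul,
        one_div_mul_cancel hq.ne', Real.rpow_neg_one, inv_mul_cancel₀ hpos.ne']
  rw [gagliardoSqR_const_mul c hψ.continuous.measurable] at hle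
  calc sobolevConst N s q Ω * J ^ (2 / q) ≤ (c ^ 2 * gagliardoSqR N s ψ) * J ^ (2 / q) := by
        gcongr
    _ = (c ^ 2 * J ^ (2 / q)) * gagliardoSqR N s ψ := by ring
    _ = gagliardoSqR N s ψ := by
        have : c ^ 2 * J ^ (2 / q) = 1 := by
          rw [hcdef, ← Real.rpow_natCast, ← Real.rpow_mul hJ0, ← Real.rpow_add hpos]
          have : -(1 / q) * ((2 : ℕ) : ℝ) + 2 / q = 0 := by push_cast; ring
          rw [this, Real.rpow_zero]
        rw [this, one_mul]

theorem exists_smooth_approx {Ω : Set (Eu N)} (hΩ : IsOpen Ω) {g : Eu N → ℝ}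
    (hg : Continuous g) (hgc : HasCompactSupport g) (hgΩ : ∀ x, x ∉ Ω → g x = 0)
    {ε : ℝ} (hε : 0 < ε) :
    ∃ ψ : Eu N → ℝ, ContDiff ℝ (⊤ : ℕ∞) ψ ∧ HasCompactSupport ψ ∧ tsupport ψ ⊆ Ω ∧
      gagliardoSq N s ψ ≤ gagliardoSq N s g ∧ ∀ x, 0 ≤ g x → |ψ x - g x| ≤ 2 * ε := by
  set f : Eu N → ℝ := fun x => max (g x - ε) 0 with hf
  have hfc : Continuous f := by fun_prop
  set K : Set (Eu N) := {x | ε ≤ g x} with hK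
  have hKc : IsCompact K := by
    refine hgc.isCompact.of_isClosed_subset (isClosed_le continuous_const hg) ?_
    intro x hx
    refine subset_tsupport g ?_
    have hx' : ε ≤ g x := hx
    exact ne_of_gt (lt_of_lt_of_le hε hx')
  have hKΩ : K ⊆ Ω := by
    intro x hx
    by_contra h
    have hx' : ε ≤ g x := hx
    rw [hgΩ x h] at hx'
    linarith
  have hf0 : ∀ x, x ∉ K → f x = 0 := by
    intro x hx
    have : g x < ε := not_le.1 hx
    exact max_eq_right (by linarith)
  have hfcs : HasCompactSupport f := HasCompactSupport.intro hKc hf0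
  obtain ⟨δ₁, hδ₁, hδΩ⟩ := hKc.exists_cthickening_subset_open hΩ hKΩ
  obtain ⟨δ₂, hδ₂, hunif⟩ := Metric.uniformContinuous_iff.1
    (hfc.uniformContinuous_of_tendsto_cocompact hfcs.is_zero_at_infty) ε hε
  set δ := min δ₁ δ₂ with hδ
  have hδ0 : 0 < δ := lt_min hδ₁ hδ₂
  set φ : ContDiffBump (0 : Eu N) := ⟨δ / 2, δ, half_pos hδ0, half_lt_self hδ0⟩ with hφ
  set ψ : Eu N → ℝ := convolution (φ.normed volume) f (ContinuousLinearMap.lsmul ℝ ℝ) volume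
    with hψ
  have hψs : ContDiff ℝ (⊤ : ℕ∞) ψ :=
    φ.hasCompactSupport_normed.contDiff_convolution_left _ φ.contDiff_normed hfc.locallyIntegrable
  have hψe : ψ = fun x => ∫ t, φ.normed volume t * f (x - t) := by
    ext x
    simp [hψ, convolution_def]
  have hψd : ∀ x, dist (ψ x) (f x) ≤ ε := by
    intro x
    refine φ.dist_normed_convolution_le hfc.aestronglyMeasurable fun y hy => ?_
    exact (hunif (lt_of_lt_of_le hy (min_le_right _ _))).le
  have hψ0 : ∀ x, x ∉ Metric.cthickening δ K → ψ x = 0 := by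
    intro x hx
    rw [hψe]
    simp only
    rw [← integral_zero (Eu N) ℝ]
    congr 1
    ext t
    by_cases ht : t ∈ Metric.ball (0 : Eu N) δ
    · rw [hf0, mul_zero]
      intro h
      refine hx (Metric.mem_cthickening_of_dist_le x (x - t) δ K h ?_)
      rw [Metric.mem_ball, dist_zero_right] at ht
      rw [dist_eq_norm, sub_sub_cancel]
      exact ht.le
    · have : t ∉ Function.support (φ.normed volume) := by
        rw [φ.support_normed_eq]
        exact ht
      rw [Function.notMem_support.1 this, zero_mul]
  have hψts : tsupport ψ ⊆ Metric.cthickening δ K := by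
    refine closure_minimal (fun x hx => ?_) Metric.isClosed_cthickening
    by_contra h
    exact hx (hψ0 x h)
  refine ⟨ψ, hψs, HasCompactSupport.intro hKc.cthickening hψ0, ?_, ?_, ?_⟩
  · exact hψts.trans ((Metric.cthickening_mono (min_le_left _ _) K).trans hδΩ)
  · rw [hψe]
    refine (gagliardoSq_average_le (φ.contDiff_normed (n := ⊤)).continuous
      φ.hasCompactSupport_normed
      φ.nonneg_normed φ.integral_normed hfc).trans (gagliardoSq_mono fun x y => ?_)
    have := abs_max_sub_max_le_abs (g x - ε) (g y - ε) 0
    simpa [hf] using this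
  · intro x hx
    have h1 := hψd x
    rw [Real.dist_eq] at h1
    have h2 : |f x - g x| ≤ ε := by
      simp only [hf]
      rcases le_total (g x) ε with h | h
      · rw [max_eq_right (by linarith), abs_le]
        constructor <;> linarith
      · rw [max_eq_left (by linarith), abs_le]
        constructor <;> linarith
    have := abs_sub_le (ψ x) (f x) (g x)
    linarith

/-- The Sobolev inequality on `Ω` for continuous nonnegative functions vanishing outside `Ω`. -/
theorem sobolevConst_mul_le (hq : 1 ≤ q) {Ω : Set (Eu N)} (hΩ : IsOpen Ω) (hΩv : volume Ω < ∞)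
    {g : Eu N → ℝ} (hg : Continuous g) (hgc : HasCompactSupport g)
    (hgΩ : ∀ x, x ∉ Ω → g x = 0) (hg0 : ∀ x, 0 ≤ g x) (hgf : gagliardoSq N s g < ∞) :
    sobolevConst N s q Ω * (∫ x, g x ^ q) ^ (2 / q) ≤ gagliardoSqR N s g := by
  have hq0 : 0 < q := by linarith
  have hchoose : ∀ n : ℕ, ∃ ψ : Eu N → ℝ, ContDiff ℝ (⊤ : ℕ∞) ψ ∧ HasCompactSupport ψ ∧
      tsupport ψ ⊆ Ω ∧ gagliardoSq N s ψ ≤ gagliardoSq N s g ∧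
      ∀ x, 0 ≤ g x → |ψ x - g x| ≤ 2 * (1 / ((n : ℝ) + 1)) := fun n =>
    exists_smooth_approx hΩ hg hgc hgΩ (by positivity)
  choose ψ hψs hψc hψΩ hψg hψd using hchoose
  obtain ⟨M, hM⟩ := hgc.exists_bound_of_continuous hg
  have hlim0 : Tendsto (fun n : ℕ => 2 * (1 / ((n : ℝ) + 1))) atTop (𝓝 0) := by
    simpa using (tendsto_one_div_add_atTop_nhds_zero_nat (𝕜 := ℝ)).const_mul 2
  have hptw : ∀ x, Tendsto (fun n => ψ n x) atTop (𝓝 (g x)) := by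
    intro x
    rw [tendsto_iff_dist_tendsto_zero]
    exact squeeze_zero (fun _ => dist_nonneg) (fun n => hψd n x (hg0 x)) hlim0
  have hlim : Tendsto (fun n => ∫ x in Ω, |ψ n x| ^ q) atTop (𝓝 (∫ x in Ω, |g x| ^ q)) := by
    refine tendsto_integral_of_dominated_convergence (fun _ => (M + 2) ^ q) ?_ ?_ ?_ ?_
    · intro n
      exact (((hψs n).continuous.abs.rpow_const fun _ => Or.inr hq0.le)).aestronglyMeasurable
    · exact integrableOn_const hΩv.ne
    · intro n
      refine Eventually.of_forall fun x => ?_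
      rw [Real.norm_of_nonneg (by positivity)]
      have h1 := hψd n x (hg0 x)
      have h2 := hM x
      rw [Real.norm_eq_abs] at h2
      have h3 : 1 / ((n : ℝ) + 1) ≤ 1 := by
        rw [div_le_one (by positivity)]
        linarith [n.cast_nonneg (α := ℝ)]
      have h4 := abs_sub_abs_le_abs_sub (ψ n x) (g x)
      exact Real.rpow_le_rpow (abs_nonneg _) (by linarith) hq0.le
    · exact Eventually.of_forall fun x => (hptw x).abs.rpow_const (Or.inr hq0.le)
  have hgint : ∫ x in Ω, |g x| ^ q = ∫ x, g x ^ q := by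
    rw [setIntegral_eq_integral_of_forall_compl_eq_zero]
    · simp_rw [fun x => abs_of_nonneg (hg0 x)]
    · intro x hx
      rw [hgΩ x hx, abs_zero, Real.zero_rpow hq0.ne']
  rw [hgint] at hlim
  refine le_of_tendsto ((hlim.rpow_const (Or.inr (by positivity))).const_mul _)
    (Eventually.of_forall fun n => ?_)
  exact (sobolevConst_mul_le_of_smooth hq0 (hψs n) (hψc n) (hψΩ n)).trans
    (ENNReal.toReal_mono hgf.ne (hψg n))

/-- The Sobolev constants of sets of volume at most one are uniformly positive. -/
theorem exists_sobolevConst_ge (hN : 2 ≤ N) (hs0 : 0 < s) (hs1 : s < 1) (hq1 : 1 ≤ q)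
    (hq2 : q < 2 * N / ((N : ℝ) - 2 * s)) :
    ∃ c : ℝ, 0 < c ∧ ∀ Ω : Set (Eu N), IsOpen Ω → volume Ω = 1 → c ≤ sobolevConst N s q Ω := by
  obtain ⟨c, hc, h⟩ := exists_gagliardoSq_ge hN hs0 hs1 hq1 hq2
  have hq0 : 0 < q := by linarith
  refine ⟨c, hc, fun Ω hΩ hΩ1 => le_csInf ?_ ?_⟩
  · have hne : Ω.Nonempty := by
      rw [Set.nonempty_iff_ne_empty]
      rintro rfl
      simp at hΩ1
    obtain ⟨x₀, hx₀⟩ := hne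
    obtain ⟨ε, hε, hball⟩ := Metric.isOpen_iff.1 hΩ x₀ hx₀
    set φ : ContDiffBump x₀ := ⟨ε / 4, ε / 2, by positivity, by linarith⟩ with hφ
    have hφc : HasCompactSupport φ := φ.hasCompactSupport
    have hφΩ : tsupport φ ⊆ Ω := by
      rw [φ.tsupport_eq]
      exact (Metric.closedBall_subset_ball (by simp only [hφ]; linarith)).trans hball
    set J := ∫ x in Ω, |φ x| ^ q with hJ
    have hcont : Continuous fun x => |φ x| ^ q :=
      φ.continuous.abs.rpow_const fun _ => Or.inr hq0.le
    have hcs : HasCompactSupport fun x => |φ x| ^ q := by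
      refine hφc.comp_left (g := fun t : ℝ => |t| ^ q) ?_
      rw [abs_zero, Real.zero_rpow hq0.ne']
    have hJ0 : 0 < J := by
      have h1 : J = ∫ x, |φ x| ^ q := by
        rw [hJ, setIntegral_eq_integral_of_forall_compl_eq_zero]
        intro x hx
        rw [image_eq_zero_of_notMem_tsupport fun h => hx (hφΩ h), abs_zero,
          Real.zero_rpow hq0.ne']
      rw [h1]
      refine hcont.integral_pos_of_hasCompactSupport_nonneg_nonzero hcs (fun x => by positivity)
        (x := x₀) ?_
      rw [φ.one_of_mem_closedBall (Metric.mem_closedBall_self φ.rIn_pos.le)]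
      simp
    have hc0 : 0 < J ^ (-(1 / q)) := by positivity
    refine ⟨_, fun x => J ^ (-(1 / q)) * φ x, contDiff_const.mul φ.contDiff, hφc.mul_left, ?_, ?_,
      rfl⟩
    · exact (closure_mono (Function.support_mul_subset_right _ _)).trans hφΩ
    · simp_rw [abs_mul, abs_of_pos hc0, Real.mul_rpow hc0.le (abs_nonneg _)]
      rw [integral_const_mul, ← hJ, ← Real.rpow_mul hJ0.le, neg_mul,
        one_div_mul_cancel hq0.ne', Real.rpow_neg_one, inv_mul_cancel₀ hJ0.ne']
  · rintro b ⟨u, hus, huc, huΩ, hu1, rfl⟩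
    have hu0 : ∀ x, x ∉ Ω → u x = 0 := fun x hx =>
      image_eq_zero_of_notMem_tsupport fun h => hx (huΩ h)
    have hInt : Integrable fun x => |u x| ^ q := by
      refine (hus.continuous.abs.rpow_const fun _ => Or.inr hq0.le).integrable_of_hasCompactSupport
        (huc.comp_left (g := fun t : ℝ => |t| ^ q) ?_)
      rw [abs_zero, Real.zero_rpow hq0.ne']
    have hl : ∫⁻ x, ENNReal.ofReal (|u x| ^ q) = 1 := by
      rw [← ofReal_integral_eq_lintegral_ofReal hInt
        (Eventually.of_forall fun x => by positivity)]
      rw [setIntegral_eq_integral_of_forall_compl_eq_zero] at hu1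
      · rw [hu1, ENNReal.ofReal_one]
      · intro x hx
        rw [hu0 x hx, abs_zero, Real.zero_rpow hq0.ne']
    obtain ⟨L, hL⟩ := ContDiff.lipschitzWith_of_hasCompactSupport huc hus (by simp)
    have hfin := gagliardoSq_lt_top_of_lipschitz (by omega) hs0 hs1 hL huc
    rw [gagliardoSqR, ← ENNReal.ofReal_le_iff_le_toReal hfin.ne]
    exact h Ω u hΩ.measurableSet hΩ1.le hus.continuous.measurable hu0 hl

end TestFunctions

section Polarization

variable {N : ℕ} {s : ℝ}

/-- Reflection across the hyperplane `⟪x, e⟫ = τ` (for a unit vector `e`). -/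
def hrefl (e : Eu N) (τ : ℝ) (x : Eu N) : Eu N := x + (2 * (τ - ⟪x, e⟫)) • e

/-- Polarization of `u` with respect to the half-space `⟪x, e⟫ ≤ τ`. -/
def polarize (e : Eu N) (τ : ℝ) (u : Eu N → ℝ) (x : Eu N) : ℝ :=
  if ⟪x, e⟫ ≤ τ then max (u x) (u (hrefl e τ x)) else min (u x) (u (hrefl e τ x))

/-- The Gaussian weight `e^{-|x|²} - e^{-|σx|²}`, where `σ` is the reflection. -/
def gaussGap (e : Eu N) (τ : ℝ) (x : Eu N) : ℝ :=
  Real.exp (-‖x‖ ^ 2) - Real.exp (-‖hrefl e τ x‖ ^ 2)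

variable {e : Eu N} {τ : ℝ}

theorem continuous_hrefl (e : Eu N) (τ : ℝ) : Continuous (hrefl e τ) := by
  unfold hrefl
  fun_prop

theorem continuous_gaussGap (e : Eu N) (τ : ℝ) : Continuous (gaussGap e τ) := by
  have := continuous_hrefl e τ
  unfold gaussGap
  fun_prop

theorem inner_hrefl (he : ‖e‖ = 1) (x : Eu N) : ⟪hrefl e τ x, e⟫ = 2 * τ - ⟪x, e⟫ := by
  rw [hrefl, inner_add_left, real_inner_smul_left, real_inner_self_eq_norm_sq, he]
  ring

theorem hrefl_hrefl (he : ‖e‖ = 1) (x : Eu N) : hrefl e τ (hrefl e τ x) = x := by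
  rw [hrefl, inner_hrefl he, hrefl, add_assoc, ← add_smul]
  have : 2 * (τ - ⟪x, e⟫) + 2 * (τ - (2 * τ - ⟪x, e⟫)) = 0 := by ring
  rw [this, zero_smul, add_zero]

theorem hrefl_of_inner_eq {x : Eu N} (h : ⟪x, e⟫ = τ) : hrefl e τ x = x := by
  rw [hrefl, h, sub_self, mul_zero, zero_smul, add_zero]

theorem norm_sub_hrefl_sq (he : ‖e‖ = 1) (x y : Eu N) :
    ‖x - hrefl e τ y‖ ^ 2 = ‖x - y‖ ^ 2 + 4 * (τ - ⟪x, e⟫) * (τ - ⟪y, e⟫) := by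
  have h1 : x - hrefl e τ y = (x - y) - (2 * (τ - ⟪y, e⟫)) • e := by
    rw [hrefl]
    abel
  rw [h1, norm_sub_sq_real, real_inner_smul_right, inner_sub_left, norm_smul, he,
    mul_one, Real.norm_eq_abs, sq_abs]
  ring

theorem norm_hrefl_sq (he : ‖e‖ = 1) (x : Eu N) :
    ‖hrefl e τ x‖ ^ 2 = ‖x‖ ^ 2 + 4 * τ * (τ - ⟪x, e⟫) := by
  have := norm_sub_hrefl_sq (τ := τ) he 0 x
  simpa using this

theorem norm_hrefl_sub_hrefl (he : ‖e‖ = 1) (x y : Eu N) :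
    ‖hrefl e τ x - hrefl e τ y‖ = ‖x - y‖ := by
  rw [← sq_eq_sq₀ (norm_nonneg _) (norm_nonneg _), norm_sub_hrefl_sq he, norm_sub_rev,
    norm_sub_hrefl_sq he, inner_hrefl he, norm_sub_rev]
  ring

theorem norm_hrefl_sub (he : ‖e‖ = 1) (x y : Eu N) :
    ‖hrefl e τ x - y‖ = ‖x - hrefl e τ y‖ := by
  rw [← norm_hrefl_sub_hrefl he, hrefl_hrefl he]

theorem measurePreserving_hrefl (he : ‖e‖ = 1) :
    MeasurePreserving (hrefl e τ) (volume : Measure (Eu N)) volume := by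
  have h1 : hrefl e τ = (fun x => x + (2 * τ) • e) ∘
      (Submodule.reflection (Submodule.span ℝ {e})ᗮ) := by
    ext1 x
    simp only [Function.comp_apply, Submodule.reflection_orthogonal_apply,
      Submodule.reflection_singleton_apply, he, hrefl]
    rw [real_inner_comm]
    simp only [mul_sub, sub_smul, mul_smul, two_smul]
    simp
    abel
  rw [h1]
  exact (measurePreserving_add_right volume _).comp (LinearIsometryEquiv.measurePreserving _)

theorem lintegral_comp_hrefl (he : ‖e‖ = 1) (f : Eu N → ℝ≥0∞) :
    ∫⁻ x, f (hrefl e τ x) = ∫⁻ x, f x := by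
  refine (measurePreserving_hrefl he).lintegral_comp_emb ?_ f
  have : Function.Involutive (hrefl e τ) := hrefl_hrefl he
  exact (Homeomorph.mk this.toPerm (continuous_hrefl e τ) (continuous_hrefl e τ)).measurableEmbedding

theorem polarize_of_le {u : Eu N → ℝ} {x : Eu N} (h : ⟪x, e⟫ ≤ τ) :
    polarize e τ u x = max (u x) (u (hrefl e τ x)) := if_pos h

theorem polarize_hrefl_of_le (he : ‖e‖ = 1) {u : Eu N → ℝ} {x : Eu N} (h : ⟪x, e⟫ ≤ τ) :
    polarize e τ u (hrefl e τ x) = min (u x) (u (hrefl e τ x)) := by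
  rcases h.eq_or_lt with h' | h'
  · rw [hrefl_of_inner_eq h', polarize_of_le h, hrefl_of_inner_eq h', max_self, min_self]
  · rw [polarize, if_neg, hrefl_hrefl he, min_comm]
    rw [inner_hrefl he]
    linarith

theorem inner_hrefl_le_or (he : ‖e‖ = 1) (τ : ℝ) (x : Eu N) :
    ⟪x, e⟫ ≤ τ ∨ ⟪hrefl e τ x, e⟫ ≤ τ := by
  rw [inner_hrefl he]
  rcases le_total ⟪x, e⟫ τ with h | h
  · exact Or.inl h
  · exact Or.inr (by linarith)

theorem comp_polarize_add {M : Type*} [AddCommMagma M] (he : ‖e‖ = 1) (F : ℝ → M) (u : Eu N → ℝ)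
    (x : Eu N) : F (polarize e τ u x) + F (polarize e τ u (hrefl e τ x)) =
      F (u x) + F (u (hrefl e τ x)) := by
  have key : ∀ y : Eu N, ⟪y, e⟫ ≤ τ → F (polarize e τ u y) + F (polarize e τ u (hrefl e τ y)) =
      F (u y) + F (u (hrefl e τ y)) := by
    intro y hy
    rw [polarize_of_le hy, polarize_hrefl_of_le he hy]
    rcases le_total (u y) (u (hrefl e τ y)) with h | h
    · rw [max_eq_right h, min_eq_left h, add_comm]
    · rw [max_eq_left h, min_eq_right h]
  rcases inner_hrefl_le_or he τ x with h | h
  · exact key x h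
  · have := key _ h
    rw [hrefl_hrefl he] at this
    rw [add_comm, this, add_comm]

theorem continuous_polarize {u : Eu N → ℝ} (hu : Continuous u) :
    Continuous (polarize e τ u) := by
  have := continuous_hrefl e τ
  refine Continuous.if_le (by fun_prop) (by fun_prop) (by fun_prop) continuous_const ?_
  intro x hx
  rw [hrefl_of_inner_eq hx, max_self, min_self]

theorem measurable_polarize {u : Eu N → ℝ} (hu : Measurable u) :
    Measurable (polarize e τ u) := by
  have := (continuous_hrefl e τ).measurable
  exact Measurable.ite (measurableSet_le (by fun_prop) measurable_const)
    (hu.max (hu.comp this)) (hu.min (hu.comp this))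

/-- Polarization is equimeasurable. -/
theorem lintegral_comp_polarize (he : ‖e‖ = 1) {u : Eu N → ℝ} (hu : Measurable u)
    {F : ℝ → ℝ≥0∞} (hF : Measurable F) :
    ∫⁻ x, F (polarize e τ u x) = ∫⁻ x, F (u x) := by
  have h : ∀ v : Eu N → ℝ, Measurable v →
      2 * ∫⁻ x, F (v x) = ∫⁻ x, (F (v x) + F (v (hrefl e τ x))) := by
    intro v hv
    rw [lintegral_add_left (show Measurable fun x => F (v x) from hF.comp hv),
      lintegral_comp_hrefl he fun x => F (v x), two_mul]
  have h2 : 2 * ∫⁻ x, F (polarize e τ u x) = 2 * ∫⁻ x, F (u x) := by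
    rw [h _ hu, h _ (measurable_polarize hu)]
    exact lintegral_congr fun x => comp_polarize_add he F u x
  exact (ENNReal.mul_right_inj two_ne_zero ENNReal.ofNat_ne_top).1 h2

theorem polarize_eq_zero (he : ‖e‖ = 1) (hτ : 0 ≤ τ) {u : Eu N → ℝ} (hu0 : ∀ x, 0 ≤ u x) {R : ℝ}
    (huR : ∀ x, R < ‖x‖ → u x = 0) {x : Eu N} (hx : R < ‖x‖) :
    polarize e τ u x = 0 := by
  rw [polarize]
  split_ifs with h
  · have h1 : R < ‖hrefl e τ x‖ := by
      refine hx.trans_le ?_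
      rw [← sq_le_sq₀ (norm_nonneg _) (norm_nonneg _), norm_hrefl_sq he]
      nlinarith [mul_nonneg hτ (sub_nonneg.2 h)]
    rw [huR x hx, huR _ h1, max_self]
  · rw [huR x hx, min_eq_left (hu0 _)]

theorem polarize_nonneg {u : Eu N → ℝ} (hu0 : ∀ x, 0 ≤ u x) (x : Eu N) :
    0 ≤ polarize e τ u x := by
  rw [polarize]
  split_ifs
  · exact le_max_of_le_left (hu0 _)
  · exact le_min (hu0 _) (hu0 _)

theorem abs_max_sub_max_le' {a b c d ε : ℝ} (h1 : |a - c| ≤ ε) (h2 : |b - d| ≤ ε) :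
    |max a b - max c d| ≤ ε :=
  (abs_max_sub_max_le_max a b c d).trans (max_le h1 h2)

theorem abs_min_sub_min_le' {a b c d ε : ℝ} (h1 : |a - c| ≤ ε) (h2 : |b - d| ≤ ε) :
    |min a b - min c d| ≤ ε :=
  (abs_min_sub_min_le_max a b c d).trans (max_le h1 h2)

/-- Polarization preserves every uniform modulus of continuity. -/
theorem abs_polarize_sub_le (he : ‖e‖ = 1) {u : Eu N → ℝ} {r ε : ℝ}
    (h : ∀ x y, ‖x - y‖ ≤ r → |u x - u y| ≤ ε) {x y : Eu N} (hxy : ‖x - y‖ ≤ r) :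
    |polarize e τ u x - polarize e τ u y| ≤ ε := by
  have mixed : ∀ x y : Eu N, ⟪x, e⟫ ≤ τ → ¬ ⟪y, e⟫ ≤ τ → ‖x - y‖ ≤ r →
      |polarize e τ u x - polarize e τ u y| ≤ ε := by
    intro x y hx hy hxy
    have h1 : ‖x - hrefl e τ y‖ ≤ r := by
      refine le_trans ?_ hxy
      rw [← sq_le_sq₀ (norm_nonneg _) (norm_nonneg _), norm_sub_hrefl_sq he]
      nlinarith [mul_nonneg (sub_nonneg.2 hx) (sub_nonneg.2 (not_le.1 hy).le)]
    have h2 : ‖hrefl e τ x - y‖ ≤ r := by rwa [norm_hrefl_sub he]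
    have h3 : ‖hrefl e τ x - hrefl e τ y‖ ≤ r := by rwa [norm_hrefl_sub_hrefl he]
    have e1 := h _ _ hxy
    have e2 := h _ _ h1
    have e3 := h _ _ h2
    have e4 := h _ _ h3
    rw [polarize_of_le hx, polarize, if_neg hy]
    rcases max_choice (u x) (u (hrefl e τ x)) with h | h <;>
      rcases min_choice (u y) (u (hrefl e τ y)) with h' | h' <;> rw [h, h'] <;> assumption
  by_cases hx : ⟪x, e⟫ ≤ τ <;> by_cases hy : ⟪y, e⟫ ≤ τ
  · rw [polarize_of_le hx, polarize_of_le hy]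
    exact abs_max_sub_max_le' (h _ _ hxy) (h _ _ (by rwa [norm_hrefl_sub_hrefl he]))
  · exact mixed x y hx hy hxy
  · rw [abs_sub_comm]
    exact mixed y x hy hx (by rwa [norm_sub_rev])
  · rw [polarize, polarize, if_neg hx, if_neg hy]
    exact abs_min_sub_min_le' (h _ _ hxy) (h _ _ (by rwa [norm_hrefl_sub_hrefl he]))

end Polarization

section PolarizationEnergy

variable {N : ℕ} {s : ℝ}

theorem exists_rpow_le_exp (m : ℝ) :
    ∃ C : ℝ, 0 < C ∧ ∀ A : ℝ, 0 ≤ A → (A + 1) ^ m ≤ C * Real.exp (A / 4) := by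
  obtain ⟨n, hn⟩ := exists_nat_ge m
  refine ⟨4 ^ n * n.factorial * Real.exp (1 / 4), by positivity, fun A hA => ?_⟩
  have h1 := Real.pow_div_factorial_le_exp ((A + 1) / 4) (by linarith) n
  rw [div_pow, div_div, div_le_iff₀ (by positivity)] at h1
  calc (A + 1) ^ m ≤ (A + 1) ^ (n : ℝ) := Real.rpow_le_rpow_of_exponent_le (by linarith) hn
    _ = (A + 1) ^ n := Real.rpow_natCast _ _
    _ ≤ Real.exp ((A + 1) / 4) * (4 ^ n * n.factorial) := h1
    _ = 4 ^ n * n.factorial * Real.exp (1 / 4) * Real.exp (A / 4) := by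
        have : (A + 1) / 4 = 1 / 4 + A / 4 := by ring
        rw [this, Real.exp_add]
        ring

/-- Lower bound for the increment of the power kernel. -/
theorem exists_kernel_increment_ge {γ : ℝ} (hγ : 1 ≤ γ) :
    ∃ c : ℝ, 0 < c ∧ ∀ A B : ℝ, 0 < A → 0 ≤ B →
      c * min 1 B * Real.exp (-(A / 4)) ≤ 1 / A ^ γ - 1 / (A + B) ^ γ := by
  obtain ⟨C, hC, hexp⟩ := exists_rpow_le_exp (γ + 1)
  refine ⟨1 / C, by positivity, fun A B hA hB => ?_⟩
  have hAγ : 0 < A ^ γ := by positivity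
  have h1 : (A + B) ^ γ = A ^ γ * (1 + B / A) ^ γ := by
    rw [← Real.mul_rpow hA.le (by positivity)]
    congr 1
    field_simp
  have h2 : 1 + B / A ≤ (1 + B / A) ^ γ :=
    Real.self_le_rpow_of_one_le (by linarith [div_nonneg hB hA.le]) hγ
  have h3 : 1 / (A + B) ^ γ ≤ 1 / A ^ γ * (A / (A + B)) := by
    rw [h1, div_mul_div_comm, one_mul, div_le_div_iff₀ (by positivity) (by positivity)]
    have : A * (1 + B / A) = A + B := by field_simp
    nlinarith [mul_le_mul_of_nonneg_left h2 (mul_pos hA hAγ).le]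
  have h4 : min 1 B / (A + 1) ≤ 1 - A / (A + B) := by
    have : 1 - A / (A + B) = B / (A + B) := by field_simp; ring
    rw [this, div_le_div_iff₀ (by linarith) (by linarith)]
    rcases le_total 1 B with h | h
    · rw [min_eq_left h]; nlinarith
    · rw [min_eq_right h]; nlinarith
  have h5 : Real.exp (-(A / 4)) ≤ C / (A + 1) ^ (γ + 1) := by
    rw [Real.exp_neg, ← one_div, div_le_div_iff₀ (Real.exp_pos _) (by positivity), one_mul]
    exact hexp A hA.le
  have h6 : A ^ γ ≤ (A + 1) ^ γ := Real.rpow_le_rpow hA.le (by linarith) (by linarith)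
  have h7 : (A + 1) ^ (γ + 1) = (A + 1) ^ γ * (A + 1) := by
    rw [Real.rpow_add (by linarith), Real.rpow_one]
  have hm : 0 ≤ min 1 B := le_min zero_le_one hB
  calc 1 / C * min 1 B * Real.exp (-(A / 4)) ≤ 1 / C * min 1 B * (C / (A + 1) ^ (γ + 1)) := by
        gcongr
    _ = 1 / (A + 1) ^ γ * (min 1 B / (A + 1)) := by
        rw [h7]
        field_simp
    _ ≤ 1 / A ^ γ * (1 - A / (A + B)) := by gcongr
    _ ≤ _ := by rw [mul_sub, mul_one]; linarith

theorem gaussGap_eq {e : Eu N} {τ : ℝ} (he : ‖e‖ = 1) (x : Eu N) :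
    gaussGap e τ x = Real.exp (-‖x‖ ^ 2) * (1 - Real.exp (-(4 * τ * (τ - ⟪x, e⟫)))) := by
  have h : ∀ A : ℝ, -(‖x‖ ^ 2 + A) = -‖x‖ ^ 2 + -A := fun A => by ring
  rw [gaussGap, norm_hrefl_sq he, h, Real.exp_add]
  ring

theorem gaussGap_nonneg {e : Eu N} {τ : ℝ} (he : ‖e‖ = 1) (hτ : 0 ≤ τ) {x : Eu N}
    (hx : ⟪x, e⟫ ≤ τ) : 0 ≤ gaussGap e τ x := by
  rw [gaussGap_eq he]
  refine mul_nonneg (Real.exp_pos _).le (sub_nonneg.2 (Real.exp_le_one_iff.2 ?_))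
  have := mul_nonneg hτ (sub_nonneg.2 hx)
  linarith

theorem gaussGap_le {e : Eu N} {τ : ℝ} (he : ‖e‖ = 1) (hτ : 0 < τ) {x : Eu N}
    (hx : ⟪x, e⟫ ≤ τ) :
    gaussGap e τ x ≤ 8 * min 1 τ * (min 1 (τ - ⟪x, e⟫) * Real.exp (-(‖x‖ ^ 2 / 2))) := by
  set d := τ - ⟪x, e⟫ with hd
  have hd0 : 0 ≤ d := sub_nonneg.2 hx
  have hE : 1 + ‖x‖ ≤ 2 * Real.exp (‖x‖ ^ 2 / 2) := by
    have := Real.add_one_le_exp (‖x‖ ^ 2 / 2)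
    nlinarith [sq_nonneg (‖x‖ - 1 / 2)]
  have hE1 : 1 ≤ Real.exp (‖x‖ ^ 2 / 2) := Real.one_le_exp (by positivity)
  have hin : |⟪x, e⟫| ≤ ‖x‖ := by
    have := abs_real_inner_le_norm x e
    rwa [he, mul_one] at this
  have h1 := abs_le.1 hin
  have hb1 : 1 - Real.exp (-(4 * τ * d)) ≤ 1 := by linarith [Real.exp_pos (-(4 * τ * d))]
  have hb2 : 1 - Real.exp (-(4 * τ * d)) ≤ 4 * τ * d := by
    linarith [Real.add_one_le_exp (-(4 * τ * d))]
  have key : 1 - Real.exp (-(4 * τ * d)) ≤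
      8 * min 1 τ * (min 1 d * Real.exp (‖x‖ ^ 2 / 2)) := by
    have hx0 := norm_nonneg x
    rcases le_total 1 τ with a | a <;> rcases le_total 1 d with b | b <;>
      simp only [a, b, min_eq_left, min_eq_right]
    · linarith
    · have : d * τ ≤ d * (2 * Real.exp (‖x‖ ^ 2 / 2)) :=
        mul_le_mul_of_nonneg_left (by linarith) hd0
      linarith
    · have : τ * d ≤ τ * (2 * Real.exp (‖x‖ ^ 2 / 2)) :=
        mul_le_mul_of_nonneg_left (by linarith) hτ.le
      linarith
    · have : τ * d * 1 ≤ τ * d * Real.exp (‖x‖ ^ 2 / 2) := by gcongr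
      nlinarith [mul_nonneg hτ.le hd0]
  rw [gaussGap_eq he, ← hd]
  have hsplit : Real.exp (-‖x‖ ^ 2) * Real.exp (‖x‖ ^ 2 / 2) = Real.exp (-(‖x‖ ^ 2 / 2)) := by
    rw [← Real.exp_add]
    congr 1
    ring
  calc Real.exp (-‖x‖ ^ 2) * (1 - Real.exp (-(4 * τ * d)))
      ≤ Real.exp (-‖x‖ ^ 2) * (8 * min 1 τ * (min 1 d * Real.exp (‖x‖ ^ 2 / 2))) := by gcongr
    _ = 8 * min 1 τ * (min 1 d * (Real.exp (-‖x‖ ^ 2) * Real.exp (‖x‖ ^ 2 / 2))) := by ring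
    _ = _ := by rw [hsplit]

theorem exists_reflected_kernel_gap_ge (hN : 2 ≤ N) (hs0 : 0 < s) :
    ∃ c : ℝ, 0 < c ∧ ∀ (e : Eu N) (τ : ℝ), ‖e‖ = 1 → 0 < τ → ∀ x y : Eu N, x ≠ y →
      ⟪x, e⟫ ≤ τ → ⟪y, e⟫ ≤ τ →
      c / (min 1 τ) ^ 2 * (gaussGap e τ x * gaussGap e τ y) ≤
        1 / ‖x - y‖ ^ ((N : ℝ) + 2 * s) - 1 / ‖x - hrefl e τ y‖ ^ ((N : ℝ) + 2 * s) := by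
  have hN2 : (2 : ℝ) ≤ N := by exact_mod_cast hN
  set γ := ((N : ℝ) + 2 * s) / 2 with hγ
  obtain ⟨c, hc, h⟩ := exists_kernel_increment_ge (γ := γ) (by rw [hγ]; linarith)
  refine ⟨c / 64, by positivity, fun e τ he hτ x y hxy hx hy => ?_⟩
  have hpow : ∀ a : ℝ, 0 ≤ a → a ^ ((N : ℝ) + 2 * s) = (a ^ 2) ^ γ := by
    intro a ha
    rw [← Real.rpow_natCast, ← Real.rpow_mul ha, hγ]
    congr 1
    push_cast
    ring
  rw [hpow _ (norm_nonneg _), hpow _ (norm_nonneg _), norm_sub_hrefl_sq he]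
  set d := τ - ⟪x, e⟫ with hd
  set d' := τ - ⟪y, e⟫ with hd'
  have hd0 : 0 ≤ d := sub_nonneg.2 hx
  have hd0' : 0 ≤ d' := sub_nonneg.2 hy
  have hA : 0 < ‖x - y‖ ^ 2 := by
    have : 0 < ‖x - y‖ := norm_pos_iff.2 (sub_ne_zero.2 hxy)
    positivity
  refine le_trans ?_ (h _ (4 * d * d') hA (by positivity))
  have hm0 : 0 < min 1 τ := lt_min one_pos hτ
  have g1 := gaussGap_le he hτ hx
  have g2 := gaussGap_le he hτ hy
  rw [← hd] at g1
  rw [← hd'] at g2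
  have hmin : min 1 d * min 1 d' ≤ min 1 (4 * d * d') := by
    refine le_min ?_ ?_
    · exact mul_le_one₀ (min_le_left _ _) (le_min zero_le_one hd0') (min_le_left _ _)
    · calc min 1 d * min 1 d' ≤ d * d' :=
          mul_le_mul (min_le_right _ _) (min_le_right _ _) (le_min zero_le_one hd0') hd0
        _ ≤ 4 * d * d' := by nlinarith [mul_nonneg hd0 hd0']
  have hexp : Real.exp (-(‖x‖ ^ 2 / 2)) * Real.exp (-(‖y‖ ^ 2 / 2)) ≤
      Real.exp (-(‖x - y‖ ^ 2 / 4)) := by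
    rw [← Real.exp_add]
    refine Real.exp_le_exp.2 ?_
    have := parallelogram_law_with_norm ℝ x y
    nlinarith [sq_nonneg ‖x + y‖]
  calc c / 64 / min 1 τ ^ 2 * (gaussGap e τ x * gaussGap e τ y)
      ≤ c / 64 / min 1 τ ^ 2 * ((8 * min 1 τ * (min 1 d * Real.exp (-(‖x‖ ^ 2 / 2)))) *
        (8 * min 1 τ * (min 1 d' * Real.exp (-(‖y‖ ^ 2 / 2))))) := by
        refine mul_le_mul_of_nonneg_left ?_ (by positivity)
        exact mul_le_mul g1 g2 (gaussGap_nonneg he hτ.le hy) (by positivity)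
    _ = c * (min 1 d * min 1 d') *
        (Real.exp (-(‖x‖ ^ 2 / 2)) * Real.exp (-(‖y‖ ^ 2 / 2))) := by
        field_simp
        norm_num
    _ ≤ c * min 1 (4 * d * d') * Real.exp (-(‖x - y‖ ^ 2 / 4)) := by gcongr

/-- Sum of the Gagliardo integrand over the four points obtained by reflecting the variables. -/
def fourPoint (N : ℕ) (s : ℝ) (e : Eu N) (τ : ℝ) (v : Eu N → ℝ) (x y : Eu N) : ℝ :=
  |v x - v y| ^ 2 / ‖x - y‖ ^ ((N : ℝ) + 2 * s) +
  |v (hrefl e τ x) - v y| ^ 2 / ‖hrefl e τ x - y‖ ^ ((N : ℝ) + 2 * s) +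
  |v x - v (hrefl e τ y)| ^ 2 / ‖x - hrefl e τ y‖ ^ ((N : ℝ) + 2 * s) +
  |v (hrefl e τ x) - v (hrefl e τ y)| ^ 2 / ‖hrefl e τ x - hrefl e τ y‖ ^ ((N : ℝ) + 2 * s)

theorem fourPoint_nonneg (e : Eu N) (τ : ℝ) (v : Eu N → ℝ) (x y : Eu N) :
    0 ≤ fourPoint N s e τ v x y := by
  unfold fourPoint
  positivity

theorem fourPoint_hrefl_left {e : Eu N} {τ : ℝ} (he : ‖e‖ = 1) (v : Eu N → ℝ) (x y : Eu N) :
    fourPoint N s e τ v (hrefl e τ x) y = fourPoint N s e τ v x y := by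
  simp only [fourPoint, hrefl_hrefl he]
  ring

theorem fourPoint_hrefl_right {e : Eu N} {τ : ℝ} (he : ‖e‖ = 1) (v : Eu N → ℝ) (x y : Eu N) :
    fourPoint N s e τ v x (hrefl e τ y) = fourPoint N s e τ v x y := by
  simp only [fourPoint, hrefl_hrefl he]
  ring

theorem measurable_fourPoint (e : Eu N) (τ : ℝ) {v : Eu N → ℝ} (hv : Measurable v) :
    Measurable (fun z : Eu N × Eu N => fourPoint N s e τ v z.1 z.2) := by
  have := (continuous_hrefl e τ).measurable
  unfold fourPoint
  fun_prop

theorem lintegral_fourPoint {e : Eu N} {τ : ℝ} (he : ‖e‖ = 1) {v : Eu N → ℝ} (hv : Measurable v) :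
    ∫⁻ x, ∫⁻ y, ENNReal.ofReal (fourPoint N s e τ v x y) = 4 * gagliardoSq N s v := by
  set Q : Eu N → Eu N → ℝ≥0∞ := fun x y =>
    ENNReal.ofReal (|v x - v y| ^ 2 / ‖x - y‖ ^ ((N : ℝ) + 2 * s)) with hQ
  have hσ := (continuous_hrefl e τ).measurable
  have hQm : Measurable (fun z : Eu N × Eu N => Q z.1 z.2) := measurable_gagliardo_integrand s hv
  have hpt : ∀ x y, ENNReal.ofReal (fourPoint N s e τ v x y) =
      Q x y + Q (hrefl e τ x) y + Q x (hrefl e τ y) + Q (hrefl e τ x) (hrefl e τ y) := by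
    intro x y
    rw [fourPoint, ENNReal.ofReal_add (by positivity) (by positivity),
      ENNReal.ofReal_add (by positivity) (by positivity),
      ENNReal.ofReal_add (by positivity) (by positivity)]
  have m1 : ∀ x, Measurable fun y => Q x y := fun x => by simp only [hQ]; fun_prop
  have m2 : ∀ x, Measurable fun y => Q x (hrefl e τ y) := fun x => (m1 x).comp hσ
  have hin : ∀ x, ∫⁻ y, ENNReal.ofReal (fourPoint N s e τ v x y) =
      2 * (∫⁻ y, Q x y) + 2 * ∫⁻ y, Q (hrefl e τ x) y := by
    intro x
    simp_rw [hpt]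
    rw [lintegral_add_right _ (m2 _), lintegral_add_right _ (m2 _), lintegral_add_right _ (m1 _),
      lintegral_comp_hrefl he fun y => Q x y,
      lintegral_comp_hrefl he fun y => Q (hrefl e τ x) y]
    ring
  have m3 : Measurable fun x => ∫⁻ y, Q x y := hQm.lintegral_prod_right'
  simp_rw [hin]
  rw [lintegral_add_left (m3.const_mul 2), lintegral_const_mul _ m3,
    lintegral_const_mul _ (show Measurable fun x => ∫⁻ y, Q (hrefl e τ x) y from m3.comp hσ),
    lintegral_comp_hrefl he fun x => ∫⁻ y, Q x y, ← add_mul]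
  have : gagliardoSq N s v = ∫⁻ x, ∫⁻ y, Q x y := rfl
  rw [this]
  norm_num

theorem four_point_ineq {a a' b b' k₁ k₂ : ℝ} (hk : k₂ ≤ k₁) :
    k₁ * |max a a' - max b b'| ^ 2 + k₂ * |min a a' - max b b'| ^ 2 +
      k₂ * |max a a' - min b b'| ^ 2 + k₁ * |min a a' - min b b'| ^ 2 +
      2 * (k₁ - k₂) * (max (a - a') 0 * max (a' - a) 0 + max (a - a') 0 * max (b' - b) 0) ≤
    k₁ * |a - b| ^ 2 + k₂ * |a' - b| ^ 2 + k₂ * |a - b'| ^ 2 + k₁ * |a' - b'| ^ 2 := by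
  simp only [sq_abs]
  have hk0 : 0 ≤ k₁ - k₂ := sub_nonneg.2 hk
  rcases le_total a a' with h1 | h1 <;> rcases le_total b b' with h2 | h2
  · rw [max_eq_right h1, min_eq_left h1, max_eq_right h2, min_eq_left h2,
      max_eq_right (sub_nonpos.2 h1)]
    nlinarith
  · rw [max_eq_right h1, min_eq_left h1, max_eq_left h2, min_eq_right h2,
      max_eq_right (sub_nonpos.2 h1)]
    nlinarith [mul_nonneg hk0 (mul_nonneg (sub_nonneg.2 h1) (sub_nonneg.2 h2))]
  · rw [max_eq_left h1, min_eq_right h1, max_eq_right h2, min_eq_left h2,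
      max_eq_left (sub_nonneg.2 h1), max_eq_right (sub_nonpos.2 h1), max_eq_left (sub_nonneg.2 h2)]
    nlinarith
  · rw [max_eq_left h1, min_eq_right h1, max_eq_left h2, min_eq_right h2,
      max_eq_right (sub_nonpos.2 h1), max_eq_right (sub_nonpos.2 h2)]
    nlinarith

theorem fourPoint_polarize_le {e : Eu N} {τ : ℝ} (he : ‖e‖ = 1) (hp : 0 ≤ (N : ℝ) + 2 * s)
    {u : Eu N → ℝ} {x y : Eu N} (hx : ⟪x, e⟫ ≤ τ) (hy : ⟪y, e⟫ ≤ τ) :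
    fourPoint N s e τ (polarize e τ u) x y +
      2 * (1 / ‖x - y‖ ^ ((N : ℝ) + 2 * s) - 1 / ‖x - hrefl e τ y‖ ^ ((N : ℝ) + 2 * s)) *
      (max (u x - u (hrefl e τ x)) 0 * max (u (hrefl e τ y) - u y) 0) ≤
      fourPoint N s e τ u x y := by
  simp only [fourPoint, norm_hrefl_sub_hrefl he, norm_hrefl_sub he, polarize_of_le hx,
    polarize_of_le hy, polarize_hrefl_of_le he hx, polarize_hrefl_of_le he hy]
  rcases eq_or_ne x y with rfl | hxy
  · have h0 : max (u x - u (hrefl e τ x)) 0 * max (u (hrefl e τ x) - u x) 0 = 0 := by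
      rcases le_total (u x) (u (hrefl e τ x)) with h | h
      · rw [max_eq_right (sub_nonpos.2 h), zero_mul]
      · rw [max_eq_right (sub_nonpos.2 h), mul_zero]
    rw [h0, mul_zero, add_zero]
    rcases le_total (u x) (u (hrefl e τ x)) with h | h <;> simp [h, abs_sub_comm]
  · have hA : 0 < ‖x - y‖ := norm_pos_iff.2 (sub_ne_zero.2 hxy)
    have hk : 1 / ‖x - hrefl e τ y‖ ^ ((N : ℝ) + 2 * s) ≤ 1 / ‖x - y‖ ^ ((N : ℝ) + 2 * s) := by
      have : ‖x - y‖ ≤ ‖x - hrefl e τ y‖ := by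
        rw [← sq_le_sq₀ (norm_nonneg _) (norm_nonneg _), norm_sub_hrefl_sq he]
        nlinarith [mul_nonneg (sub_nonneg.2 hx) (sub_nonneg.2 hy)]
      gcongr
    have h := four_point_ineq (a := u x) (a' := u (hrefl e τ x)) (b := u y)
      (b' := u (hrefl e τ y)) hk
    have h0 : 0 ≤ 2 * (1 / ‖x - y‖ ^ ((N : ℝ) + 2 * s) -
        1 / ‖x - hrefl e τ y‖ ^ ((N : ℝ) + 2 * s)) *
        (max (u x - u (hrefl e τ x)) 0 * max (u (hrefl e τ x) - u x) 0) :=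
      mul_nonneg (mul_nonneg zero_le_two (sub_nonneg.2 hk))
        (mul_nonneg (le_max_right _ _) (le_max_right _ _))
    rw [mul_add] at h
    simp only [one_div, inv_mul_eq_div] at h h0 ⊢
    linarith

theorem fourPoint_polarize_le' {e : Eu N} {τ : ℝ} (he : ‖e‖ = 1) (hp : 0 ≤ (N : ℝ) + 2 * s)
    (u : Eu N → ℝ) (x y : Eu N) :
    fourPoint N s e τ (polarize e τ u) x y ≤ fourPoint N s e τ u x y := by
  have key : ∀ x y : Eu N, ⟪x, e⟫ ≤ τ → ⟪y, e⟫ ≤ τ →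
      fourPoint N s e τ (polarize e τ u) x y ≤ fourPoint N s e τ u x y := by
    intro x y hx hy
    rcases eq_or_ne x y with rfl | hxy
    · have := fourPoint_polarize_le he hp (u := u) hx hx
      have h0 : max (u x - u (hrefl e τ x)) 0 * max (u (hrefl e τ x) - u x) 0 = 0 := by
        rcases le_total (u x) (u (hrefl e τ x)) with h | h
        · rw [max_eq_right (sub_nonpos.2 h), zero_mul]
        · rw [max_eq_right (sub_nonpos.2 h), mul_zero]
      rwa [h0, mul_zero, add_zero] at this
    · have := fourPoint_polarize_le he hp (u := u) hx hy
      refine le_trans (le_add_of_nonneg_right (mul_nonneg (mul_nonneg zero_le_two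
        (sub_nonneg.2 ?_)) (mul_nonneg (le_max_right _ _) (le_max_right _ _)))) this
      have hA : 0 < ‖x - y‖ := norm_pos_iff.2 (sub_ne_zero.2 hxy)
      have : ‖x - y‖ ≤ ‖x - hrefl e τ y‖ := by
        rw [← sq_le_sq₀ (norm_nonneg _) (norm_nonneg _), norm_sub_hrefl_sq he]
        nlinarith [mul_nonneg (sub_nonneg.2 hx) (sub_nonneg.2 hy)]
      gcongr
  rcases inner_hrefl_le_or he τ x with hx | hx <;> rcases inner_hrefl_le_or he τ y with hy | hy
  · exact key _ _ hx hy
  · simpa only [fourPoint_hrefl_right he] using key _ _ hx hy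
  · simpa only [fourPoint_hrefl_left he] using key _ _ hx hy
  · simpa only [fourPoint_hrefl_left he, fourPoint_hrefl_right he] using key _ _ hx hy

/-- Weighted mass of the positive part of `u - u ∘ σ` in the half-space. -/
def polPlus (e : Eu N) (τ : ℝ) (u : Eu N → ℝ) : ℝ≥0∞ :=
  ∫⁻ x in {x : Eu N | ⟪x, e⟫ ≤ τ},
    ENNReal.ofReal (gaussGap e τ x * max (u x - u (hrefl e τ x)) 0)

/-- Weighted mass of the negative part of `u - u ∘ σ` in the half-space. -/
def polMinus (e : Eu N) (τ : ℝ) (u : Eu N → ℝ) : ℝ≥0∞ :=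
  ∫⁻ x in {x : Eu N | ⟪x, e⟫ ≤ τ},
    ENNReal.ofReal (gaussGap e τ x * max (u (hrefl e τ x) - u x) 0)

theorem measurableSet_halfspace (e : Eu N) (τ : ℝ) : MeasurableSet {x : Eu N | ⟪x, e⟫ ≤ τ} :=
  measurableSet_le (by fun_prop) measurable_const

theorem lintegral_const_mul_mul_mul {f g : Eu N → ℝ≥0∞} (hf : Measurable f) (hg : Measurable g)
    (k : ℝ≥0∞) : ∫⁻ x, ∫⁻ y, k * (f x * g y) = k * ((∫⁻ x, f x) * ∫⁻ y, g y) := by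
  have h : ∀ x, ∫⁻ y, k * (f x * g y) = k * (f x * ∫⁻ y, g y) := fun x => by
    rw [lintegral_const_mul _ (hg.const_mul _), lintegral_const_mul _ hg]
  simp only [h]
  rw [lintegral_const_mul _ (hf.mul_const _), lintegral_mul_const _ hf]

theorem lintegral_lintegral_add_le {F G K : Eu N → Eu N → ℝ≥0∞}
    (hF : Measurable fun p : Eu N × Eu N => F p.1 p.2) (h : ∀ x y, F x y + G x y ≤ K x y) :
    (∫⁻ x, ∫⁻ y, F x y) + ∫⁻ x, ∫⁻ y, G x y ≤ ∫⁻ x, ∫⁻ y, K x y := by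
  rw [← lintegral_add_left hF.lintegral_prod_right']
  refine lintegral_mono fun x => ?_
  have hFx : Measurable fun y => F x y := hF.comp measurable_prodMk_left
  rw [← lintegral_add_left hFx]
  exact lintegral_mono fun y => h x y

/-- Polarization decreases the energy, quantitatively. -/
theorem exists_gagliardoSq_polarize_add_le (hN : 2 ≤ N) (hs0 : 0 < s) :
    ∃ c : ℝ, 0 < c ∧ ∀ (e : Eu N) (τ : ℝ), ‖e‖ = 1 → 0 < τ → ∀ u : Eu N → ℝ, Measurable u →
      gagliardoSq N s (polarize e τ u) +
        ENNReal.ofReal (c / (min 1 τ) ^ 2) * (polPlus e τ u * polMinus e τ u) ≤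
        gagliardoSq N s u := by
  obtain ⟨c, hc, hker⟩ := exists_reflected_kernel_gap_ge (N := N) hN hs0
  refine ⟨c / 2, by positivity, fun e τ he hτ u hu => ?_⟩
  have hp : 0 ≤ (N : ℝ) + 2 * s := by positivity
  set H : Set (Eu N) := {x | ⟪x, e⟫ ≤ τ} with hH
  have hHm : MeasurableSet H := measurableSet_halfspace e τ
  have hσ := (continuous_hrefl e τ).measurable
  have hG := (continuous_gaussGap e τ).measurable
  set fp : Eu N → ℝ≥0∞ := fun x =>
    H.indicator (fun x => ENNReal.ofReal (gaussGap e τ x * max (u x - u (hrefl e τ x)) 0)) x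
    with hfp
  set fm : Eu N → ℝ≥0∞ := fun x =>
    H.indicator (fun x => ENNReal.ofReal (gaussGap e τ x * max (u (hrefl e τ x) - u x) 0)) x
    with hfm
  have hfpm : Measurable fp := Measurable.indicator (by fun_prop) hHm
  have hfmm : Measurable fm := Measurable.indicator (by fun_prop) hHm
  have hP : polPlus e τ u = ∫⁻ x, fp x := (lintegral_indicator hHm _).symm
  have hM : polMinus e τ u = ∫⁻ x, fm x := (lintegral_indicator hHm _).symm
  set κ := 2 * (c / min 1 τ ^ 2) with hκ
  have hκ0 : 0 ≤ κ := by positivity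
  have hpt : ∀ x y, ENNReal.ofReal (fourPoint N s e τ (polarize e τ u) x y) +
      ENNReal.ofReal κ * (fp x * fm y) ≤ ENNReal.ofReal (fourPoint N s e τ u x y) := by
    intro x y
    by_cases hx : x ∈ H
    swap
    · simp only [hfp, Set.indicator_of_notMem hx, zero_mul, mul_zero, add_zero]
      exact ENNReal.ofReal_le_ofReal (fourPoint_polarize_le' he hp u x y)
    by_cases hy : y ∈ H
    swap
    · simp only [hfm, Set.indicator_of_notMem hy, mul_zero, add_zero]
      exact ENNReal.ofReal_le_ofReal (fourPoint_polarize_le' he hp u x y)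
    have gx := gaussGap_nonneg he hτ.le hx
    have gy := gaussGap_nonneg he hτ.le hy
    simp only [hfp, hfm, Set.indicator_of_mem hx, Set.indicator_of_mem hy]
    have a1 : 0 ≤ max (u x - u (hrefl e τ x)) 0 := le_max_right _ _
    have a2 : 0 ≤ max (u (hrefl e τ y) - u y) 0 := le_max_right _ _
    rw [← ENNReal.ofReal_mul (by positivity), ← ENNReal.ofReal_mul hκ0,
      ← ENNReal.ofReal_add (fourPoint_nonneg _ _ _ _ _) (by positivity)]
    refine ENNReal.ofReal_le_ofReal (le_trans ?_ (fourPoint_polarize_le he hp hx hy))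
    refine add_le_add le_rfl ?_
    rcases eq_or_ne x y with rfl | hxy
    · have h0 : max (u x - u (hrefl e τ x)) 0 * max (u (hrefl e τ x) - u x) 0 = 0 := by
        rcases le_total (u x) (u (hrefl e τ x)) with h | h
        · rw [max_eq_right (sub_nonpos.2 h), zero_mul]
        · rw [max_eq_right (sub_nonpos.2 h), mul_zero]
      have h1 : gaussGap e τ x * max (u x - u (hrefl e τ x)) 0 *
          (gaussGap e τ x * max (u (hrefl e τ x) - u x) 0) = 0 := by
        rw [mul_mul_mul_comm, h0, mul_zero]
      rw [h0, mul_zero, h1, mul_zero]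
    · have hk := hker e τ he hτ x y hxy hx hy
      calc κ * (gaussGap e τ x * max (u x - u (hrefl e τ x)) 0 *
            (gaussGap e τ y * max (u (hrefl e τ y) - u y) 0))
          = 2 * (c / min 1 τ ^ 2 * (gaussGap e τ x * gaussGap e τ y)) *
            (max (u x - u (hrefl e τ x)) 0 * max (u (hrefl e τ y) - u y) 0) := by
            rw [hκ]; ring
        _ ≤ _ := by gcongr
  have hInt : 4 * gagliardoSq N s (polarize e τ u) +
      ENNReal.ofReal κ * (polPlus e τ u * polMinus e τ u) ≤ 4 * gagliardoSq N s u := by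
    rw [← lintegral_fourPoint he (measurable_polarize hu), ← lintegral_fourPoint he hu, hP, hM]
    have hm4 := measurable_fourPoint (s := s) e τ (measurable_polarize (e := e) (τ := τ) hu)
    have e1 : ENNReal.ofReal κ * ((∫⁻ x, fp x) * ∫⁻ x, fm x) =
        ∫⁻ x, ∫⁻ y, ENNReal.ofReal κ * (fp x * fm y) := by
      exact (lintegral_const_mul_mul_mul hfpm hfmm _).symm
    rw [e1]
    exact lintegral_lintegral_add_le
      (F := fun x y => ENNReal.ofReal (fourPoint N s e τ (polarize e τ u) x y))
      hm4.ennreal_ofReal hpt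
  have h4 : ENNReal.ofReal κ = 4 * ENNReal.ofReal (c / 2 / min 1 τ ^ 2) := by
    have : (4 : ℝ≥0∞) = ENNReal.ofReal 4 := by simp
    rw [this, ← ENNReal.ofReal_mul (by norm_num), hκ]
    congr 1
    ring
  rw [h4, mul_assoc, ← mul_add] at hInt
  exact (ENNReal.mul_le_mul_iff_right (by norm_num) (by norm_num)).1 hInt

theorem gagliardoSq_polarize_le {e : Eu N} {τ : ℝ} (he : ‖e‖ = 1) (hp : 0 ≤ (N : ℝ) + 2 * s)
    {u : Eu N → ℝ} (hu : Measurable u) :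
    gagliardoSq N s (polarize e τ u) ≤ gagliardoSq N s u := by
  have : 4 * gagliardoSq N s (polarize e τ u) ≤ 4 * gagliardoSq N s u := by
    rw [← lintegral_fourPoint he (measurable_polarize hu), ← lintegral_fourPoint he hu]
    exact lintegral_mono fun x => lintegral_mono fun y =>
      ENNReal.ofReal_le_ofReal (fourPoint_polarize_le' he hp u x y)
  exact (ENNReal.mul_le_mul_iff_right (by norm_num) (by norm_num)).1 this

end PolarizationEnergy

section Rearrangement

variable {N : ℕ} {s : ℝ} {e : Eu N} {τ : ℝ}

/-- Gaussian mass of a nonnegative function. -/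
def gaussMass (u : Eu N → ℝ) : ℝ≥0∞ := ∫⁻ x, ENNReal.ofReal (u x * Real.exp (-‖x‖ ^ 2))

theorem lintegral_eq_of_hrefl (he : ‖e‖ = 1) {f g : Eu N → ℝ≥0∞} (hf : Measurable f)
    (hg : Measurable g)
    (h : ∀ x, ⟪x, e⟫ ≤ τ → f x + f (hrefl e τ x) = g x + g (hrefl e τ x)) :
    ∫⁻ x, f x = ∫⁻ x, g x := by
  have key : ∀ k : Eu N → ℝ≥0∞, Measurable k →
      2 * ∫⁻ x, k x = ∫⁻ x, (k x + k (hrefl e τ x)) := fun k hk => by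
    rw [lintegral_add_left hk, lintegral_comp_hrefl he k, two_mul]
  have h2 : 2 * ∫⁻ x, f x = 2 * ∫⁻ x, g x := by
    rw [key f hf, key g hg]
    refine lintegral_congr fun x => ?_
    rcases inner_hrefl_le_or he τ x with hx | hx
    · exact h x hx
    · have := h _ hx
      rw [hrefl_hrefl he] at this
      rw [add_comm, this, add_comm]
  exact (ENNReal.mul_right_inj (by norm_num) (by norm_num)).1 h2

theorem indicator_hrefl_eq_zero (he : ‖e‖ = 1) (m : Eu N → ℝ) {x : Eu N} (hx : ⟪x, e⟫ ≤ τ) :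
    Set.indicator {x : Eu N | ⟪x, e⟫ ≤ τ}
      (fun x => ENNReal.ofReal (gaussGap e τ x * m x)) (hrefl e τ x) = 0 := by
  rcases hx.eq_or_lt with h | h
  · have h1 : gaussGap e τ x = 0 := by rw [gaussGap, hrefl_of_inner_eq h, sub_self]
    rw [hrefl_of_inner_eq h, Set.indicator_of_mem (show x ∈ {x : Eu N | ⟪x, e⟫ ≤ τ} from hx),
      h1, zero_mul, ENNReal.ofReal_zero]
  · refine Set.indicator_of_notMem (fun hm => ?_) _
    have h2 : ⟪hrefl e τ x, e⟫ ≤ τ := hm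
    rw [inner_hrefl he] at h2
    linarith

theorem gaussMass_polarize (he : ‖e‖ = 1) (hτ : 0 ≤ τ) {u : Eu N → ℝ} (hu : Measurable u)
    (hu0 : ∀ x, 0 ≤ u x) :
    gaussMass (polarize e τ u) = gaussMass u + polMinus e τ u := by
  have hσ := (continuous_hrefl e τ).measurable
  have hG := (continuous_gaussGap e τ).measurable
  have hH := measurableSet_halfspace e τ
  have hP := measurable_polarize (e := e) (τ := τ) hu
  have hm : Measurable fun x => ENNReal.ofReal (u x * Real.exp (-‖x‖ ^ 2)) := by fun_prop
  rw [gaussMass, gaussMass, polMinus, ← lintegral_indicator hH, ← lintegral_add_left hm]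
  refine lintegral_eq_of_hrefl (τ := τ) he (by fun_prop)
    (hm.add (Measurable.indicator (by fun_prop) hH)) fun x hx => ?_
  have hx' : x ∈ {x : Eu N | ⟪x, e⟫ ≤ τ} := hx
  rw [indicator_hrefl_eq_zero he _ hx, Set.indicator_of_mem hx', polarize_of_le hx,
    polarize_hrefl_of_le he hx, add_zero]
  have g0 := gaussGap_nonneg he hτ hx
  have n1 := hu0 x
  have n2 := hu0 (hrefl e τ x)
  have n3 : 0 ≤ min (u x) (u (hrefl e τ x)) := le_min n1 n2
  rw [← ENNReal.ofReal_add (by positivity) (by positivity),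
    ← ENNReal.ofReal_add (by positivity) (by positivity),
    ← ENNReal.ofReal_add (by positivity) (by positivity)]
  congr 1
  rw [gaussGap]
  rcases le_total (u x) (u (hrefl e τ x)) with h | h
  · rw [max_eq_right h, min_eq_left h, max_eq_left (sub_nonneg.2 h)]
    ring
  · rw [max_eq_left h, min_eq_right h, max_eq_right (sub_nonpos.2 h)]
    ring

theorem polPlus_add_gaussMass (he : ‖e‖ = 1) (hτ : 0 ≤ τ) {u : Eu N → ℝ} (hu : Measurable u)
    (hu0 : ∀ x, 0 ≤ u x) :
    polPlus e τ u + gaussMass (fun x => u (x + (2 * τ) • e)) = polMinus e τ u + gaussMass u := by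
  have hσ := (continuous_hrefl e τ).measurable
  have hG := (continuous_gaussGap e τ).measurable
  have hH := measurableSet_halfspace e τ
  have hshift : gaussMass (fun x => u (x + (2 * τ) • e)) =
      ∫⁻ x, ENNReal.ofReal (u x * Real.exp (-‖hrefl e τ x‖ ^ 2)) := by
    have h0 : hrefl e τ 0 = (2 * τ) • e := by simp [hrefl]
    rw [gaussMass, ← lintegral_sub_right_eq_self _ ((2 * τ) • e)]
    refine lintegral_congr fun x => ?_
    have := norm_hrefl_sub (τ := τ) he x 0
    rw [sub_zero, h0] at this
    rw [sub_add_cancel, this]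
  rw [hshift, gaussMass, polPlus, polMinus, ← lintegral_indicator hH, ← lintegral_indicator hH,
    ← lintegral_add_right _ (by fun_prop), ← lintegral_add_right _ (by fun_prop)]
  refine lintegral_eq_of_hrefl (τ := τ) he (Measurable.add (Measurable.indicator (by fun_prop) hH)
    (by fun_prop)) (Measurable.add (Measurable.indicator (by fun_prop) hH) (by fun_prop))
    fun x hx => ?_
  have hx' : x ∈ {x : Eu N | ⟪x, e⟫ ≤ τ} := hx
  rw [indicator_hrefl_eq_zero he _ hx, indicator_hrefl_eq_zero he _ hx, Set.indicator_of_mem hx',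
    Set.indicator_of_mem hx', hrefl_hrefl he, zero_add, zero_add]
  have g0 := gaussGap_nonneg he hτ hx
  have n1 := hu0 x
  have n2 := hu0 (hrefl e τ x)
  rw [← ENNReal.ofReal_add (by positivity) (by positivity),
    ← ENNReal.ofReal_add (by positivity) (by positivity),
    ← ENNReal.ofReal_add (by positivity) (by positivity),
    ← ENNReal.ofReal_add (by positivity) (by positivity)]
  congr 1
  rw [gaussGap]
  rcases le_total (u x) (u (hrefl e τ x)) with h | h
  · rw [max_eq_right (sub_nonpos.2 h), max_eq_left (sub_nonneg.2 h)]
    ring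
  · rw [max_eq_left (sub_nonneg.2 h), max_eq_right (sub_nonpos.2 h)]
    ring

/-- If polarization does not move a continuous function, the function is ordered. -/
theorem hrefl_le_of_polMinus_eq_zero (he : ‖e‖ = 1) (hτ : 0 < τ) {u : Eu N → ℝ} (hu : Continuous u)
    (h : polMinus e τ u = 0) {x : Eu N} (hx : ⟪x, e⟫ < τ) : u (hrefl e τ x) ≤ u x := by
  by_contra! hlt
  have hσ := continuous_hrefl e τ
  have hG := continuous_gaussGap e τ
  set U : Set (Eu N) := {x | ⟪x, e⟫ < τ ∧ u x < u (hrefl e τ x)} with hU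
  have hU1 : IsOpen {x : Eu N | ⟪x, e⟫ < τ} := isOpen_lt (by fun_prop) continuous_const
  have hUo : IsOpen U := hU1.inter (isOpen_lt hu (hu.comp hσ))
  have hae := (lintegral_eq_zero_iff (by fun_prop)).1 h
  have hnull : volume U = 0 := by
    rw [Filter.EventuallyEq, ae_restrict_iff' (measurableSet_halfspace e τ)] at hae
    refine measure_mono_null (fun x hx => ?_) hae
    simp only [Set.mem_compl_iff, Set.mem_ofPred_eq, Pi.zero_apply, ENNReal.ofReal_eq_zero,
      not_forall, not_le]
    refine ⟨hx.1.le, ?_⟩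
    refine mul_pos ?_ (lt_max_of_lt_left (sub_pos.2 hx.2))
    have h1 : (1 : ℝ) - Real.exp (-(4 * τ * (τ - ⟪x, e⟫))) > 0 := by
      rw [gt_iff_lt, sub_pos, Real.exp_lt_one_iff, neg_lt_zero]
      have := sub_pos.2 hx.1
      positivity
    rw [gaussGap_eq he]
    exact mul_pos (Real.exp_pos _) h1
  have hemp := hUo.eq_empty_of_measure_zero hnull
  exact Set.notMem_empty x (hemp ▸ (⟨hx, hlt⟩ : x ∈ U))

/-- The reflection exchanging two points of different norm. -/
theorem exists_hrefl_eq {x y : Eu N} (h : ‖y‖ < ‖x‖) : ∃ (e : Eu N) (τ : ℝ), ‖e‖ = 1 ∧ 0 < τ ∧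
    ⟪y, e⟫ = τ - ‖x - y‖ / 2 ∧ hrefl e τ y = x ∧ τ = (‖x‖ ^ 2 - ‖y‖ ^ 2) / (2 * ‖x - y‖) := by
  have hxy : 0 < ‖x - y‖ := norm_pos_iff.2 (sub_ne_zero.2 fun h' => by simp [h'] at h)
  have hsq : ‖x - y‖ ^ 2 = ‖x‖ ^ 2 - 2 * ⟪x, y⟫ + ‖y‖ ^ 2 := norm_sub_sq_real x y
  refine ⟨‖x - y‖⁻¹ • (x - y), (‖x‖ ^ 2 - ‖y‖ ^ 2) / (2 * ‖x - y‖), ?_, ?_, ?_, ?_, rfl⟩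
  · rw [norm_smul, norm_inv, norm_norm, inv_mul_cancel₀ hxy.ne']
  · refine div_pos ?_ (by positivity)
    nlinarith [norm_nonneg y]
  · rw [real_inner_smul_right, inner_sub_right, real_inner_self_eq_norm_sq, real_inner_comm]
    field_simp
    rw [hsq]
    ring
  · have : 2 * ((‖x‖ ^ 2 - ‖y‖ ^ 2) / (2 * ‖x - y‖) - ⟪y, ‖x - y‖⁻¹ • (x - y)⟫) = ‖x - y‖ := by
      rw [real_inner_smul_right, inner_sub_right, real_inner_self_eq_norm_sq, real_inner_comm]
      field_simp
      rw [hsq]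
      ring
    rw [hrefl, this, smul_smul, mul_inv_cancel₀ hxy.ne', one_smul]
    abel

/-- Membership of `g` in the class over which the rearrangement of `v` is selected. -/
structure IsPolarClass (s R M : ℝ) (v g : Eu N → ℝ) : Prop where
  nonneg : ∀ x, 0 ≤ g x
  le_bound : ∀ x, g x ≤ M
  eq_zero : ∀ x, R < ‖x‖ → g x = 0
  modulus : ∀ r ε : ℝ, (∀ x y, ‖x - y‖ ≤ r → |v x - v y| ≤ ε) →
    ∀ x y, ‖x - y‖ ≤ r → |g x - g y| ≤ ε
  measure_eq : ∀ t, 0 ≤ t → volume {x | t < g x} = volume {x | t < v x}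
  energy_le : gagliardoSq N s g ≤ gagliardoSq N s v

variable {R M : ℝ} {v g : Eu N → ℝ}

theorem IsPolarClass.polarize (hg : IsPolarClass s R M v g) (hgm : Measurable g) (he : ‖e‖ = 1)
    (hτ : 0 ≤ τ) (hp : 0 ≤ (N : ℝ) + 2 * s) : IsPolarClass s R M v (polarize e τ g) where
  nonneg := polarize_nonneg hg.nonneg
  le_bound x := by
    unfold _root_.polarize
    split_ifs
    · exact max_le (hg.le_bound _) (hg.le_bound _)
    · exact min_le_of_left_le (hg.le_bound _)
  eq_zero x hx := polarize_eq_zero he hτ hg.nonneg hg.eq_zero hx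
  modulus r ε h x y hxy := abs_polarize_sub_le he (hg.modulus r ε h) hxy
  measure_eq t ht := by
    rw [← hg.measure_eq t ht]
    have key : ∀ f : Eu N → ℝ, Measurable f →
        volume {x | t < f x} = ∫⁻ x, Set.indicator (Set.Ioi t) (fun _ => (1 : ℝ≥0∞)) (f x) := by
      intro f hf
      rw [← lintegral_indicator_one (measurableSet_lt measurable_const hf)]
      rfl
    rw [key _ (measurable_polarize hgm), key _ hgm]
    exact lintegral_comp_polarize he hgm (measurable_const.indicator measurableSet_Ioi)
  energy_le := (gagliardoSq_polarize_le he hp hgm).trans hg.energy_le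

theorem IsPolarClass.continuous (hg : IsPolarClass s R M v g) (hv : UniformContinuous v) :
    Continuous g := by
  refine Metric.continuous_iff.2 fun y ε hε => ?_
  obtain ⟨d, hd, h⟩ := Metric.uniformContinuous_iff.1 hv (ε / 2) (by positivity)
  refine ⟨d, hd, fun x hx => ?_⟩
  have := hg.modulus (dist x y) (ε / 2) (fun a b hab => by
    rw [← Real.dist_eq]
    exact (h (lt_of_le_of_lt (by rwa [dist_eq_norm]) hx)).le) x y (dist_eq_norm x y).ge
  rw [Real.dist_eq]
  linarith

theorem IsPolarClass.of_tendstoUniformly {f : ℕ → Eu N → ℝ} (hv : UniformContinuous v)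
    (hf : ∀ n, IsPolarClass s R M v (f n)) (h : TendstoUniformly f g atTop) :
    IsPolarClass s R M v g := by
  have hpt : ∀ x, Tendsto (fun n => f n x) atTop (𝓝 (g x)) := h.tendsto_at
  have lim_meas : ∀ a b : Eu N → ℝ, (∀ ε > 0, ∀ t, 0 ≤ t →
      volume {x | t + ε < a x} ≤ volume {x | t < b x}) → ∀ t, 0 ≤ t →
      volume {x | t < a x} ≤ volume {x | t < b x} := by
    intro a b hab t ht
    have hU : {x | t < a x} = ⋃ n : ℕ, {x | t + 1 / ((n : ℝ) + 1) < a x} := by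
      ext x
      simp only [Set.mem_ofPred_eq, Set.mem_iUnion]
      refine ⟨fun hx => ?_, fun ⟨n, hn⟩ => lt_of_le_of_lt ?_ hn⟩
      · obtain ⟨n, hn⟩ := exists_nat_one_div_lt (sub_pos.2 hx)
        exact ⟨n, by linarith⟩
      · have : (0 : ℝ) < 1 / ((n : ℝ) + 1) := Nat.one_div_pos_of_nat
        linarith
    have hmono : Monotone fun n : ℕ => {x | t + 1 / ((n : ℝ) + 1) < a x} := by
      intro n m hnm x hx
      have : 1 / ((m : ℝ) + 1) ≤ 1 / ((n : ℝ) + 1) := Nat.one_div_le_one_div hnm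
      have hx' : t + 1 / ((n : ℝ) + 1) < a x := hx
      show t + 1 / ((m : ℝ) + 1) < a x
      linarith
    rw [hU, hmono.measure_iUnion]
    exact iSup_le fun n => hab _ Nat.one_div_pos_of_nat t ht
  have hclose : ∀ ε > 0, ∃ n, ∀ x, |g x - f n x| < ε := by
    intro ε hε
    obtain ⟨n, hn⟩ := (Metric.tendstoUniformly_iff.1 h ε hε).exists
    exact ⟨n, fun x => by rw [← Real.dist_eq]; exact hn x⟩
  refine ⟨fun x => ge_of_tendsto' (hpt x) fun n => (hf n).nonneg x,
    fun x => le_of_tendsto' (hpt x) fun n => (hf n).le_bound x, fun x hx => ?_, ?_, ?_, ?_⟩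
  · refine tendsto_nhds_unique (hpt x) ?_
    simp only [fun n => (hf n).eq_zero x hx]
    exact tendsto_const_nhds
  · intro r ε hr x y hxy
    exact le_of_tendsto' ((hpt x).sub (hpt y)).abs fun n => (hf n).modulus r ε hr x y hxy
  · intro t ht
    refine le_antisymm (lim_meas _ _ (fun ε hε t ht => ?_) t ht)
      (lim_meas _ _ (fun ε hε t ht => ?_) t ht)
    · obtain ⟨n, hn⟩ := hclose ε hε
      rw [← (hf n).measure_eq t ht]
      refine measure_mono fun x hx => ?_
      have h1 : t + ε < g x := hx
      have := abs_lt.1 (hn x)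
      show t < f n x
      linarith
    · obtain ⟨n, hn⟩ := hclose ε hε
      rw [← (hf n).measure_eq (t + ε) (by linarith)]
      refine measure_mono fun x hx => ?_
      have h1 : t + ε < f n x := hx
      have := abs_lt.1 (hn x)
      show t < g x
      linarith
  · exact gagliardoSq_le_of_tendsto (fun n => ((hf n).continuous hv).measurable) hpt
      fun n => (hf n).energy_le

theorem exists_subseq_tendstoUniformly {f : ℕ → Eu N → ℝ} (hv : UniformContinuous v)
    (hf : ∀ n, IsPolarClass s R M v (f n)) :
    ∃ (g : Eu N → ℝ) (φ : ℕ → ℕ), StrictMono φ ∧ TendstoUniformly (fun n => f (φ n)) g atTop := by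
  classical
  set K := Metric.closedBall (0 : Eu N) R with hK
  have : CompactSpace K := isCompact_iff_compactSpace.1 (isCompact_closedBall _ _)
  let F : ℕ → BoundedContinuousFunction K ℝ := fun n =>
    BoundedContinuousFunction.mkOfCompact
      ⟨fun x => f n x, ((hf n).continuous hv).comp continuous_subtype_val⟩
  have hcomp : IsCompact (closure (Set.range F)) := by
    refine BoundedContinuousFunction.arzela_ascoli (Set.Icc 0 M) isCompact_Icc _ ?_ ?_
    · rintro _ x ⟨n, rfl⟩
      exact ⟨(hf n).nonneg x, (hf n).le_bound x⟩
    · intro x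
      refine Metric.equicontinuousAt_iff.2 fun ε hε => ?_
      obtain ⟨d, hd, h⟩ := Metric.uniformContinuous_iff.1 hv (ε / 2) (by positivity)
      refine ⟨d, hd, ?_⟩
      rintro y hy ⟨_, n, rfl⟩
      have hxy : dist (x : Eu N) y < d := by
        rw [dist_comm]
        exact hy
      have := (hf n).modulus (dist (x : Eu N) y) (ε / 2) (fun a b hab => by
        rw [← Real.dist_eq]
        exact (h (((dist_eq_norm a b).le.trans hab).trans_lt hxy)).le) x y (dist_eq_norm (x : Eu N) y).ge
      rw [Real.dist_eq]
      show |f n x - f n y| < ε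
      linarith
  obtain ⟨G, -, φ, hφ, hlim⟩ := hcomp.tendsto_subseq
    (fun n => subset_closure (Set.mem_range_self n) : ∀ n, F n ∈ closure (Set.range F))
  refine ⟨fun x => if h : x ∈ K then G ⟨x, h⟩ else 0, φ, hφ, ?_⟩
  refine Metric.tendstoUniformly_iff.2 fun ε hε => ?_
  filter_upwards [Metric.tendsto_nhds.1 hlim ε hε] with n hn x
  by_cases hx : x ∈ K
  · rw [dif_pos hx, dist_comm]
    exact lt_of_le_of_lt (BoundedContinuousFunction.dist_coe_le_dist (f := F (φ n)) (g := G) ⟨x, hx⟩)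
      hn
  · have : R < ‖x‖ := by simpa [hK] using hx
    rw [dif_neg hx, (hf (φ n)).eq_zero x this, dist_self]
    exact hε

theorem gaussMass_le_add {f h : Eu N → ℝ} {ε : ℝ} (hε : 0 ≤ ε)
    (hle : ∀ x, f x ≤ h x + ε) :
    gaussMass f ≤ gaussMass h + ENNReal.ofReal ε * gaussMass (fun _ : Eu N => 1) := by
  rw [gaussMass, gaussMass, gaussMass, ← lintegral_const_mul _ (by fun_prop),
    ← lintegral_add_right _ (by fun_prop)]
  refine lintegral_mono fun x => ?_
  rw [← ENNReal.ofReal_mul hε]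
  refine le_trans (ENNReal.ofReal_le_ofReal ?_) ENNReal.ofReal_add_le
  nlinarith [hle x, Real.exp_pos (-‖x‖ ^ 2)]

theorem gaussMass_one_lt_top : gaussMass (fun _ : Eu N => 1) < ∞ := by
  have h := GaussianFourier.integrable_cexp_neg_mul_sq_norm_add (V := Eu N) (b := 1) (by simp) 0 0
  refine lt_of_le_of_lt (lintegral_mono fun x => ?_) h.norm.lintegral_lt_top
  refine ENNReal.ofReal_le_ofReal ?_
  rw [Complex.norm_exp, one_mul]
  refine le_of_eq (congrArg _ ?_)
  simp [← Complex.ofReal_pow]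

/-- Symmetric decreasing rearrangement of a continuous compactly supported function. -/
theorem exists_rearrangement (hp : 0 ≤ (N : ℝ) + 2 * s) (hv : Continuous v)
    (hv0 : ∀ x, 0 ≤ v x) (hvR : ∀ x, R < ‖x‖ → v x = 0) :
    ∃ g : Eu N → ℝ, Continuous g ∧ (∀ x, 0 ≤ g x) ∧ (∀ x, R < ‖x‖ → g x = 0) ∧
      (∀ x y, ‖x‖ ≤ ‖y‖ → g y ≤ g x) ∧
      (∀ t, 0 ≤ t → volume {x | t < g x} = volume {x | t < v x}) ∧
      gagliardoSq N s g ≤ gagliardoSq N s v := by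
  have hvc : HasCompactSupport v := HasCompactSupport.of_support_subset_isCompact
    (isCompact_closedBall 0 R) fun x hx => by
      by_contra hxx
      exact hx (hvR x (by simpa using hxx))
  have hvu : UniformContinuous v := hvc.uniformContinuous_of_continuous hv
  obtain ⟨M, hM⟩ := hv.bounded_above_of_compact_support hvc
  have hvM : ∀ x, v x ≤ M := fun x => (le_abs_self _).trans (hM x)
  have hself : IsPolarClass s R M v v := ⟨hv0, hvM, hvR, fun _ _ h => h, fun _ _ => rfl, le_rfl⟩
  set S : Set ℝ≥0∞ := gaussMass '' {g | IsPolarClass s R M v g} with hS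
  have hSne : S.Nonempty := ⟨_, v, hself, rfl⟩
  obtain ⟨a, -, ha, haS⟩ := exists_seq_tendsto_sSup hSne (OrderTop.bddAbove S)
  choose f hf hfa using haS
  obtain ⟨g, φ, hφ, hlim⟩ := exists_subseq_tendstoUniformly hvu hf
  have hg : IsPolarClass s R M v g := IsPolarClass.of_tendstoUniformly hvu (fun n => hf (φ n)) hlim
  have hgc := hg.continuous hvu
  have hfin : gaussMass g < ∞ := by
    have := gaussMass_le_add (f := g) (h := fun _ => 0) (ε := max M 0) (le_max_right _ _)
      fun x => by
        rw [zero_add]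
        exact (hg.le_bound x).trans (le_max_left _ _)
    refine lt_of_le_of_lt this ?_
    have h0 : gaussMass (fun _ : Eu N => (0 : ℝ)) = 0 := by simp [gaussMass]
    rw [h0, zero_add]
    exact ENNReal.mul_lt_top ENNReal.ofReal_lt_top gaussMass_one_lt_top
  have hmax : ∀ h : Eu N → ℝ, IsPolarClass s R M v h → gaussMass h ≤ gaussMass g := by
    intro h hh
    have h1 : gaussMass h ≤ sSup S := le_sSup ⟨h, hh, rfl⟩
    refine h1.trans ?_
    have h2 : Tendsto (fun n => a (φ n)) atTop (𝓝 (sSup S)) := ha.comp hφ.tendsto_atTop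
    have h3 : ∀ k : ℕ, sSup S ≤
        gaussMass g + ENNReal.ofReal (1 / ((k : ℝ) + 1)) * gaussMass (fun _ : Eu N => 1) := by
      intro k
      have hk : (0 : ℝ) < 1 / ((k : ℝ) + 1) := Nat.one_div_pos_of_nat
      refine le_of_tendsto h2 ?_
      filter_upwards [Metric.tendstoUniformly_iff.1 hlim _ hk] with n hn
      rw [← hfa]
      refine gaussMass_le_add hk.le fun x => ?_
      have := hn x
      rw [Real.dist_eq] at this
      linarith [(abs_lt.1 this).1]
    have h4 : Tendsto (fun k : ℕ => gaussMass g +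
        ENNReal.ofReal (1 / ((k : ℝ) + 1)) * gaussMass (fun _ : Eu N => 1)) atTop
        (𝓝 (gaussMass g + ENNReal.ofReal 0 * gaussMass (fun _ : Eu N => 1))) := by
      refine tendsto_const_nhds.add (ENNReal.Tendsto.mul_const ?_ (Or.inr gaussMass_one_lt_top.ne))
      exact ENNReal.tendsto_ofReal tendsto_one_div_add_atTop_nhds_zero_nat
    rw [ENNReal.ofReal_zero, zero_mul, add_zero] at h4
    exact ge_of_tendsto' h4 h3
  have hstrict : ∀ x y : Eu N, ‖y‖ < ‖x‖ → g x ≤ g y := by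
    intro x y hxy
    obtain ⟨e, τ, he, hτ, hye, hyx, -⟩ := exists_hrefl_eq hxy
    have h1 := hmax _ (hg.polarize hgc.measurable he hτ.le hp)
    rw [gaussMass_polarize he hτ.le hgc.measurable hg.nonneg] at h1
    have h2 : polMinus e τ g = 0 := by
      have h3 : gaussMass g + polMinus e τ g ≤ gaussMass g + 0 := by rwa [add_zero]
      exact nonpos_iff_eq_zero.1 ((ENNReal.add_le_add_iff_left hfin.ne).1 h3)
    have hpos : 0 < ‖x - y‖ := norm_pos_iff.2 (sub_ne_zero.2 fun h' => by simp [h'] at hxy)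
    have := hrefl_le_of_polMinus_eq_zero he hτ hgc h2 (x := y) (by rw [hye]; linarith)
    rwa [hyx] at this
  refine ⟨g, hgc, hg.nonneg, hg.eq_zero, fun x y hxy => ?_, hg.measure_eq, hg.energy_le⟩
  rcases hxy.eq_or_lt with h | h
  swap
  · exact hstrict _ _ h
  rcases eq_or_ne y 0 with rfl | hy
  · rw [norm_zero, norm_eq_zero] at h
    rw [h]
  have hlim2 : Tendsto (fun n : ℕ => g ((1 + 1 / ((n : ℝ) + 1)) • y)) atTop (𝓝 (g y)) := by
    have h5 : Tendsto (fun n : ℕ => (1 + 1 / ((n : ℝ) + 1)) • y) atTop (𝓝 ((1 + 0 : ℝ) • y)) :=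
      (tendsto_const_nhds.add tendsto_one_div_add_atTop_nhds_zero_nat).smul_const y
    rw [add_zero, one_smul] at h5
    exact (hgc.tendsto y).comp h5
  refine le_of_tendsto' hlim2 fun n => hstrict _ _ ?_
  have hn : (0 : ℝ) < 1 / ((n : ℝ) + 1) := Nat.one_div_pos_of_nat
  rw [norm_smul, h, Real.norm_of_nonneg (by positivity)]
  have := norm_pos_iff.2 hy
  nlinarith

end Rearrangement

section FaberKrahn

variable {N : ℕ} {s q : ℝ}

theorem eq_ball_of_radial (hN : 1 ≤ N) {D : Set (Eu N)} (hD : IsOpen D)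
    (hb : Bornology.IsBounded D) (hrad : ∀ x ∈ D, ∀ y : Eu N, ‖y‖ ≤ ‖x‖ → y ∈ D) :
    ∃ ρ : ℝ, 0 ≤ ρ ∧ D = Metric.ball 0 ρ := by
  have : Nonempty (Fin N) := ⟨⟨0, hN⟩⟩
  have : Nontrivial (Eu N) := inferInstance
  rcases D.eq_empty_or_nonempty with rfl | hne
  · exact ⟨0, le_rfl, Metric.ball_zero.symm⟩
  obtain ⟨R, hR⟩ := hb.subset_closedBall 0
  have hbdd : BddAbove (norm '' D) := ⟨R, by
    rintro _ ⟨x, hx, rfl⟩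
    simpa using hR hx⟩
  refine ⟨sSup (norm '' D), Real.sSup_nonneg ?_, Set.Subset.antisymm ?_ fun y hy => ?_⟩
  · rintro _ ⟨x, -, rfl⟩
    exact norm_nonneg x
  · rw [← interior_closedBall']
    refine interior_maximal (fun x hx => ?_) hD
    rw [mem_closedBall_zero_iff]
    exact le_csSup hbdd ⟨x, hx, rfl⟩
  · rw [mem_ball_zero_iff] at hy
    obtain ⟨_, ⟨x, hx, rfl⟩, hxy⟩ := exists_lt_of_lt_csSup (hne.image norm) hy
    exact hrad x hx y hxy.le

theorem integral_rpow_eq_of_measure_eq (hq : 0 < q) {f g : Eu N → ℝ} (hf : Measurable f)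
    (hg : Measurable g) (hf0 : ∀ x, 0 ≤ f x) (hg0 : ∀ x, 0 ≤ g x)
    (h : ∀ t, 0 ≤ t → volume {x | t < g x} = volume {x | t < f x}) :
    ∫ x, g x ^ q = ∫ x, f x ^ q := by
  rw [integral_eq_lintegral_of_nonneg_ae (.of_forall fun x => Real.rpow_nonneg (hg0 x) _)
      (hg.pow_const q).aestronglyMeasurable,
    integral_eq_lintegral_of_nonneg_ae (.of_forall fun x => Real.rpow_nonneg (hf0 x) _)
      (hf.pow_const q).aestronglyMeasurable,
    lintegral_rpow_eq_lintegral_meas_lt_mul _ (.of_forall hg0) hg.aemeasurable hq,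
    lintegral_rpow_eq_lintegral_meas_lt_mul _ (.of_forall hf0) hf.aemeasurable hq]
  congr 2
  refine setLIntegral_congr_fun measurableSet_Ioi fun t ht => ?_
  rw [h t (le_of_lt ht)]

theorem gagliardoSqR_comp_smul_sub (u : Eu N → ℝ) {c : ℝ} (hc : 0 < c) (a : Eu N) :
    gagliardoSq N s (fun x => u (c • (x - a))) =
      ENNReal.ofReal (c ^ (-((N : ℝ) - 2 * s))) * gagliardoSq N s u := by
  rw [← gagliardoSq_comp_smul u hc, ← gagliardoSq_comp_add (fun x => u (c • x)) (-a)]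
  simp only [sub_eq_add_neg]

/-- Scale invariant Faber–Krahn inequality for continuous functions. -/
theorem sobolevConst_ball_mul_le (hN : 1 ≤ N) (hs0 : 0 < s) (hq : 1 ≤ q) {x₀ : Eu N} {r : ℝ}
    (hr : 0 < r) (hB : volume (Metric.ball x₀ r) = 1) {v : Eu N → ℝ} (hv : Continuous v)
    (hv0 : ∀ x, 0 ≤ v x) (hvc : HasCompactSupport v) (hvf : gagliardoSq N s v < ∞) :
    sobolevConst N s q (Metric.ball x₀ r) * (∫ x, v x ^ q) ^ (2 / q) ≤
      gagliardoSqR N s v * (volume {x | 0 < v x}).toReal ^ (2 / q - 1 + 2 * s / N) := by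
  have hq0 : 0 < q := by linarith
  have hN0 : (0 : ℝ) < N := by exact_mod_cast hN
  obtain ⟨R, hR⟩ := hvc.isCompact.isBounded.subset_closedBall 0
  have hvR : ∀ x, R < ‖x‖ → v x = 0 := fun x hx => by
    by_contra hne
    have := hR (subset_tsupport v hne)
    rw [mem_closedBall_zero_iff] at this
    linarith
  obtain ⟨g, hg, hg0, hgR, hgrad, hgm, hgE⟩ :=
    exists_rearrangement (s := s) (by positivity) hv hv0 hvR
  have hgf : gagliardoSq N s g < ∞ := hgE.trans_lt hvf
  have hI : ∫ x, g x ^ q = ∫ x, v x ^ q :=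
    integral_rpow_eq_of_measure_eq hq0 hv.measurable hg.measurable hv0 hg0 hgm
  obtain ⟨ρ, hρ0, hρ⟩ := eq_ball_of_radial hN (isOpen_lt continuous_const hg)
    ((Metric.isBounded_closedBall (x := (0 : Eu N)) (r := R)).subset fun x hx => by
      rw [mem_closedBall_zero_iff]
      by_contra! hlt
      exact (hgR x hlt).not_gt hx)
    (fun x (hx : 0 < g x) y hy => lt_of_lt_of_le hx (hgrad y x hy))
  have hm : volume {x | 0 < v x} = volume (Metric.ball (0 : Eu N) ρ) := by
    rw [← hgm 0 le_rfl]
    exact congrArg volume hρ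
  have hgball : ∀ x, x ∉ Metric.ball (0 : Eu N) ρ → g x = 0 := fun x hx => by
    rw [← hρ] at hx
    exact le_antisymm (not_lt.1 hx) (hg0 x)
  set ω := (volume (Metric.ball (0 : Eu N) 1)).toReal with hω
  have hω0 : 0 < ω := unit_ball_volume_pos
  rcases hρ0.eq_or_lt with h0 | hρpos
  · have : ∀ x, g x = 0 := fun x => hgball x (by rw [← h0, Metric.ball_zero]; exact id)
    rw [← hI]
    simp only [this, Real.zero_rpow hq0.ne', integral_zero]
    rw [Real.zero_rpow (by positivity), mul_zero]
    exact mul_nonneg ENNReal.toReal_nonneg (Real.rpow_nonneg ENNReal.toReal_nonneg _)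
  have hrN : r ^ N * ω = 1 := by
    rw [volume_ball_eq x₀ hr, ENNReal.ofReal_eq_one] at hB
    exact hB
  set c := ρ / r with hc
  have hc0 : 0 < c := by positivity
  have hcm : (volume {x | 0 < v x}).toReal = c ^ (N : ℝ) := by
    rw [hm, volume_ball_eq 0 hρpos, ENNReal.toReal_ofReal (by positivity), Real.rpow_natCast, hc,
      div_pow, ← hω]
    field_simp
    linear_combination hrN
  set h : Eu N → ℝ := fun x => g (c • (x - x₀)) with hh
  have hh0 : ∀ x, x ∉ Metric.ball x₀ r → h x = 0 := fun x hx => by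
    refine hgball _ fun hm => hx ?_
    rw [mem_ball_zero_iff, norm_smul, Real.norm_of_nonneg hc0.le, hc] at hm
    rw [mem_ball_iff_norm]
    rw [div_mul_eq_mul_div, div_lt_iff₀ hr] at hm
    exact lt_of_mul_lt_mul_left hm hρpos.le
  have hhc : Continuous h := by fun_prop
  have hhs : HasCompactSupport h := HasCompactSupport.of_support_subset_isCompact
    (isCompact_closedBall x₀ r) fun x hx => by
      by_contra hxx
      exact hx (hh0 x fun h' => hxx (Metric.ball_subset_closedBall h'))
  have hhE := gagliardoSqR_comp_smul_sub (s := s) g hc0 x₀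
  have hhf : gagliardoSq N s h < ∞ := by
    rw [hhE]
    exact ENNReal.mul_lt_top ENNReal.ofReal_lt_top hgf
  have key := sobolevConst_mul_le hq Metric.isOpen_ball measure_ball_lt_top hhc hhs hh0
    (fun x => hg0 _) hhf
  have hIh : ∫ x, h x ^ q = c ^ (-(N : ℝ)) * ∫ x, v x ^ q := by
    rw [← hI, hh, integral_sub_right_eq_self (fun x => g (c • x) ^ q) x₀,
      Measure.integral_comp_smul volume (fun x => g x ^ q) c, finrank_euclideanSpace_fin,
      abs_of_nonneg (by positivity), smul_eq_mul, Real.rpow_neg hc0.le, Real.rpow_natCast]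
  have hIv : 0 ≤ ∫ x, v x ^ q := integral_nonneg fun x => Real.rpow_nonneg (hv0 x) _
  have hER : gagliardoSqR N s h ≤ c ^ (-((N : ℝ) - 2 * s)) * gagliardoSqR N s v := by
    rw [gagliardoSqR, gagliardoSqR, hhE, ENNReal.toReal_mul, ENNReal.toReal_ofReal (by positivity)]
    exact mul_le_mul_of_nonneg_left (ENNReal.toReal_mono hvf.ne hgE) (by positivity)
  rw [hIh, Real.mul_rpow (by positivity) hIv, ← Real.rpow_mul hc0.le] at key
  rw [hcm, ← Real.rpow_mul hc0.le]
  have e1 : (N : ℝ) * (2 / q - 1 + 2 * s / N) = -((N : ℝ) - 2 * s) - -(N : ℝ) * (2 / q) := by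
    field_simp
    ring
  rw [e1, Real.rpow_sub hc0]
  have hpos : 0 < c ^ (-(N : ℝ) * (2 / q)) := by positivity
  rw [← mul_div_assoc, le_div_iff₀ hpos]
  calc _ = _ := by ring
    _ ≤ _ := key.trans hER
    _ = _ := mul_comm _ _

end FaberKrahn

section UniformRegularity

variable {N : ℕ} {s q : ℝ}

theorem betaC_nonneg : 0 ≤ betaC N s :=
  inv_nonneg.2 (integral_nonneg fun x => by positivity)

theorem uniformContinuous_poisson (hN : 1 ≤ N) (hs0 : 0 < s) {z : ℝ} (hz : 0 < z) :
    UniformContinuous (poisson N s z) := by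
  have hcont : Continuous (poisson N s z) := by
    unfold poisson
    refine continuous_const.mul (Continuous.rpow_const (by fun_prop) fun x => Or.inl ?_)
    positivity
  have hN0 : (0 : ℝ) < N := by exact_mod_cast hN
  refine hcont.uniformContinuous_of_tendsto_cocompact (x := 0) ?_
  have h1 : Tendsto (fun x : Eu N => z ^ 2 + ‖x‖ ^ 2) (cocompact (Eu N)) atTop :=
    tendsto_atTop_add_const_left _ _
      ((tendsto_pow_atTop two_ne_zero).comp (tendsto_norm_cocompact_atTop (E := Eu N)))
  have h2 := ((tendsto_rpow_neg_atTop (y := ((N : ℝ) + 2 * s) / 2) (by positivity)).comp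
    h1).const_mul (betaC N s * z ^ (2 * s))
  rw [mul_zero] at h2
  refine h2.congr fun x => ?_
  rw [poisson, Function.comp_apply, neg_div]

theorem poisson_one_le (hs0 : 0 < s) (x : Eu N) : |poisson N s 1 x| ≤ betaC N s := by
  have hβ := betaC_nonneg (N := N) (s := s)
  have h1 : ((1 : ℝ) ^ 2 + ‖x‖ ^ 2) ^ (-((N : ℝ) + 2 * s) / 2) ≤ 1 := by
    refine Real.rpow_le_one_of_one_le_of_nonpos (by nlinarith [sq_nonneg ‖x‖]) ?_
    rw [neg_div, neg_nonpos]
    positivity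
  have h0 : 0 ≤ ((1 : ℝ) ^ 2 + ‖x‖ ^ 2) ^ (-((N : ℝ) + 2 * s) / 2) := by positivity
  rw [poisson, Real.one_rpow, mul_one, abs_of_nonneg (by positivity)]
  exact mul_le_of_le_one_right hβ h1

theorem integral_le_two {Ω : Set (Eu N)} (hΩ : IsOpen Ω) (hΩ1 : volume Ω = 1) (hq1 : 1 ≤ q)
    {u : Eu N → ℝ} (hu : Continuous u) (huc : HasCompactSupport u) (hu0 : ∀ x, 0 ≤ u x)
    (huΩ : ∀ x, x ∉ Ω → u x = 0) (hI : ∫ x in Ω, u x ^ q = 1) : ∫ x, u x ≤ 2 := by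
  have hq0 : 0 < q := by linarith
  have hi : Integrable u := hu.integrable_of_hasCompactSupport huc
  have hi2 : IntegrableOn (fun x => u x ^ q) Ω := by
    by_contra h
    rw [integral_undef h] at hI
    exact zero_ne_one hI
  have h1 : ∫ x, u x = ∫ x in Ω, u x :=
    (setIntegral_eq_integral_of_forall_compl_eq_zero huΩ).symm
  have hi1 : IntegrableOn (fun _ : Eu N => (1 : ℝ)) Ω :=
    integrableOn_const (by rw [hΩ1]; exact ENNReal.one_ne_top)
  rw [h1]
  calc ∫ x in Ω, u x ≤ ∫ x in Ω, (1 + u x ^ q) := by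
        refine setIntegral_mono_on hi.integrableOn (hi1.add hi2) hΩ.measurableSet fun x _ => ?_
        rcases le_total (u x) 1 with h | h
        · linarith [Real.rpow_nonneg (hu0 x) q]
        · have := Real.rpow_le_rpow_of_exponent_le h hq1
          rw [Real.rpow_one] at this
          linarith
    _ = 2 := by
        rw [integral_add hi1 hi2, hI, setIntegral_const, Measure.real, hΩ1]
        norm_num

theorem abs_integral_mul_le_of_abs_le {k u : Eu N → ℝ} {C : ℝ} (hi : Integrable u)
    (hu0 : ∀ x, 0 ≤ u x) (hk : ∀ x, |k x| ≤ C) : |∫ x, k x * u x| ≤ C * ∫ x, u x := by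
  rw [← integral_const_mul, ← Real.norm_eq_abs]
  refine norm_integral_le_of_norm_le (hi.const_mul C) (.of_forall fun x => ?_)
  rw [Real.norm_eq_abs, abs_mul, abs_of_nonneg (hu0 x)]
  exact mul_le_mul_of_nonneg_right (hk x) (hu0 x)

/-- The closeness bound on the extension forces a uniform bound and a uniform modulus of
continuity. -/
theorem exists_uniform_bounds (hN : 1 ≤ N) (hs0 : 0 < s) (hq1 : 1 ≤ q) {C₀ : ℝ} (hC₀ : 0 < C₀) :
    ∃ (M : ℝ) (m : ℝ → ℝ), 0 < M ∧ (∀ η, 0 < η → 0 < m η) ∧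
      ∀ Ω : Set (Eu N), IsOpen Ω → volume Ω = 1 → ∀ u : Eu N → ℝ, Continuous u →
      HasCompactSupport u → (∀ x, 0 ≤ u x) → (∀ x, x ∉ Ω → u x = 0) → ∫ x in Ω, u x ^ q = 1 →
      (∀ z : ℝ, 0 < z → ∀ x : Eu N, |csExt N s u x z - u x| ≤ C₀ * z ^ s) →
      (∀ x, u x ≤ M) ∧ ∀ η, 0 < η → ∀ x y, ‖x - y‖ ≤ m η → |u x - u y| ≤ η := by
  have hβ := betaC_nonneg (N := N) (s := s)
  have hmod : ∀ η : ℝ, ∃ d : ℝ, 0 < η → 0 < d ∧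
      ∀ x y : Eu N, ‖x - y‖ ≤ d → ∀ w : Eu N,
        |poisson N s ((η / (4 * C₀)) ^ s⁻¹) (x - w) -
          poisson N s ((η / (4 * C₀)) ^ s⁻¹) (y - w)| ≤ η / 4 := by
    intro η
    by_cases hη : 0 < η
    swap
    · exact ⟨0, fun h => absurd h hη⟩
    obtain ⟨d, hd, h⟩ := Metric.uniformContinuous_iff.1
      (uniformContinuous_poisson (N := N) (s := s) (z := (η / (4 * C₀)) ^ s⁻¹) hN hs0
        (by positivity)) (η / 4) (by positivity)
    refine ⟨d / 2, fun _ => ⟨by positivity, fun x y hxy w => ?_⟩⟩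
    rw [← Real.dist_eq]
    refine (h ?_).le
    rw [dist_eq_norm, sub_sub_sub_cancel_right]
    linarith
  choose m hm using hmod
  refine ⟨2 * betaC N s + C₀, m, by positivity, fun η hη => (hm η hη).1, ?_⟩
  intro Ω hΩ hΩ1 u hu huc hu0 huΩ hI hclose
  have hi : Integrable u := hu.integrable_of_hasCompactSupport huc
  have h2 := integral_le_two hΩ hΩ1 hq1 hu huc hu0 huΩ hI
  refine ⟨fun x => ?_, fun η hη x y hxy => ?_⟩
  · have h3 := hclose 1 one_pos x
    rw [Real.one_rpow, mul_one] at h3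
    have h4 : |csExt N s u x 1| ≤ betaC N s * ∫ y, u y :=
      abs_integral_mul_le_of_abs_le hi hu0 fun y => poisson_one_le hs0 (x - y)
    have h5 : betaC N s * ∫ y, u y ≤ betaC N s * 2 := mul_le_mul_of_nonneg_left h2 hβ
    linarith [(abs_le.1 h3).1, (abs_le.1 h4).2]
  · set z := (η / (4 * C₀)) ^ s⁻¹ with hz
    have hz0 : 0 < z := by positivity
    have hzs : C₀ * z ^ s = η / 4 := by
      rw [hz, ← Real.rpow_mul (by positivity), inv_mul_cancel₀ hs0.ne', Real.rpow_one]
      field_simp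
    have hcx := hclose z hz0 x
    have hcy := hclose z hz0 y
    rw [hzs] at hcx hcy
    have hP : ∀ a : Eu N, Integrable fun w => poisson N s z (a - w) * u w := by
      intro a
      have hPc : Continuous fun w => poisson N s z (a - w) :=
        (uniformContinuous_poisson hN hs0 hz0).continuous.comp (by fun_prop)
      exact (hPc.mul hu).integrable_of_hasCompactSupport huc.mul_left
    have hdiff : |csExt N s u x z - csExt N s u y z| ≤ η / 4 * ∫ w, u w := by
      rw [csExt, csExt, ← integral_sub (hP x) (hP y)]
      simp only [← sub_mul]
      exact abs_integral_mul_le_of_abs_le hi hu0 ((hm η hη).2 x y hxy)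
    have h6 : η / 4 * ∫ w, u w ≤ η / 4 * 2 := mul_le_mul_of_nonneg_left h2 (by positivity)
    rw [abs_le] at *
    constructor <;> linarith [hcx.1, hcx.2, hcy.1, hcy.2, hdiff.1, hdiff.2]

end UniformRegularity

section Center

variable {N : ℕ} {s q : ℝ} {e : Eu N} {τ : ℝ}

theorem gaussMass_comp_add_eq {u : Eu N → ℝ} (hu : Continuous u) (huc : HasCompactSupport u)
    (hu0 : ∀ x, 0 ≤ u x) (z : Eu N) : gaussMass (fun x => u (x + z)) =
      ENNReal.ofReal (∫ x, u x * Real.exp (-‖x - z‖ ^ 2)) := by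
  have hInt : Integrable fun x => u x * Real.exp (-‖x - z‖ ^ 2) :=
    (hu.mul (by fun_prop)).integrable_of_hasCompactSupport huc.mul_right
  rw [ofReal_integral_eq_lintegral_ofReal hInt
    (.of_forall fun x => mul_nonneg (hu0 x) (Real.exp_pos _).le), gaussMass,
    ← lintegral_sub_right_eq_self _ z]
  simp only [sub_add_cancel]

/-- The Gaussian mass of the translates attains its maximum. -/
theorem exists_gaussMass_max {u : Eu N → ℝ} (hu : Continuous u) (huc : HasCompactSupport u)
    (hu0 : ∀ x, 0 ≤ u x) :
    ∃ p : Eu N, ∀ z, gaussMass (fun x => u (x + z)) ≤ gaussMass (fun x => u (x + p)) := by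
  have hi : Integrable u := hu.integrable_of_hasCompactSupport huc
  set F : Eu N → ℝ := fun z => ∫ x, u x * Real.exp (-‖x - z‖ ^ 2) with hF
  have hbound : ∀ z x : Eu N, ‖u x * Real.exp (-‖x - z‖ ^ 2)‖ ≤ u x := by
    intro z x
    rw [Real.norm_of_nonneg (mul_nonneg (hu0 x) (Real.exp_pos _).le)]
    refine mul_le_of_le_one_right (hu0 x) (Real.exp_le_one_iff.2 ?_)
    rw [neg_nonpos]
    positivity
  have hm : ∀ z : Eu N, AEStronglyMeasurable (fun x => u x * Real.exp (-‖x - z‖ ^ 2)) := fun z =>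
    (hu.mul (by fun_prop)).aestronglyMeasurable
  have hcont : Continuous F := continuous_of_dominated hm (fun z => .of_forall (hbound z)) hi
    (.of_forall fun x => by fun_prop)
  have : (cocompact (Eu N)).IsCountablyGenerated := by
    rw [← Metric.cobounded_eq_cocompact, ← comap_norm_atTop]
    infer_instance
  have hlim : Tendsto F (cocompact (Eu N)) (𝓝 (∫ _ : Eu N, (0 : ℝ))) := by
    refine tendsto_integral_filter_of_dominated_convergence u (.of_forall hm)
      (.of_forall fun z => .of_forall (hbound z)) hi (.of_forall fun x => ?_)
    have h1 : Tendsto (fun z : Eu N => ‖x - z‖) (cocompact (Eu N)) atTop := by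
      refine tendsto_atTop_mono (fun z => ?_) (tendsto_atTop_add_const_right _ (-‖x‖)
        (tendsto_norm_cocompact_atTop (E := Eu N)))
      have := norm_sub_norm_le z x
      rw [norm_sub_rev] at this
      linarith
    have h2 : Tendsto (fun z : Eu N => Real.exp (-‖x - z‖ ^ 2)) (cocompact (Eu N)) (𝓝 0) :=
      Real.tendsto_exp_neg_atTop_nhds_zero.comp ((tendsto_pow_atTop two_ne_zero).comp h1)
    simpa using h2.const_mul (u x)
  rw [integral_zero] at hlim
  have hmax : ∃ p, ∀ z, F z ≤ F p := by
    by_cases h : ∃ p, 0 < F p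
    · obtain ⟨p, hp⟩ := h
      exact hcont.exists_forall_ge' p ((hlim.eventually_lt_const hp).mono fun z hz => hz.le)
    · push Not at h
      exact ⟨0, fun z => (h z).trans (integral_nonneg fun x =>
        mul_nonneg (hu0 x) (Real.exp_pos _).le)⟩
  obtain ⟨p, hp⟩ := hmax
  refine ⟨p, fun z => ?_⟩
  rw [gaussMass_comp_add_eq hu huc hu0, gaussMass_comp_add_eq hu huc hu0]
  exact ENNReal.ofReal_le_ofReal (hp z)

/-- A normalized competitor whose Gaussian mass is maximal among its translates. -/
structure IsCentered (s q : ℝ) (w : Eu N → ℝ) : Prop where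
  continuous : Continuous w
  compactSupport : HasCompactSupport w
  nonneg : ∀ x, 0 ≤ w x
  integral_eq : ∫ x, w x ^ q = 1
  volume_eq : volume {x | 0 < w x} = 1
  energy_lt_top : gagliardoSq N s w < ∞
  center : ∀ z, gaussMass (fun x => w (x + z)) ≤ gaussMass w

variable {w : Eu N → ℝ}

theorem IsCentered.eq_zero (hw : IsCentered s q w) :
    ∃ R : ℝ, ∀ x, R < ‖x‖ → w x = 0 := by
  obtain ⟨R, hR⟩ := hw.compactSupport.isCompact.isBounded.subset_closedBall 0
  refine ⟨R, fun x hx => ?_⟩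
  by_contra hne
  have := hR (subset_tsupport w hne)
  rw [mem_closedBall_zero_iff] at this
  linarith

theorem IsCentered.polMinus_le_polPlus (hw : IsCentered s q w) (he : ‖e‖ = 1) (hτ : 0 ≤ τ) :
    polMinus e τ w ≤ polPlus e τ w := by
  have h := polPlus_add_gaussMass he hτ hw.continuous.measurable hw.nonneg
  have hfin : gaussMass w ≠ ∞ := by
    have := gaussMass_comp_add_eq hw.continuous hw.compactSupport hw.nonneg 0
    simp only [add_zero] at this
    rw [this]
    exact ENNReal.ofReal_ne_top
  refine (ENNReal.add_le_add_iff_right hfin).1 ?_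
  rw [← h]
  exact add_le_add le_rfl (hw.center _)

theorem sobolevConst_le_polarize (hN : 1 ≤ N) (hs0 : 0 < s) (hq : 1 ≤ q) {x₀ : Eu N} {r : ℝ}
    (hr : 0 < r) (hB : volume (Metric.ball x₀ r) = 1) (hw : IsCentered s q w) (he : ‖e‖ = 1)
    (hτ : 0 ≤ τ) :
    sobolevConst N s q (Metric.ball x₀ r) ≤ gagliardoSqR N s (polarize e τ w) := by
  obtain ⟨R, hR⟩ := hw.eq_zero
  have hq0 : 0 < q := by linarith
  have hwm := hw.continuous.measurable
  have hpm := measurable_polarize (e := e) (τ := τ) hwm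
  have hpf := (gagliardoSq_polarize_le (s := s) (τ := τ) he (by positivity) hwm).trans_lt hw.energy_lt_top
  have hpc : HasCompactSupport (polarize e τ w) := HasCompactSupport.of_support_subset_isCompact
    (isCompact_closedBall 0 R) fun x hx => by
      by_contra hxx
      exact hx (polarize_eq_zero he hτ hw.nonneg hR (by simpa using hxx))
  have key := sobolevConst_ball_mul_le hN hs0 hq hr hB (continuous_polarize hw.continuous)
    (polarize_nonneg hw.nonneg) hpc hpf
  have hmeas : ∀ t, 0 ≤ t → volume {x | t < polarize e τ w x} = volume {x | t < w x} := by
    intro t _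
    have h1 : ∀ f : Eu N → ℝ, Measurable f →
        volume {x | t < f x} = ∫⁻ x, Set.indicator (Set.Ioi t) (fun _ => (1 : ℝ≥0∞)) (f x) := by
      intro f hf
      rw [← lintegral_indicator_one (measurableSet_lt measurable_const hf)]
      rfl
    rw [h1 _ hpm, h1 _ hwm]
    exact lintegral_comp_polarize he hwm (measurable_const.indicator measurableSet_Ioi)
  rw [hmeas 0 le_rfl, hw.volume_eq, integral_rpow_eq_of_measure_eq hq0 hwm hpm hw.nonneg
    (polarize_nonneg hw.nonneg) hmeas, hw.integral_eq] at key
  simpa using key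

/-- Quantitative half-space asymmetry of a centered competitor. -/
theorem exists_polMinus_le (hN : 2 ≤ N) (hs0 : 0 < s) (hq : 1 ≤ q) :
    ∃ C : ℝ, 0 < C ∧ ∀ (x₀ : Eu N) (r : ℝ), 0 < r → volume (Metric.ball x₀ r) = 1 →
      ∀ w : Eu N → ℝ, IsCentered s q w → ∀ (e : Eu N) (τ : ℝ), ‖e‖ = 1 → 0 < τ →
      polMinus e τ w ≤ ENNReal.ofReal (C *
        √(gagliardoSqR N s w - sobolevConst N s q (Metric.ball x₀ r)) * min 1 τ) := by
  obtain ⟨c, hc, h⟩ := exists_gagliardoSq_polarize_add_le (N := N) (s := s) hN hs0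
  refine ⟨(√c)⁻¹, by positivity, fun x₀ r hr hB w hw e τ he hτ => ?_⟩
  have hm0 : 0 < min 1 τ := lt_min one_pos hτ
  have h1 := h e τ he hτ w hw.continuous.measurable
  have h2 := hw.polMinus_le_polPlus he hτ.le
  have hball := sobolevConst_le_polarize (by omega) hs0 hq hr hB hw he hτ.le
  set P := polMinus e τ w with hP
  set k := c / min 1 τ ^ 2 with hk
  have hk0 : 0 < k := by positivity
  have h3 : gagliardoSq N s (polarize e τ w) + ENNReal.ofReal k * (P * P) ≤ gagliardoSq N s w :=
    le_trans (by gcongr) h1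
  have hfin := hw.energy_lt_top.ne
  have hfin2 : ENNReal.ofReal k * (P * P) ≠ ∞ := ne_top_of_le_ne_top hfin (le_add_self.trans h3)
  have hPfin : P ≠ ∞ := by
    intro hPt
    rw [hPt] at hfin2
    refine hfin2 ?_
    rw [ENNReal.top_mul_top, ENNReal.mul_top (ENNReal.ofReal_pos.2 hk0).ne']
  have h4 := ENNReal.toReal_mono hfin h3
  rw [ENNReal.toReal_add (ne_top_of_le_ne_top hfin (le_self_add.trans h3)) hfin2,
    ENNReal.toReal_mul, ENNReal.toReal_mul, ENNReal.toReal_ofReal hk0.le] at h4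
  rw [← ENNReal.ofReal_toReal hPfin]
  refine ENNReal.ofReal_le_ofReal ?_
  set δ := gagliardoSqR N s w - sobolevConst N s q (Metric.ball x₀ r) with hδ
  have h5 : k * (P.toReal * P.toReal) ≤ δ := by
    simp only [gagliardoSqR] at hδ hball
    linarith
  have h6 : P.toReal ^ 2 ≤ (min 1 τ) ^ 2 / c * δ := by
    rw [hk] at h5
    rw [div_mul_eq_mul_div, le_div_iff₀ hc]
    rw [div_mul_eq_mul_div, div_le_iff₀ (by positivity)] at h5
    linarith
  have h7 := Real.le_sqrt_of_sq_le h6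
  rw [Real.sqrt_mul (by positivity), Real.sqrt_div (by positivity), Real.sqrt_sq hm0.le] at h7
  calc P.toReal ≤ _ := h7
    _ = _ := by ring

end Center


section Tightness

variable {N : ℕ} {s q : ℝ}

/-- A ball of volume larger than one. -/
theorem exists_one_lt_volume_ball (hN : 1 ≤ N) :
    ∃ ρ : ℝ, 1 ≤ ρ ∧ 1 < volume (Metric.ball (0 : Eu N) ρ) := by
  set V := (volume (Metric.ball (0 : Eu N) 1)).toReal with hV
  have hV0 : 0 < V := unit_ball_volume_pos
  refine ⟨max 1 (2 / V), le_max_left _ _, ?_⟩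
  have h1 : (1 : ℝ) ≤ max 1 (2 / V) := le_max_left _ _
  rw [volume_ball_eq _ (by linarith), ← ENNReal.ofReal_one,
    ENNReal.ofReal_lt_ofReal_iff (by positivity)]
  calc (1 : ℝ) < 2 / V * V := by rw [div_mul_cancel₀ _ hV0.ne']; norm_num
    _ ≤ max 1 (2 / V) * V := by gcongr; exact le_max_right _ _
    _ ≤ max 1 (2 / V) ^ N * V := by gcongr; exact le_self_pow₀ h1 (by omega)

/-- Nearly optimal centered competitors are small outside a fixed ball. -/
theorem exists_tightness (hN : 2 ≤ N) (hs0 : 0 < s) (hq : 1 ≤ q) :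
    ∃ ρ₀ : ℝ, 1 ≤ ρ₀ ∧ ∀ (m : ℝ → ℝ), (∀ η, 0 < η → 0 < m η) → ∀ η, 0 < η →
      ∃ δ₀ : ℝ, 0 < δ₀ ∧ ∀ (x₀ : Eu N) (r : ℝ), 0 < r → volume (Metric.ball x₀ r) = 1 →
      ∀ w : Eu N → ℝ, IsCentered s q w →
      (∀ η, 0 < η → ∀ x y, ‖x - y‖ ≤ m η → |w x - w y| ≤ η) →
      gagliardoSqR N s w - sobolevConst N s q (Metric.ball x₀ r) < δ₀ →
      ∀ x, ρ₀ ≤ ‖x‖ → w x < η := by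
  obtain ⟨C, hC, hP⟩ := exists_polMinus_le (N := N) (s := s) (q := q) hN hs0 hq
  obtain ⟨ρ, hρ1, hρ⟩ := exists_one_lt_volume_ball (N := N) (by omega)
  refine ⟨ρ + 4, by linarith, fun m hm η hη => ?_⟩
  set t := min (m (η / 4)) 1 with ht
  have ht0 : 0 < t := lt_min (hm _ (by positivity)) one_pos
  have ht1 : t ≤ 1 := min_le_right _ _
  set V := t ^ N * (volume (Metric.ball (0 : Eu N) 1)).toReal with hV
  have hV0 : 0 < V := mul_pos (pow_pos ht0 N) unit_ball_volume_pos
  set k := Real.exp (-(ρ + 1) ^ 2) / 2 * (η / 2) with hk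
  have hk0 : 0 < k := by positivity
  refine ⟨(k * V / C) ^ 2, by positivity, fun x₀ r hr hB w hw hmod hδ x hx => ?_⟩
  by_contra! hwx
  obtain ⟨y, hy, hwy⟩ : ∃ y, ‖y‖ < ρ ∧ w y = 0 := by
    by_contra! hne
    refine absurd (measure_mono (μ := volume) (s := Metric.ball (0 : Eu N) ρ)
      (t := {x | 0 < w x}) fun y hy => ?_) ?_
    · exact lt_of_le_of_ne (hw.nonneg y) (hne y (by simpa using hy)).symm
    · rw [hw.volume_eq]
      exact not_le.2 hρ
  obtain ⟨e, τ, he, hτ, hye, hxy, hτe⟩ := exists_hrefl_eq (show ‖y‖ < ‖x‖ by linarith)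
  have hd : ‖x‖ - ‖y‖ ≤ ‖x - y‖ := norm_sub_norm_le x y
  have hd0 : 4 ≤ ‖x - y‖ := by linarith
  have hτ2 : 2 ≤ τ := by
    rw [hτe, le_div_iff₀ (by positivity)]
    have h1 : ‖x - y‖ ≤ ‖x‖ + ‖y‖ := norm_sub_le x y
    nlinarith [norm_nonneg x, norm_nonneg y]
  have hsub : ∀ z ∈ Metric.ball y t, ⟪z, e⟫ ≤ τ - 1 ∧
      k ≤ gaussGap e τ z * max (w (hrefl e τ z) - w z) 0 := by
    intro z hz
    rw [mem_ball_iff_norm] at hz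
    have h1 : ⟪z, e⟫ ≤ τ - 1 := by
      have h2 : ⟪z - y, e⟫ ≤ ‖z - y‖ * ‖e‖ := real_inner_le_norm _ _
      rw [inner_sub_left, he] at h2
      linarith
    refine ⟨h1, ?_⟩
    have h2 : w z ≤ η / 4 := by
      have := (abs_le.1 (hmod (η / 4) (by positivity) z y
        (hz.le.trans (min_le_left _ _)))).2
      linarith
    have h3 : 3 * η / 4 ≤ w (hrefl e τ z) := by
      have h4 : ‖hrefl e τ z - hrefl e τ y‖ ≤ m (η / 4) := by
        rw [norm_hrefl_sub_hrefl he]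
        exact hz.le.trans (min_le_left _ _)
      have := (abs_le.1 (hmod (η / 4) (by positivity) _ _ h4)).1
      rw [hxy] at this
      linarith
    have h5 : η / 2 ≤ max (w (hrefl e τ z) - w z) 0 := le_max_of_le_left (by linarith)
    have hzn : ‖z‖ ≤ ρ + 1 := by
      have := norm_le_norm_add_norm_sub y z
      rw [norm_sub_rev] at this
      linarith
    have h6 : Real.exp (-(ρ + 1) ^ 2) / 2 ≤ gaussGap e τ z := by
      rw [gaussGap_eq he, div_eq_mul_inv]
      have h7 : Real.exp (-(4 * τ * (τ - ⟪z, e⟫))) ≤ 2⁻¹ := by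
        rw [Real.exp_neg]
        refine inv_anti₀ two_pos ?_
        have : 2 * 1 ≤ τ * (τ - ⟪z, e⟫) := by gcongr; linarith
        linarith [Real.add_one_le_exp (4 * τ * (τ - ⟪z, e⟫))]
      refine mul_le_mul (Real.exp_le_exp.2 ?_) (by linarith) (by norm_num) (Real.exp_pos _).le
      nlinarith [norm_nonneg z]
    rw [hk]
    gcongr
    exact (by positivity : (0 : ℝ) ≤ Real.exp (-(ρ + 1) ^ 2) / 2).trans h6
  have hlow : ENNReal.ofReal (k * V) ≤ polMinus e τ w := by
    calc ENNReal.ofReal (k * V) = ∫⁻ _ in Metric.ball y t, ENNReal.ofReal k := by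
          rw [setLIntegral_const, volume_ball_eq _ ht0, ENNReal.ofReal_mul hk0.le]
      _ ≤ ∫⁻ z in Metric.ball y t,
          ENNReal.ofReal (gaussGap e τ z * max (w (hrefl e τ z) - w z) 0) :=
          setLIntegral_mono' Metric.isOpen_ball.measurableSet
            fun z hz => ENNReal.ofReal_le_ofReal (hsub z hz).2
      _ ≤ _ := lintegral_mono_set fun z hz => by
          have := (hsub z hz).1
          rw [Set.mem_ofPred_eq]
          linarith
  have hup := hlow.trans (hP x₀ r hr hB w hw e τ he hτ)
  rw [min_eq_left (by linarith), mul_one, ENNReal.ofReal_le_ofReal_iff (by positivity)] at hup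
  have h8 : √(gagliardoSqR N s w - sobolevConst N s q (Metric.ball x₀ r)) < k * V / C := by
    rw [Real.sqrt_lt' (by positivity)]
    exact hδ
  rw [lt_div_iff₀ hC] at h8
  linarith

end Tightness

section IntegralGeometry

variable {N : ℕ}

/-- Integration in polar coordinates. -/
theorem lintegral_polar (hN : 1 ≤ N) {f : Eu N → ℝ≥0∞} (hf : Measurable f) :
    ∫⁻ x, f x = ∫⁻ e : Metric.sphere (0 : Eu N) 1, (∫⁻ ρ in Set.Ioi (0 : ℝ),
      ENNReal.ofReal (ρ ^ (N - 1)) * f (ρ • (e : Eu N))) ∂(volume : Measure (Eu N)).toSphere := by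
  have hN' : NeZero N := ⟨by omega⟩
  have hsm : Measurable fun p : Metric.sphere (0 : Eu N) 1 × Set.Ioi (0 : ℝ) =>
      f ((p.2 : ℝ) • (p.1 : Eu N)) := by fun_prop
  calc ∫⁻ x, f x = ∫⁻ x : ({0}ᶜ : Set (Eu N)), f x ∂((volume : Measure (Eu N)).comap (↑)) := by
        rw [lintegral_subtype_comap (measurableSet_singleton _).compl f,
          restrict_compl_singleton]
    _ = ∫⁻ p : Metric.sphere (0 : Eu N) 1 × Set.Ioi (0 : ℝ), f ((p.2 : ℝ) • (p.1 : Eu N))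
          ∂((volume : Measure (Eu N)).toSphere.prod
            (Measure.volumeIoiPow (Module.finrank ℝ (Eu N) - 1))) := by
        rw [← (Measure.measurePreserving_homeomorphUnitSphereProd
          (volume : Measure (Eu N))).lintegral_comp hsm]
        refine lintegral_congr fun x => ?_
        congr 1
        have hx : ‖(x : Eu N)‖ ≠ 0 := norm_ne_zero_iff.2 x.2
        simp [smul_smul, mul_inv_cancel₀ hx]
    _ = _ := by
        rw [lintegral_prod _ hsm.aemeasurable]
        refine lintegral_congr fun e => ?_
        rw [finrank_euclideanSpace_fin, Measure.volumeIoiPow,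
          lintegral_withDensity_eq_lintegral_mul _ (by fun_prop) (by fun_prop)]
        exact lintegral_subtype_comap measurableSet_Ioi
          fun ρ : ℝ => ENNReal.ofReal (ρ ^ (N - 1)) * f (ρ • (e : Eu N))

theorem lintegral_comp_affine {g : ℝ → ℝ≥0∞} (hg : Measurable g) (b : ℝ) :
    ∫⁻ t, g t = ENNReal.ofReal 2⁻¹ * ∫⁻ ρ, g (b + 2⁻¹ * ρ) := by
  rw [← lintegral_add_left_eq_self g b]
  conv_lhs => rw [← Real.smul_map_volume_mul_left (a := (2 : ℝ)⁻¹) (by norm_num)]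
  rw [lintegral_smul_measure, lintegral_map (by fun_prop) (by fun_prop), smul_eq_mul,
    abs_of_pos (by norm_num)]

theorem norm_add_sq_sub_sq (y e : Eu N) (he : ‖e‖ = 1) (ρ : ℝ) :
    ‖y + ρ • e‖ ^ 2 - ‖y‖ ^ 2 = 2 * ρ * (⟪y, e⟫ + 2⁻¹ * ρ) := by
  rw [norm_add_sq_real, real_inner_smul_right, norm_smul, he, mul_one, Real.norm_eq_abs, sq_abs]
  ring

/-- The parametrization of pairs of points by the half-spaces exchanging them. -/
theorem lintegral_halfspaces (hN : 1 ≤ N) {Φ : ℝ → Eu N → Eu N → ℝ≥0∞}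
    (hΦ : Measurable fun p : ℝ × Eu N × Eu N => Φ p.1 p.2.1 p.2.2) :
    ∫⁻ e : Metric.sphere (0 : Eu N) 1, (∫⁻ τ in Set.Ioi (0 : ℝ),
      ∫⁻ y in {y : Eu N | ⟪y, (e : Eu N)⟫ < τ}, Φ τ y (hrefl (e : Eu N) τ y))
        ∂(volume : Measure (Eu N)).toSphere =
    ∫⁻ y, ∫⁻ x in {x : Eu N | ‖y‖ < ‖x‖}, ENNReal.ofReal ((2 * ‖x - y‖ ^ (N - 1))⁻¹) *
      Φ ((‖x‖ ^ 2 - ‖y‖ ^ 2) / (2 * ‖x - y‖)) y x := by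
  classical
  set F : Metric.sphere (0 : Eu N) 1 → ℝ → Eu N → ℝ≥0∞ := fun e τ y =>
    if 0 < τ ∧ ⟪y, (e : Eu N)⟫ < τ then Φ τ y (hrefl (e : Eu N) τ y) else 0 with hF
  have hFm : Measurable fun p : Metric.sphere (0 : Eu N) 1 × ℝ × Eu N => F p.1 p.2.1 p.2.2 := by
    refine Measurable.ite ?_ ?_ measurable_const
    · exact (measurableSet_lt (f := fun _ : Metric.sphere (0 : Eu N) 1 × ℝ × Eu N => (0 : ℝ))
        (g := fun p => p.2.1) measurable_const (by fun_prop)).inter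
        (measurableSet_lt (f := fun p : Metric.sphere (0 : Eu N) 1 × ℝ × Eu N =>
          ⟪p.2.2, (p.1 : Eu N)⟫) (g := fun p => p.2.1) (by fun_prop) (by fun_prop))
    · refine hΦ.comp (f := fun p : Metric.sphere (0 : Eu N) 1 × ℝ × Eu N =>
        (p.2.1, p.2.2, hrefl (p.1 : Eu N) p.2.1 p.2.2)) ?_
      unfold hrefl
      fun_prop
  have hL : ∀ e : Metric.sphere (0 : Eu N) 1, (∫⁻ τ in Set.Ioi (0 : ℝ),
      ∫⁻ y in {y : Eu N | ⟪y, (e : Eu N)⟫ < τ}, Φ τ y (hrefl (e : Eu N) τ y)) =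
      ∫⁻ τ, ∫⁻ y, F e τ y := by
    intro e
    rw [← lintegral_indicator measurableSet_Ioi]
    refine lintegral_congr fun τ => ?_
    by_cases hτ : 0 < τ
    · rw [Set.indicator_of_mem (show τ ∈ Set.Ioi (0 : ℝ) from hτ),
        ← lintegral_indicator (measurableSet_lt (by fun_prop) measurable_const)]
      refine lintegral_congr fun y => ?_
      by_cases hy : ⟪y, (e : Eu N)⟫ < τ <;> simp [hF, hy, hτ]
    · rw [Set.indicator_of_notMem (show τ ∉ Set.Ioi (0 : ℝ) from hτ)]
      simp [hF, hτ]
  simp only [hL]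
  have hswap : ∫⁻ e, (∫⁻ τ, ∫⁻ y, F e τ y) ∂(volume : Measure (Eu N)).toSphere =
      ∫⁻ y, ∫⁻ e, (∫⁻ τ, F e τ y) ∂(volume : Measure (Eu N)).toSphere := by
    have h1 : ∀ e, ∫⁻ τ, ∫⁻ y, F e τ y = ∫⁻ y, ∫⁻ τ, F e τ y := fun e =>
      lintegral_lintegral_swap (hFm.comp (by fun_prop :
        Measurable fun p : ℝ × Eu N => (e, p.1, p.2))).aemeasurable
    simp only [h1]
    refine lintegral_lintegral_swap (Measurable.aemeasurable ?_)
    exact Measurable.lintegral_prod_right' (f := fun p : (Metric.sphere (0 : Eu N) 1 × Eu N) × ℝ =>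
      F p.1.1 p.2 p.1.2) (hFm.comp (by fun_prop : Measurable fun
        p : (Metric.sphere (0 : Eu N) 1 × Eu N) × ℝ => (p.1.1, p.2, p.1.2)))
  rw [hswap]
  refine lintegral_congr fun y => ?_
  set H : Eu N → ℝ≥0∞ := fun x => if ‖y‖ < ‖x‖ then
    ENNReal.ofReal ((2 * ‖x - y‖ ^ (N - 1))⁻¹) *
      Φ ((‖x‖ ^ 2 - ‖y‖ ^ 2) / (2 * ‖x - y‖)) y x else 0 with hH
  have hHm : Measurable H := by
    refine Measurable.ite (measurableSet_lt measurable_const measurable_norm) ?_ measurable_const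
    refine Measurable.mul (by fun_prop) (hΦ.comp (f := fun x : Eu N =>
      ((‖x‖ ^ 2 - ‖y‖ ^ 2) / (2 * ‖x - y‖), y, x)) (by fun_prop))
  have hR : ∫⁻ x in {x : Eu N | ‖y‖ < ‖x‖}, ENNReal.ofReal ((2 * ‖x - y‖ ^ (N - 1))⁻¹) *
      Φ ((‖x‖ ^ 2 - ‖y‖ ^ 2) / (2 * ‖x - y‖)) y x = ∫⁻ x, H (y + x) := by
    rw [lintegral_add_left_eq_self H y,
      ← lintegral_indicator (measurableSet_lt measurable_const measurable_norm)]
    refine lintegral_congr fun x => ?_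
    simp only [hH, Set.indicator_apply, Set.mem_ofPred_eq]
  have hHm' : Measurable fun x => H (y + x) := hHm.comp (measurable_const_add y)
  rw [hR, lintegral_polar hN hHm']
  refine lintegral_congr fun e => ?_
  have he : ‖(e : Eu N)‖ = 1 := by simp
  have hFe : Measurable fun t => F e t y :=
    hFm.comp (by fun_prop : Measurable fun t : ℝ => (e, t, y))
  rw [lintegral_comp_affine hFe ⟪y, (e : Eu N)⟫, ← lintegral_indicator measurableSet_Ioi,
    ← lintegral_const_mul' _ _ ENNReal.ofReal_ne_top]
  refine lintegral_congr fun ρ => ?_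
  by_cases hρ : 0 < ρ
  · rw [Set.indicator_of_mem (show ρ ∈ Set.Ioi (0 : ℝ) from hρ)]
    have hsq := norm_add_sq_sub_sq y e he ρ
    have hrf : hrefl (e : Eu N) (⟪y, (e : Eu N)⟫ + 2⁻¹ * ρ) y = y + ρ • (e : Eu N) := by
      rw [hrefl]
      congr 2
      ring
    have hn : ‖y + ρ • (e : Eu N) - y‖ = ρ := by
      rw [add_sub_cancel_left, norm_smul, he, mul_one, Real.norm_of_nonneg hρ.le]
    have hiff : ‖y‖ < ‖y + ρ • (e : Eu N)‖ ↔ 0 < ⟪y, (e : Eu N)⟫ + 2⁻¹ * ρ := by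
      rw [← sq_lt_sq₀ (norm_nonneg _) (norm_nonneg _), ← sub_pos, hsq,
        mul_pos_iff_of_pos_left (by positivity)]
    have hlt : ⟪y, (e : Eu N)⟫ < ⟪y, (e : Eu N)⟫ + 2⁻¹ * ρ := by linarith
    simp only [hF, hH, hiff, hn, hrf, hlt, and_true]
    by_cases hc : 0 < ⟪y, (e : Eu N)⟫ + 2⁻¹ * ρ
    · simp only [hc, if_true]
      rw [← mul_assoc, ← ENNReal.ofReal_mul (by positivity), hsq]
      congr 2
      · field_simp
      · field_simp
    · simp only [hc, if_false, mul_zero]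
  · rw [Set.indicator_of_notMem (show ρ ∉ Set.Ioi (0 : ℝ) from hρ)]
    have hlt : ¬ ⟪y, (e : Eu N)⟫ < ⟪y, (e : Eu N)⟫ + 2⁻¹ * ρ := by
      push Not at hρ ⊢
      linarith
    simp only [hF, hlt, and_false, if_false, mul_zero]

end IntegralGeometry

section KernelBound

variable {N : ℕ} {s q : ℝ}

/-- The kernel produced by averaging over all half-spaces. -/
def reflKernel (s : ℝ) (x y : Eu N) : ℝ :=
  (‖x - y‖ ^ (N - 2))⁻¹ * ((‖x‖ ^ 2 - ‖y‖ ^ 2) / (2 * ‖x - y‖)) ^ (-s)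

open Classical in
/-- The kernel `reflKernel`, restricted to the pairs with `‖y‖ < ‖x‖ < ρ`. -/
def crossKernel (s ρ : ℝ) (x y : Eu N) : ℝ≥0∞ :=
  if ‖y‖ < ‖x‖ ∧ ‖x‖ < ρ then ENNReal.ofReal (reflKernel s x y) else 0

theorem measurable_crossKernel (s ρ : ℝ) :
    Measurable fun p : Eu N × Eu N => crossKernel s ρ p.1 p.2 := by
  refine Measurable.ite ?_ ?_ measurable_const
  · exact (measurableSet_lt (f := fun p : Eu N × Eu N => ‖p.2‖) (g := fun p => ‖p.1‖)
      (by fun_prop) (by fun_prop)).inter (measurableSet_lt (f := fun p : Eu N × Eu N => ‖p.1‖)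
      (by fun_prop) measurable_const)
  · unfold reflKernel
    fun_prop

theorem half_space_offset_lt {x y : Eu N} {ρ : ℝ} (hyx : ‖y‖ < ‖x‖) (hx : ‖x‖ < ρ) :
    0 < (‖x‖ ^ 2 - ‖y‖ ^ 2) / (2 * ‖x - y‖) ∧ (‖x‖ ^ 2 - ‖y‖ ^ 2) / (2 * ‖x - y‖) < ρ := by
  have h1 : ‖x‖ - ‖y‖ ≤ ‖x - y‖ := norm_sub_norm_le x y
  have h2 := norm_nonneg y
  have h3 : 0 < ‖x - y‖ := by linarith
  refine ⟨div_pos (by nlinarith) (by positivity), ?_⟩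
  rw [div_lt_iff₀ (by positivity)]
  nlinarith

theorem mul_norm_hrefl_sub_le {e : Eu N} {τ ρ : ℝ} (he : ‖e‖ = 1) (hτ : 0 < τ) (hτρ : τ < ρ)
    {y : Eu N} (hy : ⟪y, e⟫ < τ) (hyρ : ‖hrefl e τ y‖ < ρ) :
    τ * ‖hrefl e τ y - y‖ ≤ Real.exp (ρ ^ 2) * (1 + 8 * ρ ^ 2) * gaussGap e τ y := by
  have hd : 0 < τ - ⟪y, e⟫ := sub_pos.2 hy
  set t := 4 * τ * (τ - ⟪y, e⟫) with ht
  have ht0 : 0 < t := by positivity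
  have hsq := norm_hrefl_sq (τ := τ) he y
  have hyl : ‖y‖ < ρ := by
    refine lt_of_pow_lt_pow_left₀ 2 ((norm_nonneg _).trans hyρ.le) ?_
    have : ‖hrefl e τ y‖ ^ 2 < ρ ^ 2 := by gcongr
    linarith
  have hin : -ρ ≤ ⟪y, e⟫ := by
    have := abs_real_inner_le_norm y e
    rw [he, mul_one] at this
    linarith [neg_abs_le ⟪y, e⟫]
  have htρ : t ≤ 8 * ρ ^ 2 := by
    have : τ * (τ - ⟪y, e⟫) ≤ ρ * (2 * ρ) := mul_le_mul hτρ.le (by linarith) hd.le (by linarith)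
    linarith
  have hnorm : ‖hrefl e τ y - y‖ = 2 * (τ - ⟪y, e⟫) := by
    rw [hrefl, add_sub_cancel_left, norm_smul, he, mul_one, Real.norm_of_nonneg (by positivity)]
  have hexp : t ≤ (1 + 8 * ρ ^ 2) * (1 - Real.exp (-t)) := by
    have h1 : Real.exp (-t) ≤ 1 / (1 + t) := by
      rw [Real.exp_neg, one_div]
      exact inv_anti₀ (by positivity) (by linarith [Real.add_one_le_exp t])
    have h2 : t / (1 + t) ≤ 1 - Real.exp (-t) := by
      have : t / (1 + t) = 1 - 1 / (1 + t) := by field_simp; ring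
      linarith
    calc t = (1 + t) * (t / (1 + t)) := by field_simp
      _ ≤ (1 + 8 * ρ ^ 2) * (1 - Real.exp (-t)) := by gcongr
  have h3 : 1 ≤ Real.exp (ρ ^ 2) * Real.exp (-‖y‖ ^ 2) := by
    rw [← Real.exp_add]
    refine Real.one_le_exp ?_
    have : ‖y‖ ^ 2 ≤ ρ ^ 2 := by gcongr
    linarith
  rw [gaussGap_eq he, hnorm, ← ht]
  calc τ * (2 * (τ - ⟪y, e⟫)) ≤ t := by rw [ht]; nlinarith
    _ ≤ 1 * ((1 + 8 * ρ ^ 2) * (1 - Real.exp (-t))) := by linarith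
    _ ≤ (Real.exp (ρ ^ 2) * Real.exp (-‖y‖ ^ 2)) * ((1 + 8 * ρ ^ 2) * (1 - Real.exp (-t))) := by
        gcongr
        exact ht0.le.trans hexp
    _ = _ := by ring

theorem lintegral_rpow_neg_lt_top (hs1 : s < 1) (ρ : ℝ) :
    ∫⁻ τ in Set.Ioo 0 ρ, ENNReal.ofReal (τ ^ (-s)) < ∞ := by
  have h := (intervalIntegral.intervalIntegrable_rpow' (a := 0) (b := ρ)
    (show -1 < -s by linarith)).1
  refine lt_of_le_of_lt (lintegral_mono_set Set.Ioo_subset_Ioc_self) ?_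
  refine lt_of_le_of_lt (lintegral_mono fun τ => ?_) h.2
  rw [← ofReal_norm]
  exact ENNReal.ofReal_le_ofReal (Real.le_norm_self _)

/-- The averaged asymmetry of a centered competitor. -/
theorem exists_crossKernel_le (hN : 2 ≤ N) (hs0 : 0 < s) (hs1 : s < 1) (hq : 1 ≤ q) (ρ : ℝ) :
    ∃ C : ℝ, 0 < C ∧ ∀ (x₀ : Eu N) (r : ℝ), 0 < r → volume (Metric.ball x₀ r) = 1 →
      ∀ w : Eu N → ℝ, IsCentered s q w →
      ∫⁻ y, ∫⁻ x, crossKernel s ρ x y * ENNReal.ofReal (max (w x - w y) 0) ≤ ENNReal.ofReal (C *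
        √(gagliardoSqR N s w - sobolevConst N s q (Metric.ball x₀ r))) := by
  classical
  obtain ⟨C, hC, hP⟩ := exists_polMinus_le (N := N) (s := s) (q := q) hN hs0 hq
  set c₁ := Real.exp (ρ ^ 2) * (1 + 8 * ρ ^ 2) with hc₁
  have hc₁0 : 0 < c₁ := by positivity
  set I := ∫⁻ τ in Set.Ioo 0 ρ, ENNReal.ofReal (τ ^ (-s)) with hI
  have hIt : I < ∞ := lintegral_rpow_neg_lt_top hs1 ρ
  set K := ENNReal.ofReal 2 * (I * (volume : Measure (Eu N)).toSphere Set.univ) with hK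
  have hKt : K < ∞ := ENNReal.mul_lt_top ENNReal.ofReal_lt_top
    (ENNReal.mul_lt_top hIt (measure_lt_top _ _))
  refine ⟨K.toReal * (c₁ * C) + 1, by positivity, fun x₀ r hr hB w hw => ?_⟩
  set δ := √(gagliardoSqR N s w - sobolevConst N s q (Metric.ball x₀ r)) with hδ
  have hδ0 : 0 ≤ δ := Real.sqrt_nonneg _
  have hwm := hw.continuous.measurable
  set Φ : ℝ → Eu N → Eu N → ℝ≥0∞ := fun τ y x => if ‖x‖ < ρ ∧ τ < ρ then
    ENNReal.ofReal (τ ^ (-s) * ‖x - y‖ * max (w x - w y) 0) else 0 with hΦ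
  have hΦm : Measurable fun p : ℝ × Eu N × Eu N => Φ p.1 p.2.1 p.2.2 := by
    refine Measurable.ite ?_ (by fun_prop) measurable_const
    exact (measurableSet_lt (f := fun p : ℝ × Eu N × Eu N => ‖p.2.2‖) (by fun_prop)
      measurable_const).inter (measurableSet_lt measurable_fst measurable_const)
  have hle : ∫⁻ y, ∫⁻ x, crossKernel s ρ x y * ENNReal.ofReal (max (w x - w y) 0) ≤
      ENNReal.ofReal 2 * ∫⁻ y, ∫⁻ x in {x : Eu N | ‖y‖ < ‖x‖}, ENNReal.ofReal ((2 * ‖x - y‖ ^ (N - 1))⁻¹) *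
        Φ ((‖x‖ ^ 2 - ‖y‖ ^ 2) / (2 * ‖x - y‖)) y x := by
    rw [← lintegral_const_mul' _ _ ENNReal.ofReal_ne_top]
    refine lintegral_mono fun y => ?_
    rw [← lintegral_const_mul' _ _ ENNReal.ofReal_ne_top,
      ← lintegral_indicator (measurableSet_lt measurable_const measurable_norm)]
    refine lintegral_mono fun x => ?_
    by_cases h : ‖y‖ < ‖x‖ ∧ ‖x‖ < ρ
    · obtain ⟨h1, h2⟩ := h
      obtain ⟨hτ0, hτρ⟩ := half_space_offset_lt h1 h2
      have hxy : 0 < ‖x - y‖ := norm_pos_iff.2 (sub_ne_zero.2 fun h' => by simp [h'] at h1)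
      rw [Set.indicator_of_mem (by exact h1)]
      simp only [crossKernel, hΦ, h1, h2, hτρ, and_self, if_true]
      set τ := (‖x‖ ^ 2 - ‖y‖ ^ 2) / (2 * ‖x - y‖) with hτ
      have h0 : 0 ≤ reflKernel s x y := by unfold reflKernel; positivity
      rw [← ENNReal.ofReal_mul h0, ← ENNReal.ofReal_mul (by positivity),
        ← ENNReal.ofReal_mul (by norm_num)]
      refine ENNReal.ofReal_le_ofReal (le_of_eq ?_)
      rw [reflKernel, ← hτ]
      have hpow : ‖x - y‖ ^ (N - 1) = ‖x - y‖ ^ (N - 2) * ‖x - y‖ := by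
        rw [← pow_succ]
        congr 1
        omega
      rw [hpow]
      field_simp
    · simp [crossKernel, h]
  refine hle.trans ?_
  rw [← lintegral_halfspaces (by omega) hΦm]
  have hinner : ∀ e : Metric.sphere (0 : Eu N) 1, (∫⁻ τ in Set.Ioi (0 : ℝ),
      ∫⁻ y in {y : Eu N | ⟪y, (e : Eu N)⟫ < τ}, Φ τ y (hrefl (e : Eu N) τ y)) ≤
      I * ENNReal.ofReal (c₁ * C * δ) := by
    intro e
    have he : ‖(e : Eu N)‖ = 1 := by simp
    rw [hI, ← lintegral_mul_const' _ _ ENNReal.ofReal_ne_top,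
      ← lintegral_indicator measurableSet_Ioi, ← lintegral_indicator measurableSet_Ioo]
    refine lintegral_mono fun τ => ?_
    by_cases hτ0 : 0 < τ
    swap
    · rw [Set.indicator_of_notMem (by exact hτ0)]
      exact zero_le
    rw [Set.indicator_of_mem (show τ ∈ Set.Ioi (0 : ℝ) from hτ0)]
    by_cases hτρ : τ < ρ
    swap
    · simp [hΦ, hτρ]
    rw [Set.indicator_of_mem (show τ ∈ Set.Ioo 0 ρ from ⟨hτ0, hτρ⟩)]
    calc ∫⁻ y in {y : Eu N | ⟪y, (e : Eu N)⟫ < τ}, Φ τ y (hrefl (e : Eu N) τ y)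
        ≤ ∫⁻ y in {y : Eu N | ⟪y, (e : Eu N)⟫ < τ}, ENNReal.ofReal (τ ^ (-s) * τ⁻¹ * c₁) *
            ENNReal.ofReal (gaussGap (e : Eu N) τ y *
              max (w (hrefl (e : Eu N) τ y) - w y) 0) := by
          refine setLIntegral_mono' (measurableSet_lt (by fun_prop) measurable_const)
            fun y hy => ?_
          rw [Set.mem_ofPred_eq] at hy
          by_cases hρy : ‖hrefl (e : Eu N) τ y‖ < ρ
          · simp only [hΦ, hρy, hτρ, and_self, if_true]
            rw [← ENNReal.ofReal_mul (by positivity)]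
            refine ENNReal.ofReal_le_ofReal ?_
            have h1 := mul_norm_hrefl_sub_le he hτ0 hτρ hy hρy
            have h2 : ‖hrefl (e : Eu N) τ y - y‖ ≤ τ⁻¹ * (c₁ * gaussGap (e : Eu N) τ y) := by
              rw [inv_mul_eq_div, le_div_iff₀ hτ0]
              linarith
            calc τ ^ (-s) * ‖hrefl (e : Eu N) τ y - y‖ * max (w (hrefl (e : Eu N) τ y) - w y) 0
                ≤ τ ^ (-s) * (τ⁻¹ * (c₁ * gaussGap (e : Eu N) τ y)) *
                  max (w (hrefl (e : Eu N) τ y) - w y) 0 := by gcongr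
              _ = _ := by ring
          · simp only [hΦ, hρy, false_and, if_false]
            exact zero_le
      _ ≤ ENNReal.ofReal (τ ^ (-s) * τ⁻¹ * c₁) * polMinus (e : Eu N) τ w := by
          rw [lintegral_const_mul' _ _ ENNReal.ofReal_ne_top]
          gcongr
          exact lintegral_mono_set fun y (hy : ⟪y, (e : Eu N)⟫ < τ) => hy.le
      _ ≤ ENNReal.ofReal (τ ^ (-s) * τ⁻¹ * c₁) * ENNReal.ofReal (C * δ * min 1 τ) := by
          gcongr
          exact hP x₀ r hr hB w hw _ τ he hτ0
      _ ≤ ENNReal.ofReal (τ ^ (-s)) * ENNReal.ofReal (c₁ * C * δ) := by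
          rw [← ENNReal.ofReal_mul (by positivity), ← ENNReal.ofReal_mul (by positivity)]
          refine ENNReal.ofReal_le_ofReal ?_
          calc τ ^ (-s) * τ⁻¹ * c₁ * (C * δ * min 1 τ) ≤ τ ^ (-s) * τ⁻¹ * c₁ * (C * δ * τ) := by
                gcongr
                exact min_le_right _ _
            _ = _ := by field_simp
  calc ENNReal.ofReal 2 * ∫⁻ e : Metric.sphere (0 : Eu N) 1, (∫⁻ τ in Set.Ioi (0 : ℝ),
        ∫⁻ y in {y : Eu N | ⟪y, (e : Eu N)⟫ < τ}, Φ τ y (hrefl (e : Eu N) τ y))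
          ∂(volume : Measure (Eu N)).toSphere
      ≤ ENNReal.ofReal 2 * ∫⁻ _ : Metric.sphere (0 : Eu N) 1, I * ENNReal.ofReal (c₁ * C * δ)
          ∂(volume : Measure (Eu N)).toSphere := by gcongr with e; exact hinner e
    _ = K * ENNReal.ofReal (c₁ * C * δ) := by
        rw [lintegral_const, hK]
        ring
    _ = ENNReal.ofReal (K.toReal * (c₁ * C * δ)) := by
        rw [ENNReal.ofReal_mul ENNReal.toReal_nonneg, ENNReal.ofReal_toReal hKt.ne]
    _ ≤ _ := by
        refine ENNReal.ofReal_le_ofReal ?_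
        nlinarith

end KernelBound

section Shells

variable {N : ℕ}

/-- The volume of the ball centred at the origin whose boundary contains `x`. -/
def radVol (x : Eu N) : ℝ := (volume (Metric.ball (0 : Eu N) 1)).toReal * ‖x‖ ^ N

theorem continuous_radVol : Continuous (radVol : Eu N → ℝ) := by
  unfold radVol
  fun_prop

theorem radVol_nonneg (x : Eu N) : 0 ≤ radVol x := by
  unfold radVol
  positivity

theorem norm_lt_of_radVol_lt {x y : Eu N} (h : radVol x < radVol y) : ‖x‖ < ‖y‖ := by
  unfold radVol at h
  exact lt_of_pow_lt_pow_left₀ N (norm_nonneg _)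
    (lt_of_mul_lt_mul_left h ENNReal.toReal_nonneg)

theorem exists_radVol_lt_iff (hN : 1 ≤ N) {b : ℝ} (hb : 0 ≤ b) :
    ∃ r, 0 ≤ r ∧ r ^ N * (volume (Metric.ball (0 : Eu N) 1)).toReal = b ∧
      {x : Eu N | radVol x < b} = Metric.ball 0 r ∧
      {x : Eu N | radVol x ≤ b} = Metric.closedBall 0 r := by
  have hω := unit_ball_volume_pos (N := N)
  set ω := (volume (Metric.ball (0 : Eu N) 1)).toReal with hωd
  have hN0 : N ≠ 0 := by omega
  obtain ⟨r, hr0, hr⟩ : ∃ r : ℝ, 0 ≤ r ∧ r ^ N = b / ω :=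
    ⟨(b / ω) ^ ((N : ℝ)⁻¹), by positivity, Real.rpow_inv_natCast_pow (by positivity) hN0⟩
  have hrb : r ^ N * ω = b := by rw [hr]; field_simp
  refine ⟨r, hr0, hrb, ?_, ?_⟩
  · ext x
    rw [Set.mem_ofPred_eq, mem_ball_zero_iff, radVol, ← hωd, ← hrb, mul_comm, mul_lt_mul_iff_left₀ hω,
      pow_lt_pow_iff_left₀ (norm_nonneg x) hr0 hN0]
  · ext x
    rw [Set.mem_ofPred_eq, mem_closedBall_zero_iff, radVol, ← hωd, ← hrb, mul_comm,
      mul_le_mul_iff_left₀ hω, pow_le_pow_iff_left₀ (norm_nonneg x) hr0 hN0]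

theorem volume_radVol_lt (hN : 1 ≤ N) {b : ℝ} (hb : 0 ≤ b) :
    volume.real {x : Eu N | radVol x < b} = b ∧ volume {x : Eu N | radVol x < b} < ∞ := by
  obtain ⟨r, hr0, hrb, h, -⟩ := exists_radVol_lt_iff hN hb
  rw [h]
  refine ⟨?_, measure_ball_lt_top⟩
  rcases hr0.eq_or_lt with rfl | hr
  · simp [← hrb, zero_pow (show N ≠ 0 by omega)]
  · rw [measureReal_def, volume_ball_eq _ hr, ENNReal.toReal_ofReal (by positivity), hrb]

theorem volume_radVol_le (hN : 1 ≤ N) {b : ℝ} (hb : 0 ≤ b) :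
    volume.real {x : Eu N | radVol x ≤ b} = b ∧ volume {x : Eu N | radVol x ≤ b} < ∞ := by
  have : Nonempty (Fin N) := ⟨⟨0, hN⟩⟩
  obtain ⟨r, hr0, hrb, h, h'⟩ := exists_radVol_lt_iff (N := N) hN hb
  have h2 := volume_radVol_lt (N := N) hN hb
  rw [h] at h2
  rw [h']
  have : volume (Metric.closedBall (0 : Eu N) r) = volume (Metric.ball (0 : Eu N) r) :=
    Measure.addHaar_closedBall_eq_addHaar_ball volume 0 r
  rw [measureReal_def, this]
  exact h2

/-- The open spherical shell between two radial volumes. -/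
def shell (N : ℕ) (a b : ℝ) : Set (Eu N) := {x | a < radVol x ∧ radVol x < b}

theorem measurableSet_shell (a b : ℝ) : MeasurableSet (shell N a b) :=
  (measurableSet_lt measurable_const continuous_radVol.measurable).inter
    (measurableSet_lt continuous_radVol.measurable measurable_const)

theorem volume_shell_lt_top (hN : 1 ≤ N) (a : ℝ) {b : ℝ} (hb : 0 ≤ b) :
    volume (shell N a b) < ∞ :=
  (measure_mono fun _ hx => hx.2).trans_lt (volume_radVol_lt hN hb).2

theorem volume_shell (hN : 1 ≤ N) {a b : ℝ} (ha : 0 ≤ a) (hab : a < b) :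
    volume.real (shell N a b) = b - a := by
  have h : shell N a b = {x | radVol x < b} \ {x | radVol x ≤ a} := by
    ext x
    simp only [shell, Set.mem_sdiff, Set.mem_ofPred_eq, not_le]
    exact and_comm
  have hsub : {x : Eu N | radVol x ≤ a} ⊆ {x | radVol x < b} := fun x hx => lt_of_le_of_lt hx hab
  rw [h, measureReal_sdiff hsub
    (measurableSet_le continuous_radVol.measurable measurable_const)
    (volume_radVol_lt hN (ha.trans hab.le)).2.ne, (volume_radVol_lt hN (ha.trans hab.le)).1,
    (volume_radVol_le hN ha).1]

theorem volume_half_open_shell_le (hN : 1 ≤ N) {a b : ℝ} (ha : 0 ≤ a) (hab : a ≤ b) :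
    volume.real {x : Eu N | a ≤ radVol x ∧ radVol x < b} ≤ b - a := by
  have h : {x : Eu N | a ≤ radVol x ∧ radVol x < b} = {x | radVol x < b} \ {x | radVol x < a} := by
    ext x
    simp only [Set.mem_sdiff, Set.mem_ofPred_eq, not_lt]
    exact and_comm
  have hsub : {x : Eu N | radVol x < a} ⊆ {x | radVol x < b} := fun x hx => lt_of_lt_of_le hx hab
  rw [h, measureReal_sdiff hsub
    (measurableSet_lt continuous_radVol.measurable measurable_const)
    (volume_radVol_lt hN (ha.trans hab)).2.ne, (volume_radVol_lt hN (ha.trans hab)).1,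
    (volume_radVol_lt hN ha).1]

/-- The open cone of aperture `π / 4` around `x`. -/
def cone (x : Eu N) : Set (Eu N) := {z | ‖x‖ * ‖z‖ < √2 * ⟪x, z⟫}

theorem measurableSet_cone (x : Eu N) : MeasurableSet (cone x) :=
  measurableSet_lt (by fun_prop) (by fun_prop)

theorem disjoint_cone {x y : Eu N} (hxy : ⟪x, y⟫ ≤ 0) : Disjoint (cone x) (cone y) := by
  rw [Set.disjoint_left]
  intro z hx hy
  simp only [cone, Set.mem_ofPred_eq] at hx hy
  rcases eq_or_ne x 0 with rfl | hx0
  · simp at hx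
  rcases eq_or_ne y 0 with rfl | hy0
  · simp at hy
  have hx1 : 0 < ‖x‖ := norm_pos_iff.2 hx0
  have hy1 : 0 < ‖y‖ := norm_pos_iff.2 hy0
  have h2 : √2 ^ 2 = 2 := Real.sq_sqrt (by norm_num)
  have h20 : 0 < √2 := by positivity
  have hz0 := norm_nonneg z
  set v : Eu N := ‖y‖ • x + ‖x‖ • y with hv
  have hv2 : ‖v‖ ^ 2 ≤ (√2 * (‖x‖ * ‖y‖)) ^ 2 := by
    rw [hv, @norm_add_sq_real, norm_smul, norm_smul, inner_smul_left, inner_smul_right]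
    simp only [norm_norm, conj_trivial]
    have : ‖y‖ * (‖x‖ * ⟪x, y⟫) ≤ 0 := by
      have := mul_nonpos_of_nonneg_of_nonpos (mul_pos hy1 hx1).le hxy
      linarith
    nlinarith
  have hvn : ‖v‖ ≤ √2 * (‖x‖ * ‖y‖) := le_of_sq_le_sq hv2 (by positivity)
  have h3 : ⟪v, z⟫ ≤ ‖v‖ * ‖z‖ := real_inner_le_norm _ _
  have h4 : ⟪v, z⟫ = ‖y‖ * ⟪x, z⟫ + ‖x‖ * ⟪y, z⟫ := by
    rw [hv, inner_add_left, inner_smul_left, inner_smul_left]; rfl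
  have h5 : ‖v‖ * ‖z‖ ≤ √2 * (‖x‖ * ‖y‖) * ‖z‖ := by gcongr
  have h6 := mul_lt_mul_of_pos_left hx hy1
  have h7 := mul_lt_mul_of_pos_left hy hx1
  have h8 : √2 * ⟪v, z⟫ ≤ √2 * (√2 * (‖x‖ * ‖y‖) * ‖z‖) := by gcongr; linarith
  have h9 : √2 * (√2 * (‖x‖ * ‖y‖) * ‖z‖) = 2 * (‖x‖ * ‖y‖ * ‖z‖) := by
    linear_combination (‖x‖ * ‖y‖ * ‖z‖) * h2
  rw [h4, h9] at h8
  linarith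

theorem exists_orthogonal_norm_eq (hN : 2 ≤ N) (x : Eu N) : ∃ w : Eu N, ⟪x, w⟫ = 0 ∧ ‖w‖ = ‖x‖ := by
  have hlt : Module.finrank ℝ (Submodule.span ℝ {x}) < Module.finrank ℝ (Eu N) := by
    have := finrank_span_le_card (R := ℝ) ({x} : Set (Eu N))
    simp at this ⊢
    omega
  obtain ⟨v, hv0, hv⟩ : ∃ v : Eu N, v ≠ 0 ∧ ⟪x, v⟫ = 0 := by
    by_contra! h
    have hb : (Submodule.span ℝ {x})ᗮ = ⊥ := by
      rw [Submodule.eq_bot_iff]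
      intro v hv
      by_contra hv0
      exact h v hv0 (Submodule.mem_orthogonal_singleton_iff_inner_right.1 hv)
    rw [Submodule.orthogonal_eq_bot_iff] at hb
    rw [hb, finrank_top] at hlt
    exact lt_irrefl _ hlt
  refine ⟨(‖x‖ / ‖v‖) • v, by rw [inner_smul_right, hv, mul_zero], ?_⟩
  rw [norm_smul, norm_div, norm_norm, norm_norm, div_mul_cancel₀ _ (norm_ne_zero_iff.2 hv0)]

theorem volume_cone_eq {x y : Eu N} (hxy : ‖x‖ = ‖y‖) (a b : ℝ) :
    volume.real (cone x ∩ shell N a b) = volume.real (cone y ∩ shell N a b) := by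
  rcases eq_or_ne x y with rfl | hne
  · rfl
  have hsub : x - y ≠ 0 := sub_ne_zero.2 hne
  set K : Submodule ℝ (Eu N) := (Submodule.span ℝ {x - y})ᗮ with hK
  have href : K.reflection x = y := Submodule.reflection_sub hxy
  have hmp := (K.reflection).measurePreserving
  have hpre : K.reflection ⁻¹' (cone y ∩ shell N a b) = cone x ∩ shell N a b := by
    ext z
    simp only [cone, shell, radVol, Set.mem_preimage, Set.mem_inter_iff, Set.mem_ofPred_eq,
      LinearIsometryEquiv.norm_map]
    have hin : ⟪y, K.reflection z⟫ = ⟪x, z⟫ := by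
      have := LinearIsometryEquiv.inner_map_map K.reflection x z
      rwa [href] at this
    rw [hin, hxy]
  rw [measureReal_def, measureReal_def, ← hpre, hmp.measure_preimage
    ((measurableSet_cone y).inter (measurableSet_shell a b)).nullMeasurableSet]

theorem volume_cone_inter_shell_le (hN : 2 ≤ N) (x : Eu N) {a b : ℝ} (ha : 0 ≤ a) (hab : a < b) :
    volume.real (cone x ∩ shell N a b) ≤ (b - a) / 3 := by
  obtain ⟨w, hw, hwx⟩ := exists_orthogonal_norm_eq hN x
  have hfin : volume (shell N a b) ≠ ∞ :=
    (volume_shell_lt_top (by omega) a (ha.trans hab.le)).ne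
  have hm : ∀ y : Eu N, MeasurableSet (cone y ∩ shell N a b) := fun y =>
    (measurableSet_cone y).inter (measurableSet_shell a b)
  have hf : ∀ y : Eu N, volume (cone y ∩ shell N a b) ≠ ∞ := fun y =>
    measure_ne_top_of_subset Set.inter_subset_right hfin
  have hd : ∀ {y z : Eu N}, ⟪y, z⟫ ≤ 0 → Disjoint (cone y ∩ shell N a b) (cone z ∩ shell N a b) :=
    fun h => (disjoint_cone h).mono Set.inter_subset_left Set.inter_subset_left
  have h1 : ⟪x, -x⟫ ≤ 0 := by
    rw [inner_neg_right, real_inner_self_eq_norm_sq]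
    nlinarith [norm_nonneg x]
  have h2 : ⟪-x, w⟫ ≤ 0 := by rw [inner_neg_left, hw, neg_zero]
  have hu : volume.real ((cone x ∩ shell N a b ∪ cone (-x) ∩ shell N a b) ∪
      cone w ∩ shell N a b) = 3 * volume.real (cone x ∩ shell N a b) := by
    rw [measureReal_union _ (hm w) (measure_union_ne_top (hf _) (hf _)) (hf _),
      measureReal_union (hd h1) (hm _) (hf _) (hf _), ← volume_cone_eq hwx.symm a b,
      ← volume_cone_eq (norm_neg x).symm a b]
    · ring
    · exact Set.disjoint_union_left.2 ⟨hd hw.le, hd h2⟩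
  have hle : volume.real ((cone x ∩ shell N a b ∪ cone (-x) ∩ shell N a b) ∪
      cone w ∩ shell N a b) ≤ volume.real (shell N a b) :=
    measureReal_mono (Set.union_subset (Set.union_subset Set.inter_subset_right
      Set.inter_subset_right) Set.inter_subset_right) hfin
  rw [hu, volume_shell (by omega) ha hab] at hle
  linarith

theorem exists_le_reflKernel {s : ℝ} (hN : 2 ≤ N) (hs0 : 0 < s) (hs1 : s < 1) {ρ : ℝ} (hρ : 0 < ρ) :
    ∃ c, 0 < c ∧ ∀ (x z : Eu N) (a : ℝ), ‖x‖ < ρ → radVol z < radVol x → 0 < a → a ≤ radVol x →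
      radVol x ≤ radVol z + 8 * a → √2 * ⟪x, z⟫ ≤ ‖x‖ * ‖z‖ →
      c * a ^ (-(s / 2)) ≤ reflKernel s x z := by
  have hω := unit_ball_volume_pos (N := N)
  set ω := (volume (Metric.ball (0 : Eu N) 1)).toReal with hωd
  obtain ⟨n, rfl⟩ : ∃ n, N = n + 2 := ⟨N - 2, by omega⟩
  have hK : 0 < (2 : ℝ) ^ n * ρ ^ ((n : ℝ) * (1 - s / 2)) * (12 / ω) ^ s * ω ^ (s / 2) := by
    positivity
  refine ⟨((2 : ℝ) ^ n * ρ ^ ((n : ℝ) * (1 - s / 2)) * (12 / ω) ^ s * ω ^ (s / 2))⁻¹,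
    inv_pos.2 hK, fun x z a hxρ hzx ha hax hxz hg => ?_⟩
  have hnorm := norm_lt_of_radVol_lt hzx
  have hz0 := norm_nonneg z
  have hX : 0 < ‖x‖ := hz0.trans_lt hnorm
  have hsub : 0 < ‖x - z‖ := (sub_pos.2 hnorm).trans_le (norm_sub_norm_le x z)
  have h2 : √2 ^ 2 = 2 := Real.sq_sqrt (by norm_num)
  have h2l : √2 < 1.5 := by
    rw [Real.sqrt_lt' (by norm_num)]; norm_num
  have h20 : 0 < √2 := by positivity
  have hsub2 : ‖x - z‖ ≤ 2 * ‖x‖ := (norm_sub_le x z).trans (by linarith)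
  have hlow : ‖x‖ ≤ √2 * ‖x - z‖ := by
    refine le_of_sq_le_sq ?_ (by positivity)
    rw [mul_pow, h2, @norm_sub_sq_real]
    have : √2 * (√2 * ⟪x, z⟫) ≤ √2 * (‖x‖ * ‖z‖) := by gcongr
    nlinarith [sq_nonneg (‖x‖ - √2 * ‖z‖)]
  have hoff0 := (half_space_offset_lt hnorm hxρ).1
  set X := ‖x‖ with hXd
  have hpow : X ^ (n + 1) * (X - ‖z‖) ≤ X ^ (n + 2) - ‖z‖ ^ (n + 2) := by
    have : ‖z‖ ^ (n + 1) * ‖z‖ ≤ X ^ (n + 1) * ‖z‖ := by gcongr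
    calc X ^ (n + 1) * (X - ‖z‖) = X ^ (n + 1) * X - X ^ (n + 1) * ‖z‖ := by ring
      _ ≤ X ^ (n + 1) * X - ‖z‖ ^ (n + 1) * ‖z‖ := by linarith
      _ = _ := by ring
  have hdiff : X - ‖z‖ ≤ 8 * a / (ω * X ^ (n + 1)) := by
    rw [le_div_iff₀ (by positivity)]
    simp only [radVol, ← hωd, ← hXd] at hxz
    nlinarith
  have hoff : (X ^ 2 - ‖z‖ ^ 2) / (2 * ‖x - z‖) ≤ 12 / ω * (a / X ^ (n + 1)) := by
    have h3 : (X ^ 2 - ‖z‖ ^ 2) / (2 * ‖x - z‖) ≤ √2 * (X - ‖z‖) := by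
      rw [div_le_iff₀ (by positivity)]
      have : (X - ‖z‖) * X ≤ (X - ‖z‖) * (√2 * ‖x - z‖) := by gcongr
      nlinarith
    refine h3.trans ?_
    calc √2 * (X - ‖z‖) ≤ 1.5 * (8 * a / (ω * X ^ (n + 1))) :=
          mul_le_mul h2l.le hdiff (by linarith) (by norm_num)
      _ = _ := by field_simp; norm_num
  have hker : ((2 * X) ^ n)⁻¹ * (12 / ω * (a / X ^ (n + 1))) ^ (-s) ≤ reflKernel s x z := by
    unfold reflKernel
    rw [Nat.add_sub_cancel]
    gcongr ?_ * ?_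
    · gcongr
    · exact Real.rpow_le_rpow_of_nonpos hoff0 hoff (by linarith)
  refine le_trans ?_ hker
  have haX : a ≤ ω * X ^ (n + 2) := hax
  have e1 : ((2 * X) ^ n)⁻¹ * (12 / ω * (a / X ^ (n + 1))) ^ (-s)
      = ((2 * X) ^ n * ((12 / ω) ^ s * (a ^ s / (X ^ (n + 1)) ^ s)))⁻¹ := by
    rw [Real.rpow_neg (by positivity), Real.mul_rpow (by positivity) (by positivity),
      Real.div_rpow ha.le (by positivity)]
    simp only [mul_inv]
  rw [e1, Real.rpow_neg ha.le, ← mul_inv]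
  refine inv_anti₀ (by positivity) ?_
  have e2 : X ^ n / (X ^ (n + 1)) ^ s * (X ^ (n + 2)) ^ (s / 2)
      = X ^ ((n : ℝ) * (1 - s / 2)) := by
    simp only [← Real.rpow_natCast, ← Real.rpow_mul hX.le, ← Real.rpow_sub hX, ← Real.rpow_add hX]
    congr 1
    push_cast
    ring
  have e3 : a ^ s = a ^ (s / 2) * a ^ (s / 2) := by
    rw [← Real.rpow_add ha]; congr 1; ring
  have e4 : a ^ (s / 2) ≤ ω ^ (s / 2) * (X ^ (n + 2)) ^ (s / 2) := by
    rw [← Real.mul_rpow hω.le (by positivity)]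
    exact Real.rpow_le_rpow ha.le haX (by linarith)
  have e5 : X ^ ((n : ℝ) * (1 - s / 2)) ≤ ρ ^ ((n : ℝ) * (1 - s / 2)) :=
    Real.rpow_le_rpow hX.le hxρ.le (mul_nonneg (by positivity) (by linarith))
  calc (2 * X) ^ n * ((12 / ω) ^ s * (a ^ s / (X ^ (n + 1)) ^ s))
      = 2 ^ n * (12 / ω) ^ s * (X ^ n / (X ^ (n + 1)) ^ s) * a ^ (s / 2) * a ^ (s / 2) := by
        rw [mul_pow, e3]; ring
    _ ≤ 2 ^ n * (12 / ω) ^ s * (X ^ n / (X ^ (n + 1)) ^ s) *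
          (ω ^ (s / 2) * (X ^ (n + 2)) ^ (s / 2)) * a ^ (s / 2) := by gcongr
    _ = 2 ^ n * (X ^ n / (X ^ (n + 1)) ^ s * (X ^ (n + 2)) ^ (s / 2)) * (12 / ω) ^ s *
          ω ^ (s / 2) * a ^ (s / 2) := by ring
    _ ≤ _ := by rw [e2]; gcongr

end Shells

section CrossMass

variable {N : ℕ} {s : ℝ}

/-- The interaction, through the kernel `crossKernel`, of a set with its complement. -/
def crossMass (s ρ : ℝ) (E : Set (Eu N)) : ℝ≥0∞ :=
  ∫⁻ y in Eᶜ, ∫⁻ x in E, crossKernel s ρ x y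

theorem mul_measure_le_setLIntegral {G E : Set (Eu N)} (hG : MeasurableSet G) (hGE : G ⊆ E)
    {f : Eu N → ℝ≥0∞} {k : ℝ≥0∞} (h : ∀ x ∈ G, k ≤ f x) :
    k * volume G ≤ ∫⁻ x in E, f x := by
  rw [← setLIntegral_const]
  exact (setLIntegral_mono' hG h).trans (lintegral_mono_set hGE)

theorem ofReal_mul_le_setLIntegral {G E : Set (Eu N)} (hG : MeasurableSet G) (hGE : G ⊆ E)
    {f : Eu N → ℝ≥0∞} {k b : ℝ} (hk : 0 ≤ k) (hb : b ≤ volume.real G)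
    (h : ∀ x ∈ G, ENNReal.ofReal k ≤ f x) :
    ENNReal.ofReal (k * b) ≤ ∫⁻ x in E, f x := by
  refine le_trans ?_ (mul_measure_le_setLIntegral hG hGE h)
  rw [ENNReal.ofReal_mul hk]
  gcongr
  exact (ENNReal.ofReal_le_ofReal hb).trans ENNReal.ofReal_toReal_le

theorem crossMass_eq_swap (s ρ : ℝ) (E : Set (Eu N)) :
    crossMass s ρ E = ∫⁻ x in E, ∫⁻ y in Eᶜ, crossKernel s ρ x y := by
  unfold crossMass
  exact lintegral_lintegral_swap
    (((measurable_crossKernel s ρ).comp measurable_swap).aemeasurable)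

theorem ofReal_le_crossKernel {ρ k : ℝ} {x y : Eu N} (hyx : radVol y < radVol x) (hx : ‖x‖ < ρ)
    (hk : k ≤ reflKernel s x y) : ENNReal.ofReal k ≤ crossKernel s ρ x y := by
  rw [crossKernel, if_pos ⟨norm_lt_of_radVol_lt hyx, hx⟩]
  exact ENNReal.ofReal_le_ofReal hk

theorem not_mem_cone_iff {x z : Eu N} : z ∉ cone x ↔ √2 * ⟪x, z⟫ ≤ ‖x‖ * ‖z‖ := by
  rw [cone, Set.mem_ofPred_eq, not_lt]

theorem measureReal_le_add_of_subset {S A B : Set (Eu N)} (h : S ⊆ A ∪ B)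
    (hA : volume A ≠ ∞) (hB : volume B ≠ ∞) :
    volume.real S ≤ volume.real A + volume.real B :=
  (measureReal_mono h (measure_union_ne_top hA hB)).trans (measureReal_union_le A B)

theorem exists_crossMass_ge (hN : 2 ≤ N) (hs0 : 0 < s) (hs1 : s < 1) {ρ : ℝ} (hρ : 0 < ρ) :
    ∃ c, 0 < c ∧ ∀ (E : Set (Eu N)) (R : ℝ), MeasurableSet E → E ⊆ Metric.ball 0 ρ →
      volume (Metric.ball (0 : Eu N) R) = volume E →
      ENNReal.ofReal (c * (volume.real (E \ Metric.ball 0 R)) ^ (2 - s / 2)) ≤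
        crossMass s ρ E := by
  obtain ⟨c, hc, hker⟩ := exists_le_reflKernel hN hs0 hs1 hρ
  refine ⟨c / 96, by positivity, fun E R hE hEρ hR => ?_⟩
  have hN1 : 1 ≤ N := by omega
  have hEfin : volume E ≠ ∞ := measure_ne_top_of_subset hEρ measure_ball_lt_top.ne
  set V := volume.real E with hV
  have hV0 : 0 ≤ V := measureReal_nonneg
  have hball : Metric.ball (0 : Eu N) R = {x | radVol x < V} := by
    rcases le_or_gt R 0 with h | h
    · have : V = 0 := by
        rw [hV, measureReal_def, ← hR, Metric.ball_eq_empty.2 h, measure_empty, ENNReal.toReal_zero]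
      rw [this, Metric.ball_eq_empty.2 h]
      symm
      rw [Set.eq_empty_iff_forall_notMem]
      exact fun x hx => absurd hx (not_lt.2 (radVol_nonneg x))
    · have hω := unit_ball_volume_pos (N := N)
      ext x
      rw [mem_ball_zero_iff, Set.mem_ofPred_eq, hV, measureReal_def, ← hR, volume_ball_eq _ h,
        ENNReal.toReal_ofReal (by positivity), radVol, mul_comm, mul_lt_mul_iff_left₀ hω,
        pow_lt_pow_iff_left₀ (norm_nonneg x) h.le (by omega)]
  set B : Set (Eu N) := Metric.ball 0 R with hB
  have hBm : MeasurableSet B := Metric.isOpen_ball.measurableSet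
  have hBfin : volume B ≠ ∞ := measure_ball_lt_top.ne
  have hBiff : ∀ x, x ∈ B ↔ radVol x < V := fun x => by rw [hball, Set.mem_ofPred_eq]
  set a := volume.real (E \ B) with ha
  have ha0 : 0 ≤ a := measureReal_nonneg
  rcases ha0.eq_or_lt with h0 | hapos
  · rw [← h0, Real.zero_rpow (by linarith), mul_zero, ENNReal.ofReal_zero]
    exact zero_le
  have hXfin : volume (E \ B) ≠ ∞ := measure_ne_top_of_subset Set.sdiff_subset hEfin
  have hYfin : volume (B \ E) ≠ ∞ := measure_ne_top_of_subset Set.sdiff_subset hBfin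
  have hXm : MeasurableSet (E \ B) := hE.diff hBm
  have hYm : MeasurableSet (B \ E) := hBm.diff hE
  have hY : volume.real (B \ E) = a := by
    have h1 := measureReal_sdiff_add_inter (μ := volume) (s := E) (t := B) hBm (h := hEfin)
    have h2 := measureReal_sdiff_add_inter (μ := volume) (s := B) (t := E) hE (h := hBfin)
    have h3 : volume.real B = volume.real E := by rw [measureReal_def, hR, measureReal_def]
    rw [Set.inter_comm] at h2
    linarith
  have haV : a ≤ V := measureReal_mono Set.sdiff_subset hEfin
  set k := c * a ^ (-(s / 2)) with hk
  have hk0 : 0 < k := by positivity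
  have hpow : c / 96 * a ^ (2 - s / 2) = k * a / 96 * a := by
    rw [hk, show 2 - s / 2 = -(s / 2) + 1 + 1 by ring, Real.rpow_add hapos, Real.rpow_add hapos,
      Real.rpow_one]
    ring
  rw [hpow]
  have hshm : ∀ a b, MeasurableSet (shell N a b) := measurableSet_shell
  have hrm := (continuous_radVol (N := N)).measurable
  have hcfin : ∀ (x : Eu N) a b, 0 ≤ b → volume (cone x ∩ shell N a b) ≠ ∞ := fun x a b hb =>
    measure_ne_top_of_subset Set.inter_subset_right (volume_shell_lt_top hN1 a hb).ne
  have hcm : ∀ (x : Eu N) a b, MeasurableSet (cone x ∩ shell N a b) := fun x a b =>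
    (measurableSet_cone x).inter (hshm a b)
  by_cases hi : a / 2 ≤ volume.real ((B \ E) ∩ {y | radVol y ≤ V - 4 * a})
  · -- a definite part of `B \ E` lies well inside `B`
    refine le_trans (b := ENNReal.ofReal (k * a * (a / 2))) (ENNReal.ofReal_le_ofReal ?_) ?_
    · nlinarith [mul_pos (mul_pos hk0 hapos) hapos]
    refine ofReal_mul_le_setLIntegral (hYm.inter (measurableSet_le hrm measurable_const))
      (fun y hy => hy.1.2) (by positivity) hi fun y hy => ?_
    have hyV : radVol y ≤ V - 4 * a := hy.2
    have hy0 := radVol_nonneg y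
    set S := shell N (radVol y + a) (radVol y + 4 * a) with hS
    refine ofReal_mul_le_setLIntegral (G := E ∩ (S \ cone y))
      (hE.inter ((hshm _ _).diff (measurableSet_cone y))) Set.inter_subset_left hk0.le ?_ ?_
    · have h1 : volume.real S = 3 * a := by
        rw [hS, volume_shell hN1 (by linarith) (by linarith)]; ring
      have h2 : S ⊆ (E ∩ (S \ cone y)) ∪ ((B \ E) ∪ (cone y ∩ S)) := fun z hz => by
        by_cases h : z ∈ cone y
        · exact Or.inr (Or.inr ⟨h, hz⟩)
        by_cases h' : z ∈ E
        · exact Or.inl ⟨h', hz, h⟩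
        · exact Or.inr (Or.inl ⟨(hBiff z).2 (by linarith [hz.2]), h'⟩)
      have h3 := measureReal_le_add_of_subset h2
        (measure_ne_top_of_subset Set.inter_subset_left hEfin)
        (measure_union_ne_top hYfin (hcfin _ _ _ (by linarith)))
      have h4 := measureReal_union_le (μ := volume) (B \ E) (cone y ∩ S)
      have h5 := volume_cone_inter_shell_le hN y (a := radVol y + a) (b := radVol y + 4 * a)
        (by linarith) (by linarith)
      rw [← hS] at h5
      linarith
    · rintro z ⟨hzE, hzS, hzc⟩
      have h1 : radVol y + a < radVol z := hzS.1
      have h2 : radVol z < radVol y + 4 * a := hzS.2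
      have hzρ := mem_ball_zero_iff.1 (hEρ hzE)
      rw [not_mem_cone_iff, real_inner_comm, mul_comm ‖y‖] at hzc
      exact ofReal_le_crossKernel (by linarith) hzρ
        (hker z y a hzρ (by linarith) hapos (by linarith) (by linarith) hzc)
  by_cases hii : a / 2 ≤ volume.real ((E \ B) ∩ {x | V + 4 * a ≤ radVol x})
  · -- a definite part of `E \ B` lies well outside `B`
    rw [crossMass_eq_swap]
    refine le_trans (b := ENNReal.ofReal (k * a * (a / 2))) (ENNReal.ofReal_le_ofReal ?_) ?_
    · nlinarith [mul_pos (mul_pos hk0 hapos) hapos]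
    refine ofReal_mul_le_setLIntegral (hXm.inter (measurableSet_le measurable_const hrm))
      (fun x hx => hx.1.1) (by positivity) hii fun x hx => ?_
    have hxV : V + 4 * a ≤ radVol x := hx.2
    have hxρ := mem_ball_zero_iff.1 (hEρ hx.1.1)
    set S := shell N (radVol x - 4 * a) (radVol x) with hS
    refine ofReal_mul_le_setLIntegral (G := (S \ cone x) \ E)
      (((hshm _ _).diff (measurableSet_cone x)).diff hE) (fun z hz => hz.2) hk0.le ?_ ?_
    · have h1 : volume.real S = 4 * a := by
        rw [hS, volume_shell hN1 (by linarith) (by linarith)]; ring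
      have h2 : S ⊆ ((S \ cone x) \ E) ∪ ((E \ B) ∪ (cone x ∩ S)) := fun z hz => by
        by_cases h : z ∈ cone x
        · exact Or.inr (Or.inr ⟨h, hz⟩)
        by_cases h' : z ∈ E
        · exact Or.inr (Or.inl ⟨h', fun h => by linarith [(hBiff z).1 h, hz.1]⟩)
        · exact Or.inl ⟨⟨hz, h⟩, h'⟩
      have h3 := measureReal_le_add_of_subset h2
        (measure_ne_top_of_subset (Set.sdiff_subset.trans Set.sdiff_subset)
          (volume_shell_lt_top hN1 _ (by linarith)).ne)
        (measure_union_ne_top hXfin (hcfin _ _ _ (by linarith)))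
      have h4 := measureReal_union_le (μ := volume) (E \ B) (cone x ∩ S)
      have h5 := volume_cone_inter_shell_le hN x (a := radVol x - 4 * a) (b := radVol x)
        (by linarith) (by linarith)
      rw [← hS] at h5
      linarith
    · rintro z ⟨⟨hzS, hzc⟩, hzE⟩
      have h1 : radVol x - 4 * a < radVol z := hzS.1
      have h2 : radVol z < radVol x := hzS.2
      rw [not_mem_cone_iff] at hzc
      exact ofReal_le_crossKernel h2 hxρ
        (hker x z a hxρ h2 hapos (by linarith) (by linarith) hzc)
  -- both `E \ B` and `B \ E` concentrate near the boundary of `B`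
  set X₂ := (E \ B) ∩ {x | V + a / 4 ≤ radVol x ∧ radVol x < V + 4 * a} with hX₂
  set Y₂ := (B \ E) ∩ {y | V - 4 * a < radVol y} with hY₂
  have hX₂m : MeasurableSet X₂ := hXm.inter
    ((measurableSet_le measurable_const hrm).inter (measurableSet_lt hrm measurable_const))
  have hY₂m : MeasurableSet Y₂ := hYm.inter (measurableSet_lt measurable_const hrm)
  have hY₂v : a / 4 ≤ volume.real Y₂ := by
    have h1 : B \ E ⊆ Y₂ ∪ ((B \ E) ∩ {y | radVol y ≤ V - 4 * a}) := fun y hy => by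
      rcases lt_or_ge (V - 4 * a) (radVol y) with h | h
      · exact Or.inl ⟨hy, h⟩
      · exact Or.inr ⟨hy, h⟩
    have := measureReal_le_add_of_subset h1
      (measure_ne_top_of_subset Set.inter_subset_left hYfin)
      (measure_ne_top_of_subset Set.inter_subset_left hYfin)
    linarith
  have hX₂v : a / 4 ≤ volume.real X₂ := by
    have h1 : E \ B ⊆ X₂ ∪ (((E \ B) ∩ {x | V + 4 * a ≤ radVol x}) ∪
        {x | V ≤ radVol x ∧ radVol x < V + a / 4}) := fun x hx => by
      have hxV : V ≤ radVol x := not_lt.1 fun h => hx.2 ((hBiff x).2 h)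
      rcases le_or_gt (V + 4 * a) (radVol x) with h | h
      · exact Or.inr (Or.inl ⟨hx, h⟩)
      rcases le_or_gt (V + a / 4) (radVol x) with h' | h'
      · exact Or.inl ⟨hx, h', h⟩
      · exact Or.inr (Or.inr ⟨hxV, h'⟩)
    have hf : volume {x : Eu N | V ≤ radVol x ∧ radVol x < V + a / 4} ≠ ∞ :=
      measure_ne_top_of_subset (fun x hx => hx.2) (volume_radVol_lt hN1 (by linarith)).2.ne
    have hf' : volume ((E \ B) ∩ {x | V + 4 * a ≤ radVol x}) ≠ ∞ :=
      measure_ne_top_of_subset Set.inter_subset_left hXfin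
    have h2 := measureReal_le_add_of_subset h1
      (measure_ne_top_of_subset Set.inter_subset_left hXfin) (measure_union_ne_top hf' hf)
    have h3 := measureReal_union_le (μ := volume) ((E \ B) ∩ {x | V + 4 * a ≤ radVol x})
      {x | V ≤ radVol x ∧ radVol x < V + a / 4}
    have h4 := volume_half_open_shell_le hN1 hV0 (show V ≤ V + a / 4 by linarith)
    linarith
  set S := shell N V (V + a / 4) with hS
  have hSfin : volume S ≠ ∞ := (volume_shell_lt_top hN1 _ (by linarith)).ne
  have hSm : MeasurableSet S := hshm _ _
  have hkey : ∀ x ∈ X₂, ∀ y ∈ Y₂,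
      k * a / 24 * 1 ≤ k * volume.real ((S \ cone x) \ E) ∨
      k * a / 24 * 1 ≤ k * volume.real ((S \ cone y) ∩ E) := by
    intro x hx y hy
    have h1 : volume.real S = a / 4 := by rw [hS, volume_shell hN1 hV0 (by linarith)]; ring
    have h2 : S ⊆ (((S \ cone x) \ E) ∪ ((S \ cone y) ∩ E)) ∪ ((cone x ∩ S) ∪ (cone y ∩ S)) :=
      fun z hz => by
        by_cases h : z ∈ cone x
        · exact Or.inr (Or.inl ⟨h, hz⟩)
        by_cases h' : z ∈ cone y
        · exact Or.inr (Or.inr ⟨h', hz⟩)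
        by_cases h'' : z ∈ E
        · exact Or.inl (Or.inr ⟨⟨hz, h'⟩, h''⟩)
        · exact Or.inl (Or.inl ⟨⟨hz, h⟩, h''⟩)
    have h3 := measureReal_le_add_of_subset h2
      (measure_union_ne_top
        (measure_ne_top_of_subset (Set.sdiff_subset.trans Set.sdiff_subset) hSfin)
        (measure_ne_top_of_subset (Set.inter_subset_left.trans Set.sdiff_subset) hSfin))
      (measure_union_ne_top (hcfin _ _ _ (by linarith)) (hcfin _ _ _ (by linarith)))
    have h4 := measureReal_union_le (μ := volume) ((S \ cone x) \ E) ((S \ cone y) ∩ E)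
    have h5 := measureReal_union_le (μ := volume) (cone x ∩ S) (cone y ∩ S)
    have h6 := volume_cone_inter_shell_le hN x hV0 (show V < V + a / 4 by linarith)
    have h7 := volume_cone_inter_shell_le hN y hV0 (show V < V + a / 4 by linarith)
    rw [← hS] at h6 h7
    by_contra! hcon
    nlinarith [hcon.1, hcon.2]
  have hfinal : ENNReal.ofReal (k * a / 96 * a) = ENNReal.ofReal (k * a / 24 * (a / 4)) := by
    congr 1; ring
  rw [hfinal]
  by_cases hall : ∀ x ∈ X₂, k * a / 24 * 1 ≤ k * volume.real ((S \ cone x) \ E)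
  · rw [crossMass_eq_swap]
    refine ofReal_mul_le_setLIntegral hX₂m (fun x hx => hx.1.1) (by positivity) hX₂v
      fun x hx => ?_
    have hx1 : V + a / 4 ≤ radVol x := hx.2.1
    have hx2 : radVol x < V + 4 * a := hx.2.2
    have hxρ := mem_ball_zero_iff.1 (hEρ hx.1.1)
    have h := hall x hx
    rw [mul_one] at h
    refine (ENNReal.ofReal_le_ofReal h).trans (ofReal_mul_le_setLIntegral
      ((hSm.diff (measurableSet_cone x)).diff hE) (fun z hz => hz.2) hk0.le le_rfl ?_)
    rintro z ⟨⟨hzS, hzc⟩, hzE⟩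
    have h1 : V < radVol z := hzS.1
    have h2 : radVol z < V + a / 4 := hzS.2
    rw [not_mem_cone_iff] at hzc
    exact ofReal_le_crossKernel (by linarith) hxρ
      (hker x z a hxρ (by linarith) hapos (by linarith) (by linarith) hzc)
  · push Not at hall
    obtain ⟨x, hx, hxl⟩ := hall
    refine ofReal_mul_le_setLIntegral hY₂m (fun y hy => hy.1.2) (by positivity) hY₂v
      fun y hy => ?_
    have hy1 : V - 4 * a < radVol y := hy.2
    have hy2 : radVol y < V := (hBiff y).1 hy.1.1
    have h := (hkey x hx y hy).resolve_left (not_le.2 hxl)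
    rw [mul_one] at h
    refine (ENNReal.ofReal_le_ofReal h).trans (ofReal_mul_le_setLIntegral
      ((hSm.diff (measurableSet_cone y)).inter hE) Set.inter_subset_right hk0.le le_rfl ?_)
    rintro z ⟨⟨hzS, hzc⟩, hzE⟩
    have h1 : V < radVol z := hzS.1
    have h2 : radVol z < V + a / 4 := hzS.2
    have hzρ := mem_ball_zero_iff.1 (hEρ hzE)
    rw [not_mem_cone_iff, real_inner_comm, mul_comm ‖y‖] at hzc
    exact ofReal_le_crossKernel (by linarith) hzρ
      (hker z y a hzρ (by linarith) hapos (by linarith) (by linarith) hzc)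

end CrossMass

section LevelSets

variable {N : ℕ} {s q : ℝ}

theorem radVol_lt_of_norm_lt (hN : 1 ≤ N) {x y : Eu N} (h : ‖x‖ < ‖y‖) : radVol x < radVol y := by
  have hω := unit_ball_volume_pos (N := N)
  have := pow_lt_pow_left₀ h (norm_nonneg x) (show N ≠ 0 by omega)
  unfold radVol
  gcongr

theorem lintegral_sub_eq_lintegral_measure {α : Type*} [MeasurableSpace α] (μ : Measure α)
    [SFinite μ] {f g : α → ℝ} (hf : Measurable f) (hg : Measurable g) :
    ∫⁻ x, ENNReal.ofReal (max (f x - g x) 0) ∂μ =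
      ∫⁻ t : ℝ, μ ({x | t < f x} \ {x | t < g x}) := by
  have hm : MeasurableSet {p : α × ℝ | g p.1 ≤ p.2 ∧ p.2 < f p.1} :=
    (measurableSet_le (f := fun p : α × ℝ => g p.1) (g := fun p => p.2) (by fun_prop)
      (by fun_prop)).inter (measurableSet_lt (f := fun p : α × ℝ => p.2) (g := fun p => f p.1)
      (by fun_prop) (by fun_prop))
  have h1 := Measure.prod_apply (μ := μ) (ν := (volume : Measure ℝ)) hm
  have h2 := Measure.prod_apply_symm (μ := μ) (ν := (volume : Measure ℝ)) hm
  rw [h1] at h2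
  calc ∫⁻ x, ENNReal.ofReal (max (f x - g x) 0) ∂μ
      = ∫⁻ x, volume (Prod.mk x ⁻¹' {p : α × ℝ | g p.1 ≤ p.2 ∧ p.2 < f p.1}) ∂μ := by
        refine lintegral_congr fun x => ?_
        have : Prod.mk x ⁻¹' {p : α × ℝ | g p.1 ≤ p.2 ∧ p.2 < f p.1} = Set.Ico (g x) (f x) := rfl
        rw [this, Real.volume_Ico, ENNReal.ofReal_max, ENNReal.ofReal_zero, max_eq_left zero_le]
    _ = _ := h2
    _ = _ := by
        refine lintegral_congr fun t => ?_
        congr 1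
        ext x
        simp only [Set.mem_preimage, Set.mem_ofPred_eq, Set.mem_sdiff, not_lt]
        exact and_comm

theorem lintegral_crossMass_level {w : Eu N → ℝ} (hw : Measurable w) (s ρ : ℝ) :
    ∫⁻ t : ℝ, crossMass s ρ {x | t < w x} =
      ∫⁻ y, ∫⁻ x, crossKernel s ρ x y * ENNReal.ofReal (max (w x - w y) 0) := by
  classical
  set F : ℝ → Eu N → Eu N → ℝ≥0∞ := fun t y x =>
    if w y ≤ t ∧ t < w x then crossKernel s ρ x y else 0 with hF
  have hK : Measurable fun p : (ℝ × Eu N) × Eu N => crossKernel s ρ p.2 p.1.2 :=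
    (measurable_crossKernel s ρ).comp (f := fun p : (ℝ × Eu N) × Eu N => (p.2, p.1.2))
      (by fun_prop)
  have hFm : Measurable fun p : (ℝ × Eu N) × Eu N => F p.1.1 p.1.2 p.2 := by
    refine Measurable.ite ?_ ?_ measurable_const
    · exact (measurableSet_le (f := fun p : (ℝ × Eu N) × Eu N => w p.1.2) (g := fun p => p.1.1)
        (by fun_prop) (by fun_prop)).inter (measurableSet_lt
        (f := fun p : (ℝ × Eu N) × Eu N => p.1.1) (g := fun p => w p.2) (by fun_prop)
        (by fun_prop))
    · exact hK
  have h1 : ∀ t, crossMass s ρ {x | t < w x} = ∫⁻ y, ∫⁻ x, F t y x := by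
    intro t
    have hm : MeasurableSet {x | t < w x} := measurableSet_lt measurable_const hw
    rw [crossMass, ← lintegral_indicator hm.compl]
    refine lintegral_congr fun y => ?_
    by_cases hy : t < w y
    · rw [Set.indicator_of_notMem (by simpa using hy)]
      simp [hF, not_le.2 hy]
    · rw [Set.indicator_of_mem (by simpa using hy), ← lintegral_indicator hm]
      refine lintegral_congr fun x => ?_
      by_cases hx : t < w x
      · rw [Set.indicator_of_mem (by simpa using hx)]
        simp [hF, not_lt.1 hy, hx]
      · rw [Set.indicator_of_notMem (by simpa using hx)]
        simp [hF, hx]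
  simp_rw [h1]
  have hFi : Measurable (Function.uncurry fun t y => ∫⁻ x, F t y x) :=
    hFm.lintegral_prod_right'
  rw [lintegral_lintegral_swap hFi.aemeasurable]
  refine lintegral_congr fun y => ?_
  have hFy : Measurable (Function.uncurry fun (t : ℝ) (x : Eu N) => F t y x) :=
    hFm.comp (f := fun p : ℝ × Eu N => ((p.1, y), p.2)) (by fun_prop)
  rw [lintegral_lintegral_swap hFy.aemeasurable]
  refine lintegral_congr fun x => ?_
  have h2 : (fun t => F t y x) = (Set.Ico (w y) (w x)).indicator fun _ => crossKernel s ρ x y := by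
    ext t
    simp only [hF, Set.indicator_apply, Set.mem_Ico]
  rw [h2, lintegral_indicator measurableSet_Ico, setLIntegral_const, Real.volume_Ico,
    ENNReal.ofReal_max, ENNReal.ofReal_zero, max_eq_left zero_le]

theorem crossMass_inter_ball_le (s ρ : ℝ) {E : Set (Eu N)} (hE : MeasurableSet E) :
    crossMass s ρ (E ∩ Metric.ball 0 ρ) ≤ crossMass s ρ E := by
  have hm := hE.inter (Metric.isOpen_ball (x := (0 : Eu N)) (ε := ρ)).measurableSet
  unfold crossMass
  rw [← lintegral_indicator hm.compl, ← lintegral_indicator hE.compl]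
  refine lintegral_mono fun y => ?_
  by_cases hy : y ∈ E
  · by_cases hyρ : ‖y‖ < ρ
    · rw [Set.indicator_of_notMem (by simpa using ⟨hy, hyρ⟩)]
      exact zero_le
    · have h0 : ∀ x, crossKernel s ρ x y = 0 := fun x =>
        if_neg fun h => hyρ (h.1.trans h.2)
      refine Set.indicator_apply_le' (fun _ => ?_) fun _ => zero_le
      simp only [h0, lintegral_zero]
      exact zero_le
  · have hy' : y ∈ (E ∩ Metric.ball 0 ρ)ᶜ := fun h => hy h.1
    rw [Set.indicator_of_mem hy', Set.indicator_of_mem (by simpa using hy)]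
    exact lintegral_mono_set Set.inter_subset_left

theorem le_add_rpow_mul_rpow {a ε θ : ℝ} (ha : 0 ≤ a) (hε : 0 < ε) (hθ : 0 ≤ θ) :
    a ≤ ε + ε ^ (-θ) * a ^ (1 + θ) := by
  rcases le_or_gt a ε with h | h
  · have : 0 ≤ ε ^ (-θ) * a ^ (1 + θ) := by positivity
    linarith
  · have ha0 : 0 < a := hε.trans h
    have h1 : 1 ≤ ε ^ (-θ) * a ^ θ := by
      rw [Real.rpow_neg hε.le, ← div_eq_inv_mul, one_le_div (by positivity)]
      exact Real.rpow_le_rpow hε.le h.le hθ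
    rw [Real.rpow_add ha0, Real.rpow_one]
    nlinarith

/-- Level sets of a function and of its radial rearrangement differ by little, up to the part
lying outside a large ball. -/
theorem exists_measure_level_diff_le (hN : 2 ≤ N) (hs0 : 0 < s) (hs1 : s < 1) {ρ : ℝ}
    (hρ : 0 < ρ) :
    ∃ C, 0 < C ∧ ∀ (E G : Set (Eu N)) (ε : ℝ), MeasurableSet E → volume E < ∞ →
      volume G = volume E → (∀ x y, ‖x‖ ≤ ‖y‖ → y ∈ G → x ∈ G) → 0 < ε →
      volume (E \ G) ≤ volume (E \ Metric.ball 0 ρ) + ENNReal.ofReal ε +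
        ENNReal.ofReal (C * ε ^ (-(1 - s / 2))) * crossMass s ρ E := by
  obtain ⟨c, hc, h⟩ := exists_crossMass_ge hN hs0 hs1 hρ
  have hN1 : 1 ≤ N := by omega
  refine ⟨c⁻¹, inv_pos.2 hc, fun E G ε hE hEf hG hrad hε => ?_⟩
  set E' := E ∩ Metric.ball 0 ρ with hE'
  have hE'm : MeasurableSet E' := hE.inter Metric.isOpen_ball.measurableSet
  have hE'f : volume E' ≠ ∞ := measure_ne_top_of_subset Set.inter_subset_left hEf.ne
  set b := volume.real E' with hb
  have hb0 : 0 ≤ b := measureReal_nonneg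
  obtain ⟨R, -, -, hR, -⟩ := exists_radVol_lt_iff (N := N) hN1 hb0
  have hvR := volume_radVol_lt (N := N) hN1 hb0
  rw [hR] at hvR
  have hRE : volume (Metric.ball (0 : Eu N) R) = volume E' := by
    rw [← ENNReal.toReal_eq_toReal_iff' hvR.2.ne hE'f]
    exact hvR.1
  have hcm := h E' R hE'm Set.inter_subset_right hRE
  set a := volume.real (E' \ Metric.ball 0 R) with ha
  have hsub : E \ G ⊆ (E \ Metric.ball 0 ρ) ∪ (E' \ Metric.ball 0 R) := by
    rintro x ⟨hxE, hxG⟩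
    by_cases hx : x ∈ Metric.ball (0 : Eu N) ρ
    · refine Or.inr ⟨⟨hxE, hx⟩, fun hxR => ?_⟩
      rw [← hR, Set.mem_ofPred_eq] at hxR
      have hGx : G ⊆ {y | radVol y < radVol x} := fun y hy =>
        radVol_lt_of_norm_lt hN1 (not_le.1 fun hle => hxG (hrad x y hle hy))
      have h1 : volume.real G ≤ radVol x := by
        have h2 := volume_radVol_lt (N := N) hN1 (radVol_nonneg x)
        rw [← h2.1]
        exact measureReal_mono hGx h2.2.ne
      have h2 : b ≤ volume.real E := measureReal_mono Set.inter_subset_left hEf.ne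
      rw [measureReal_def, hG, ← measureReal_def] at h1
      linarith
    · exact Or.inl ⟨hxE, hx⟩
  have hae : volume (E' \ Metric.ball 0 R) = ENNReal.ofReal a :=
    (ENNReal.ofReal_toReal (measure_ne_top_of_subset Set.sdiff_subset hE'f)).symm
  have h1 : ENNReal.ofReal a ≤ ENNReal.ofReal ε +
      ENNReal.ofReal (c⁻¹ * ε ^ (-(1 - s / 2))) * crossMass s ρ E := by
    have h2 := le_add_rpow_mul_rpow (a := a) measureReal_nonneg hε
      (show 0 ≤ 1 - s / 2 by linarith)
    have h3 : ε ^ (-(1 - s / 2)) * a ^ (1 + (1 - s / 2)) =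
        c⁻¹ * ε ^ (-(1 - s / 2)) * (c * a ^ (2 - s / 2)) := by
      rw [show 1 + (1 - s / 2) = 2 - s / 2 by ring]
      field_simp
    rw [h3] at h2
    refine (ENNReal.ofReal_le_ofReal h2).trans (ENNReal.ofReal_add_le.trans ?_)
    rw [ENNReal.ofReal_mul (by positivity)]
    gcongr
    exact hcm.trans (crossMass_inter_ball_le s ρ hE)
  calc volume (E \ G) ≤ volume (E \ Metric.ball 0 ρ) + volume (E' \ Metric.ball 0 R) :=
        (measure_mono hsub).trans (measure_union_le _ _)
    _ ≤ _ := by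
        rw [hae, add_assoc]
        gcongr

end LevelSets

section RealInequalities

theorem one_sub_rpow_le {x b : ℝ} (hx0 : 0 ≤ x) (hx1 : x ≤ 1) (hb : 0 ≤ b) :
    (1 - x) ^ b ≤ 1 - min b 1 * x := by
  rcases le_total b 1 with h | h
  · rw [min_eq_left h]
    have := rpow_one_add_le_one_add_mul_self (s := -x) (by linarith) hb h
    rw [← sub_eq_add_neg] at this
    linarith
  · rw [min_eq_right h, one_mul]
    calc (1 - x) ^ b ≤ (1 - x) ^ (1 : ℝ) := by
          rcases (sub_nonneg.2 hx1).eq_or_lt with h0 | h0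
          · rw [← h0, Real.zero_rpow (by linarith), Real.zero_rpow one_ne_zero]
          · exact Real.rpow_le_rpow_of_exponent_ge h0 (by linarith) h
      _ = 1 - x := Real.rpow_one _

theorem rpow_sub_rpow_le {q M a b : ℝ} (hq : 1 ≤ q) (ha : 0 ≤ a) (hab : a ≤ b) (hb : b ≤ M) :
    b ^ q - a ^ q ≤ q * M ^ (q - 1) * (b - a) := by
  rcases (ha.trans hab).eq_or_lt with h0 | hb0
  · have : a = 0 := le_antisymm (hab.trans h0.symm.le) ha
    simp [← h0, this]
  · have h1 := one_add_mul_self_le_rpow_one_add (s := a / b - 1) (by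
      have : 0 ≤ a / b := by positivity
      linarith) hq
    rw [add_sub_cancel, Real.div_rpow ha hb0.le, le_div_iff₀ (by positivity)] at h1
    have h2 : b ^ q = b ^ (q - 1) * b := by
      rw [← Real.rpow_add_one hb0.ne', sub_add_cancel]
    have h3 : (1 + q * (a / b - 1)) * b ^ q = b ^ q - q * b ^ (q - 1) * (b - a) := by
      rw [h2]
      field_simp
      ring
    rw [h3] at h1
    have h4 : q * b ^ (q - 1) * (b - a) ≤ q * M ^ (q - 1) * (b - a) := by
      have : 0 ≤ b - a := by linarith
      gcongr
    linarith

theorem le_of_sup_inf_energy {l L a A β q P Q : ℝ} (hl : 0 < l) (hL : l ≤ L) (ha0 : 0 ≤ a)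
    (ha1 : a ≤ 1) (hA0 : 0 ≤ A) (hA1 : A ≤ 1) (hβ : 0 < β) (hq : 1 ≤ q) (hP : 0 ≤ P) (hQ : 0 ≤ Q)
    (hPQ : P + Q ≤ 2 * L) (h1 : l * (1 + a) ^ (2 / q) ≤ P * (1 + A) ^ β)
    (h2 : l * (1 - a) ^ (2 / q) ≤ Q * (1 - A) ^ β) :
    l * (min (β / 2) 1 * A ^ 2) ≤ L - l + l * a ^ 2 := by
  have hq0 : 0 < q := by linarith
  have ha2 : 0 ≤ 1 - a ^ 2 := by nlinarith
  have hA2 : 0 ≤ 1 - A ^ 2 := by nlinarith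
  have hLpos : 0 < L := hl.trans_le hL
  set b := min (β / 2) 1 with hb
  have hbA : (1 - A ^ 2) ^ (β / 2) ≤ 1 - b * A ^ 2 :=
    one_sub_rpow_le (by positivity) (by linarith) (by positivity)
  have hprod : l ^ 2 * (1 - a ^ 2) ^ (2 / q) ≤ P * Q * (1 - A ^ 2) ^ β := by
    have h := mul_le_mul h1 h2 (mul_nonneg hl.le (Real.rpow_nonneg (by linarith) _))
      (mul_nonneg hP (Real.rpow_nonneg (by linarith) _))
    have e1 : (1 - a ^ 2) ^ (2 / q) = (1 + a) ^ (2 / q) * (1 - a) ^ (2 / q) := by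
      rw [← Real.mul_rpow (by linarith) (by linarith)]; congr 1; ring
    have e2 : (1 - A ^ 2) ^ β = (1 + A) ^ β * (1 - A) ^ β := by
      rw [← Real.mul_rpow (by linarith) (by linarith)]; congr 1; ring
    rw [e1, e2]
    calc _ = l * (1 + a) ^ (2 / q) * (l * (1 - a) ^ (2 / q)) := by ring
      _ ≤ _ := h
      _ = _ := by ring
  have hPQ2 : P * Q ≤ L ^ 2 := by nlinarith [sq_nonneg (P - Q)]
  have hsq : (l * (1 - a ^ 2)) ^ 2 ≤ (L * (1 - A ^ 2) ^ (β / 2)) ^ 2 := by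
    have e1 : (1 - a ^ 2) ^ 2 ≤ (1 - a ^ 2) ^ (2 / q) := by
      rcases ha2.eq_or_lt with h0 | h0
      · rw [← h0, Real.zero_rpow (by positivity)]; norm_num
      · rw [← Real.rpow_natCast]
        refine Real.rpow_le_rpow_of_exponent_ge h0 (by nlinarith) ?_
        rw [div_le_iff₀ hq0]
        push_cast
        linarith
    have e2 : ((1 - A ^ 2) ^ (β / 2)) ^ 2 = (1 - A ^ 2) ^ β := by
      rw [← Real.rpow_natCast, ← Real.rpow_mul hA2]; congr 1; push_cast; ring
    rw [mul_pow, mul_pow, e2]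
    calc l ^ 2 * (1 - a ^ 2) ^ 2 ≤ l ^ 2 * (1 - a ^ 2) ^ (2 / q) := by gcongr
      _ ≤ P * Q * (1 - A ^ 2) ^ β := hprod
      _ ≤ _ := by gcongr
  have h3 : l * (1 - a ^ 2) ≤ L * (1 - A ^ 2) ^ (β / 2) :=
    le_of_sq_le_sq hsq (by positivity)
  have h4 : l * (1 - a ^ 2) ≤ L * (1 - b * A ^ 2) := h3.trans (by gcongr)
  have h5 : l * (b * A ^ 2) ≤ L * (b * A ^ 2) := by
    have : 0 ≤ b * A ^ 2 := by positivity
    gcongr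
  nlinarith

theorem mul_rpow_le_of_sup_inf {l ℓ b A δ a θ T : ℝ} (hℓ : 0 < ℓ) (hl : ℓ ≤ l)
    (hb : 0 < b) (hA0 : 0 < A) (hA1 : A ≤ 1) (hδ : 0 ≤ δ) (hθ : 0 ≤ θ) (ha0 : 0 ≤ a)
    (h : l * (b * A ^ 2) ≤ δ + l * a ^ 2)
    (ha : a ≤ √b / 2 * A + T * A ^ (-θ) * √δ) :
    b / 2 / (1 / ℓ + 2 * T ^ 2) * A ^ (2 + 2 * θ) ≤ δ := by
  have hl0 : 0 < l := hℓ.trans_le hl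
  have hδs : √δ ^ 2 = δ := Real.sq_sqrt hδ
  have hbs : √b ^ 2 = b := Real.sq_sqrt hb.le
  have hA2 : (A ^ (-θ)) ^ 2 * A ^ (2 * θ) = 1 := by
    rw [← Real.rpow_natCast, ← Real.rpow_mul hA0.le, ← Real.rpow_add hA0]
    simp only [Nat.cast_ofNat]
    rw [show -θ * 2 + 2 * θ = 0 by ring, Real.rpow_zero]
  have hAle : A ^ (2 * θ) ≤ 1 := Real.rpow_le_one hA0.le hA1 (by positivity)
  have hApos : 0 < A ^ (2 * θ) := by positivity
  have h1 : a ^ 2 ≤ b / 2 * A ^ 2 + 2 * T ^ 2 * (A ^ (-θ)) ^ 2 * δ := by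
    have e1 : a ^ 2 ≤ (√b / 2 * A + T * A ^ (-θ) * √δ) ^ 2 := pow_le_pow_left₀ ha0 ha 2
    have e2 := sq_nonneg (√b / 2 * A - T * A ^ (-θ) * √δ)
    have e3 : (√b / 2 * A) ^ 2 = b / 4 * A ^ 2 := by rw [mul_pow, div_pow, hbs]; ring
    have e4 : (T * A ^ (-θ) * √δ) ^ 2 = T ^ 2 * (A ^ (-θ)) ^ 2 * δ := by
      rw [mul_pow, mul_pow, hδs]
    nlinarith
  have h2 : l * (b / 2 * A ^ 2) ≤ δ + l * (2 * T ^ 2 * (A ^ (-θ)) ^ 2 * δ) := by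
    have := mul_le_mul_of_nonneg_left h1 hl0.le
    nlinarith
  have h3 : l * (b / 2 * A ^ (2 + 2 * θ)) ≤ δ + l * (2 * T ^ 2 * δ) := by
    have e1 : A ^ (2 + 2 * θ) = A ^ 2 * A ^ (2 * θ) := by
      rw [Real.rpow_add hA0]; norm_num
    calc l * (b / 2 * A ^ (2 + 2 * θ)) = l * (b / 2 * A ^ 2) * A ^ (2 * θ) := by rw [e1]; ring
      _ ≤ (δ + l * (2 * T ^ 2 * (A ^ (-θ)) ^ 2 * δ)) * A ^ (2 * θ) := by gcongr
      _ = δ * A ^ (2 * θ) + l * (2 * T ^ 2 * δ) * ((A ^ (-θ)) ^ 2 * A ^ (2 * θ)) := by ring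
      _ ≤ _ := by
        rw [hA2, mul_one]
        nlinarith
  have h4 : b / 2 * A ^ (2 + 2 * θ) ≤ δ * (1 / ℓ + 2 * T ^ 2) := by
    have e1 : b / 2 * A ^ (2 + 2 * θ) ≤ δ * (1 / l) + 2 * T ^ 2 * δ := by
      rw [← mul_le_mul_iff_right₀ hl0]
      calc _ ≤ _ := h3
        _ = _ := by field_simp
    have e2 : 1 / l ≤ 1 / ℓ := one_div_le_one_div_of_le hℓ hl
    nlinarith
  rw [div_mul_eq_mul_div, div_le_iff₀ (by positivity)]
  exact h4

end RealInequalities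

section CenteredStability

variable {N : ℕ} {s q : ℝ}

theorem exists_lintegral_sub_le (hN : 2 ≤ N) (hs0 : 0 < s) (hs1 : s < 1) (hq : 1 ≤ q) {ρ : ℝ}
    (hρ : 0 < ρ) :
    ∃ C, 0 < C ∧ ∀ (x₀ : Eu N) (r r' M η ε : ℝ) (w g : Eu N → ℝ), 0 < r →
      volume (Metric.ball x₀ r) = 1 → IsCentered s q w → (∀ x, w x ≤ M) →
      (∀ x, ρ ≤ ‖x‖ → w x < η) → r' ≤ ρ → Measurable g → (∀ x, 0 ≤ g x) →
      (∀ x y, ‖x‖ ≤ ‖y‖ → g y ≤ g x) →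
      (∀ t, 0 ≤ t → volume {x | t < g x} = volume {x | t < w x}) → 0 < ε → 0 ≤ η → 0 ≤ M →
      ∫⁻ x, ENNReal.ofReal (max (w x - g x) 0) ≤
        ENNReal.ofReal (M * ε + C * ε ^ (-(1 - s / 2)) *
          √(gagliardoSqR N s w - sobolevConst N s q (Metric.ball x₀ r)) +
          η * volume.real ({x | 0 < w x} \ Metric.ball 0 r')) := by
  obtain ⟨C₁, hC₁, h₁⟩ := exists_measure_level_diff_le hN hs0 hs1 hρ
  obtain ⟨C₂, hC₂, h₂⟩ := exists_crossKernel_le (N := N) hN hs0 hs1 hq ρ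
  refine ⟨C₁ * C₂, by positivity, fun x₀ r r' M η ε w g hr hB hw hwM hwη hr' hg hg0 hrad hlev
    hε hη hM => ?_⟩
  set δ := gagliardoSqR N s w - sobolevConst N s q (Metric.ball x₀ r) with hδ
  set A := {x | 0 < w x} \ Metric.ball 0 r' with hA
  have hwm : Measurable w := hw.continuous.measurable
  have hAf : volume A ≠ ∞ := measure_ne_top_of_subset Set.sdiff_subset (by
    rw [hw.volume_eq]; exact ENNReal.one_ne_top)
  set K := C₁ * ε ^ (-(1 - s / 2)) with hK
  rw [lintegral_sub_eq_lintegral_measure volume hwm hg]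
  have hpt : ∀ t : ℝ, volume ({x | t < w x} \ {x | t < g x}) ≤
      (Set.Ico 0 M).indicator (fun _ => ENNReal.ofReal ε) t +
      ((Set.Ico 0 η).indicator (fun _ => volume A) t +
        ENNReal.ofReal K * crossMass s ρ {x | t < w x}) := by
    intro t
    rcases lt_or_ge t 0 with ht | ht
    · have : {x | t < w x} \ {x | t < g x} = ∅ := by
        rw [Set.sdiff_eq_empty]
        exact fun x _ => ht.trans_le (hg0 x)
      rw [this, measure_empty]
      exact zero_le
    rcases le_or_gt M t with htM | htM
    · have : {x | t < w x} \ {x | t < g x} = ∅ := by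
        rw [Set.sdiff_eq_empty]
        exact fun x hx => absurd (hx.trans_le (hwM x)) (not_lt.2 htM)
      rw [this, measure_empty]
      exact zero_le
    have hEf : volume {x | t < w x} < ∞ := by
      have hsub : {x | t < w x} ⊆ {x | 0 < w x} := fun x hx => ht.trans_lt hx
      refine (measure_mono hsub).trans_lt ?_
      rw [hw.volume_eq]
      exact ENNReal.one_lt_top
    have h := h₁ {x | t < w x} {x | t < g x} ε (measurableSet_lt measurable_const hwm) hEf
      (hlev t ht) (fun x y hxy (hy : t < g y) => hy.trans_le (hrad x y hxy)) hε
    refine h.trans ?_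
    rw [Set.indicator_of_mem (show t ∈ Set.Ico 0 M from ⟨ht, htM⟩), add_comm (volume _), add_assoc]
    gcongr
    rcases lt_or_ge t η with htη | htη
    · rw [Set.indicator_of_mem (show t ∈ Set.Ico 0 η from ⟨ht, htη⟩)]
      refine measure_mono fun x hx => ⟨ht.trans_lt hx.1, fun hxr => hx.2 ?_⟩
      exact Metric.ball_subset_ball hr' hxr
    · have : {x | t < w x} \ Metric.ball 0 ρ = ∅ := by
        rw [Set.sdiff_eq_empty]
        intro x (hx : t < w x)
        rw [mem_ball_zero_iff]
        by_contra hxρ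
        exact absurd (hwη x (not_lt.1 hxρ)) (not_lt.2 (htη.trans hx.le))
      rw [this, measure_empty]
      exact zero_le
  refine (lintegral_mono hpt).trans ?_
  rw [lintegral_add_left (measurable_const.indicator measurableSet_Ico),
    lintegral_add_left (measurable_const.indicator measurableSet_Ico),
    lintegral_const_mul' _ _ ENNReal.ofReal_ne_top, lintegral_indicator measurableSet_Ico,
    lintegral_indicator measurableSet_Ico, setLIntegral_const, setLIntegral_const,
    Real.volume_Ico, Real.volume_Ico, sub_zero, sub_zero, lintegral_crossMass_level hwm]
  have e1 : volume A = ENNReal.ofReal (volume.real A) := (ENNReal.ofReal_toReal hAf).symm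
  calc _ ≤ ENNReal.ofReal ε * ENNReal.ofReal M + (ENNReal.ofReal (volume.real A) *
        ENNReal.ofReal η + ENNReal.ofReal K * ENNReal.ofReal (C₂ * √δ)) := by
        rw [← e1]
        gcongr
        exact h₂ x₀ r hr hB w hw
    _ = _ := by
        have hK0 : 0 ≤ K := by positivity
        rw [← ENNReal.ofReal_mul hε.le, ← ENNReal.ofReal_mul measureReal_nonneg,
          ← ENNReal.ofReal_mul hK0, ← ENNReal.ofReal_add (by positivity) (by positivity),
          ← ENNReal.ofReal_add (by positivity) (by positivity), hK]
        congr 1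
        ring

end CenteredStability

section Stability

variable {N : ℕ} {s q : ℝ}

theorem integrable_rpow_of_hasCompactSupport (hq : 0 < q) {f : Eu N → ℝ} (hf : Continuous f)
    (hfc : HasCompactSupport f) : Integrable fun x => f x ^ q :=
  (hf.rpow_const fun _ => Or.inr hq.le).integrable_of_hasCompactSupport
    (hfc.comp_left (g := fun t : ℝ => t ^ q) (Real.zero_rpow hq.ne'))

theorem IsCentered.sobolevConst_le (hN : 1 ≤ N) (hs0 : 0 < s) (hq : 1 ≤ q) {x₀ : Eu N} {r : ℝ}
    (hr : 0 < r) (hB : volume (Metric.ball x₀ r) = 1) {w : Eu N → ℝ} (hw : IsCentered s q w) :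
    sobolevConst N s q (Metric.ball x₀ r) ≤ gagliardoSqR N s w := by
  have h := sobolevConst_ball_mul_le hN hs0 hq hr hB hw.continuous hw.nonneg hw.compactSupport
    hw.energy_lt_top
  rwa [hw.integral_eq, hw.volume_eq, ENNReal.toReal_one, Real.one_rpow, Real.one_rpow, mul_one,
    mul_one] at h

/-- Testing the Faber–Krahn inequality with the maximum and the minimum of two functions. -/
theorem IsCentered.sup_inf_bound (hN : 1 ≤ N) (hs0 : 0 < s) (hq : 1 ≤ q)
    (hβ : 0 < 2 / q - 1 + 2 * s / N) {x₀ : Eu N} {r : ℝ}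
    (hr : 0 < r) (hB : volume (Metric.ball x₀ r) = 1)
    (hpos : 0 < sobolevConst N s q (Metric.ball x₀ r)) {w g : Eu N → ℝ} (hw : IsCentered s q w)
    (hg : Continuous g) (hgc : HasCompactSupport g) (hg0 : ∀ x, 0 ≤ g x)
    (hgw : gagliardoSq N s g ≤ gagliardoSq N s w) (hgI : ∫ x, g x ^ q = 1)
    (hgv : volume {x | 0 < g x} = 1) :
    0 ≤ (∫ x, max (w x) (g x) ^ q) - 1 ∧
    sobolevConst N s q (Metric.ball x₀ r) * (min ((2 / q - 1 + 2 * s / N) / 2) 1 *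
        volume.real ({x | 0 < w x} \ {x | 0 < g x}) ^ 2) ≤
      gagliardoSqR N s w - sobolevConst N s q (Metric.ball x₀ r) +
      sobolevConst N s q (Metric.ball x₀ r) * ((∫ x, max (w x) (g x) ^ q) - 1) ^ 2 := by
  have hq0 : 0 < q := by linarith
  have hwc := hw.continuous
  have hcs : ∀ F : ℝ → ℝ → ℝ, F 0 0 = 0 → HasCompactSupport fun x => F (w x) (g x) := by
    intro F hF
    refine (hw.compactSupport.isCompact.union hgc.isCompact).of_isClosed_subset
      (isClosed_tsupport _) (closure_minimal (fun x hx => ?_)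
        ((isClosed_tsupport w).union (isClosed_tsupport g)))
    by_contra hcon
    rw [Set.mem_union, not_or] at hcon
    exact hx (by simp [image_eq_zero_of_notMem_tsupport hcon.1,
      image_eq_zero_of_notMem_tsupport hcon.2, hF])
  have hmaxc := hcs max (max_self 0)
  have hminc := hcs min (min_self 0)
  have hsum : (∫ x, max (w x) (g x) ^ q) + ∫ x, min (w x) (g x) ^ q = 2 := by
    rw [← integral_add (integrable_rpow_of_hasCompactSupport hq0 (hwc.max hg) hmaxc)
      (integrable_rpow_of_hasCompactSupport hq0 (hwc.min hg) hminc)]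
    have : ∀ x, max (w x) (g x) ^ q + min (w x) (g x) ^ q = w x ^ q + g x ^ q := fun x => by
      rcases le_total (w x) (g x) with h | h
      · rw [max_eq_right h, min_eq_left h, add_comm]
      · rw [max_eq_left h, min_eq_right h]
    simp_rw [this]
    rw [integral_add (integrable_rpow_of_hasCompactSupport hq0 hwc hw.compactSupport)
      (integrable_rpow_of_hasCompactSupport hq0 hg hgc), hw.integral_eq, hgI]
    norm_num
  have hmin0 : 0 ≤ ∫ x, min (w x) (g x) ^ q :=
    integral_nonneg fun x => Real.rpow_nonneg (le_min (hw.nonneg x) (hg0 x)) _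
  have hmax1 : 1 ≤ ∫ x, max (w x) (g x) ^ q := by
    rw [← hw.integral_eq]
    refine integral_mono (integrable_rpow_of_hasCompactSupport hq0 hwc hw.compactSupport)
      (integrable_rpow_of_hasCompactSupport hq0 (hwc.max hg) hmaxc) fun x => ?_
    exact Real.rpow_le_rpow (hw.nonneg x) (le_max_left _ _) hq0.le
  refine ⟨by linarith, ?_⟩
  set a := (∫ x, max (w x) (g x) ^ q) - 1 with ha
  have hgt : gagliardoSq N s g < ∞ := hgw.trans_lt hw.energy_lt_top
  have hsi := gagliardoSq_sup_add_inf_le (s := s) hwc.measurable hg.measurable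
  have htop : gagliardoSq N s w + gagliardoSq N s g < ∞ :=
    ENNReal.add_lt_top.2 ⟨hw.energy_lt_top, hgt⟩
  have hmaxt : gagliardoSq N s (fun x => max (w x) (g x)) < ∞ := (le_self_add.trans hsi).trans_lt htop
  have hmint : gagliardoSq N s (fun x => min (w x) (g x)) < ∞ :=
    (le_add_self.trans hsi).trans_lt htop
  have hen : gagliardoSqR N s (fun x => max (w x) (g x)) +
      gagliardoSqR N s (fun x => min (w x) (g x)) ≤ 2 * gagliardoSqR N s w := by
    have h1 := ENNReal.toReal_mono htop.ne hsi
    rw [ENNReal.toReal_add hmaxt.ne hmint.ne, ENNReal.toReal_add hw.energy_lt_top.ne hgt.ne] at h1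
    have h2 := ENNReal.toReal_mono hw.energy_lt_top.ne hgw
    unfold gagliardoSqR
    linarith
  set W := {x | 0 < w x} with hW
  set G := {x | 0 < g x} with hG
  have hWm : MeasurableSet W := measurableSet_lt measurable_const hwc.measurable
  have hGm : MeasurableSet G := measurableSet_lt measurable_const hg.measurable
  have hWf : volume W ≠ ∞ := by rw [hw.volume_eq]; exact ENNReal.one_ne_top
  have hGf : volume G ≠ ∞ := by rw [hgv]; exact ENNReal.one_ne_top
  have hW1 : volume.real W = 1 := by rw [measureReal_def, hw.volume_eq, ENNReal.toReal_one]
  have hG1 : volume.real G = 1 := by rw [measureReal_def, hgv, ENNReal.toReal_one]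
  set A := volume.real (W \ G) with hA
  have hA1 : A ≤ 1 := by
    rw [← hW1]
    exact measureReal_mono Set.sdiff_subset hWf
  have hsupp1 : {x | 0 < max (w x) (g x)} = W \ G ∪ G := by
    ext x
    simp only [Set.sdiff_union_self, Set.mem_union, hW, hG, Set.mem_ofPred_eq, lt_max_iff]
  have hsupp2 : {x | 0 < min (w x) (g x)} = W ∩ G := by
    ext x
    simp only [Set.mem_inter_iff, hW, hG, Set.mem_ofPred_eq, lt_min_iff]
  have hv1 : (volume {x | 0 < max (w x) (g x)}).toReal = 1 + A := by
    rw [hsupp1, ← measureReal_def, measureReal_union Set.disjoint_sdiff_left hGm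
      (measure_ne_top_of_subset Set.sdiff_subset hWf) hGf, hG1, add_comm]
  have hv2 : (volume {x | 0 < min (w x) (g x)}).toReal = 1 - A := by
    have := measureReal_sdiff_add_inter (μ := volume) (s := W) (t := G) hGm (h := hWf)
    rw [hsupp2, ← measureReal_def]
    linarith
  have h1 := sobolevConst_ball_mul_le hN hs0 hq hr hB (hwc.max hg)
    (fun x => (hw.nonneg x).trans (le_max_left _ _)) hmaxc hmaxt
  have h2 := sobolevConst_ball_mul_le hN hs0 hq hr hB (hwc.min hg)
    (fun x => le_min (hw.nonneg x) (hg0 x)) hminc hmint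
  rw [hv1] at h1
  rw [hv2] at h2
  refine le_of_sup_inf_energy hpos (hw.sobolevConst_le hN hs0 hq hr hB) (by linarith)
    (by linarith) measureReal_nonneg hA1 hβ hq ENNReal.toReal_nonneg ENNReal.toReal_nonneg
    hen ?_ ?_
  · rwa [ha, add_sub_cancel]
  · rwa [show 1 - a = ∫ x, min (w x) (g x) ^ q by rw [ha]; linarith]

theorem integral_sup_rpow_sub_one_le (hq : 1 ≤ q) {M : ℝ} (hM : 0 < M) {w g : Eu N → ℝ}
    (hw : Continuous w) (hwc : HasCompactSupport w) (hwM : ∀ x, w x ≤ M)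
    (hg : Continuous g) (hgc : HasCompactSupport g) (hg0 : ∀ x, 0 ≤ g x) (hgI : ∫ x, g x ^ q = 1)
    {D : ℝ} (hD0 : 0 ≤ D) (hD : ∫⁻ x, ENNReal.ofReal (max (w x - g x) 0) ≤ ENNReal.ofReal D) :
    (∫ x, max (w x) (g x) ^ q) - 1 ≤ q * M ^ (q - 1) * D := by
  have hq0 : 0 < q := by linarith
  have hpt : ∀ x, max (w x) (g x) ^ q ≤ g x ^ q + q * M ^ (q - 1) * max (w x - g x) 0 := by
    intro x
    rcases le_total (w x) (g x) with h | h
    · rw [max_eq_right h, max_eq_right (sub_nonpos.2 h), mul_zero, add_zero]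
    · rw [max_eq_left h, max_eq_left (sub_nonneg.2 h)]
      linarith [rpow_sub_rpow_le hq (hg0 x) h (hwM x)]
  have hsubc : HasCompactSupport fun x => max (w x - g x) 0 :=
    (hwc.sub hgc).comp_left (g := fun t : ℝ => max t 0) (max_self 0)
  have hsubi : Integrable fun x => max (w x - g x) 0 :=
    ((hw.sub hg).max continuous_const).integrable_of_hasCompactSupport hsubc
  have hgi := integrable_rpow_of_hasCompactSupport hq0 hg hgc
  have hDi : ∫ x, max (w x - g x) 0 ≤ D := by
    have hnn : 0 ≤ᵐ[volume] fun x => max (w x - g x) 0 := .of_forall fun x => le_max_right _ _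
    rw [integral_eq_lintegral_of_nonneg_ae hnn hsubi.aestronglyMeasurable]
    exact ENNReal.toReal_le_of_le_ofReal hD0 hD
  have h1 : ∫ x, max (w x) (g x) ^ q ≤ ∫ x, (g x ^ q + q * M ^ (q - 1) * max (w x - g x) 0) :=
    integral_mono_of_nonneg
      (.of_forall fun x => Real.rpow_nonneg ((hg0 x).trans (le_max_right _ _)) _)
      (hgi.add (hsubi.const_mul _)) (.of_forall hpt)
  rw [integral_add hgi (hsubi.const_mul _), hgI, integral_const_mul] at h1
  have h2 : q * M ^ (q - 1) * ∫ x, max (w x - g x) 0 ≤ q * M ^ (q - 1) * D := by gcongr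
  linarith

theorem posSet_eq_ball_of_radial (hN : 1 ≤ N) {x₀ : Eu N} {r : ℝ} (hr : 0 < r)
    (hB : volume (Metric.ball x₀ r) = 1) {g : Eu N → ℝ} (hg : Continuous g) {R : ℝ}
    (hgR : ∀ x, R < ‖x‖ → g x = 0) (hgrad : ∀ x y, ‖x‖ ≤ ‖y‖ → g y ≤ g x)
    (hgv : volume {x | 0 < g x} = 1) : {x | 0 < g x} = Metric.ball 0 r := by
  have hsub : {x | 0 < g x} ⊆ Metric.closedBall 0 R := by
    intro x hx
    by_contra hxx
    exact hx.ne' (hgR x (by simpa using hxx))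
  obtain ⟨r', hr'0, hr'⟩ := eq_ball_of_radial hN (isOpen_lt continuous_const hg)
    (Metric.isBounded_closedBall.subset hsub) fun x hx y hy => lt_of_lt_of_le hx (hgrad y x hy)
  rw [hr']
  rw [hr'] at hgv
  have hr'pos : 0 < r' := by
    rcases hr'0.eq_or_lt with h | h
    · rw [← h, Metric.ball_zero, measure_empty] at hgv
      exact absurd hgv zero_ne_one
    · exact h
  rw [volume_ball_eq _ hr] at hB
  rw [volume_ball_eq _ hr'pos, ← hB, ENNReal.ofReal_eq_ofReal_iff (by positivity)
    (by positivity)] at hgv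
  have := mul_right_cancel₀ (unit_ball_volume_pos (N := N)).ne' hgv
  rw [pow_left_inj₀ hr'pos.le hr.le (by omega)] at this
  rw [this]

/-- Quantitative Faber–Krahn inequality for centred functions with a uniform modulus of
continuity. -/
theorem exists_centered_stability (hN : 2 ≤ N) (hs0 : 0 < s) (hs1 : s < 1) (hq1 : 1 ≤ q)
    (hq2 : q < 2 * N / ((N : ℝ) - 2 * s)) {M : ℝ} (hM : 0 < M) {m : ℝ → ℝ}
    (hm : ∀ η, 0 < η → 0 < m η) :
    ∃ c, 0 < c ∧ ∀ (x₀ : Eu N) (r : ℝ), 0 < r → volume (Metric.ball x₀ r) = 1 →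
      ∀ w : Eu N → ℝ, IsCentered s q w → (∀ x, w x ≤ M) →
      (∀ η, 0 < η → ∀ x y, ‖x - y‖ ≤ m η → |w x - w y| ≤ η) →
      c * volume.real ({x | 0 < w x} \ Metric.ball 0 r) ^ (4 - s) ≤
        gagliardoSqR N s w - sobolevConst N s q (Metric.ball x₀ r) := by
  have hN1 : 1 ≤ N := by omega
  have hNR : (2 : ℝ) ≤ N := by exact_mod_cast hN
  have hq0 : 0 < q := by linarith
  have hβ : 0 < 2 / q - 1 + 2 * s / N := by
    rw [lt_div_iff₀ (by linarith)] at hq2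
    have : 2 / q - 1 + 2 * s / N = (2 * N - q * (N - 2 * s)) / (q * N) := by
      field_simp
      ring
    rw [this]
    exact div_pos (by linarith) (by positivity)
  obtain ⟨ℓ, hℓ, hℓle⟩ := exists_sobolevConst_ge hN hs0 hs1 hq1 hq2
  obtain ⟨ρ₀, hρ₀, htight⟩ := exists_tightness (N := N) (s := s) (q := q) hN hs0 hq1
  obtain ⟨r₁, -, hr₁, -, -⟩ := exists_radVol_lt_iff (N := N) hN1 zero_le_one
  have hω := unit_ball_volume_pos (N := N)
  set ω := (volume (Metric.ball (0 : Eu N) 1)).toReal with hωd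
  set ρ := max ρ₀ |r₁| with hρ
  have hρ0 : 0 < ρ := lt_max_of_lt_left (by linarith)
  obtain ⟨C, hC, hDle⟩ := exists_lintegral_sub_le (N := N) hN hs0 hs1 hq1 hρ0
  set b := min ((2 / q - 1 + 2 * s / N) / 2) 1 with hb
  have hb0 : 0 < b := lt_min (by positivity) one_pos
  set Q := q * M ^ (q - 1) with hQ
  have hQ0 : 0 < Q := by positivity
  set σ := √b / 4 with hσ
  have hσ0 : 0 < σ := by positivity
  obtain ⟨δ₀, hδ₀, hti⟩ := htight m hm (σ / Q) (by positivity)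
  set θ := 1 - s / 2 with hθ
  have hθ0 : 0 ≤ θ := by linarith
  set κ := σ / (Q * M) with hκ
  have hκ0 : 0 < κ := by positivity
  set T := Q * C * κ ^ (-θ) with hT
  set c₁ := b / 2 / (1 / ℓ + 2 * T ^ 2) with hc₁
  have hc₁0 : 0 < c₁ := by positivity
  refine ⟨min c₁ δ₀, lt_min hc₁0 hδ₀, fun x₀ r hr hB w hw hwM hwm => ?_⟩
  have hrr : r ≤ ρ := by
    rw [volume_ball_eq _ hr, ← hωd, ← ENNReal.ofReal_one,
      ENNReal.ofReal_eq_ofReal_iff (by positivity) zero_le_one] at hB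
    have h1 : r ^ N = r₁ ^ N := mul_right_cancel₀ hω.ne' (hB.trans hr₁.symm)
    have h2 : r ^ N = |r₁| ^ N := by
      rw [← abs_pow, ← h1, abs_of_pos (by positivity)]
    rw [pow_left_inj₀ hr.le (abs_nonneg _) (by omega)] at h2
    exact h2.le.trans (le_max_right _ _)
  set δ := gagliardoSqR N s w - sobolevConst N s q (Metric.ball x₀ r) with hδ
  have hδ0 : 0 ≤ δ := sub_nonneg.2 (hw.sobolevConst_le hN1 hs0 hq1 hr hB)
  set A := volume.real ({x | 0 < w x} \ Metric.ball 0 r) with hA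
  have hWf : volume {x | 0 < w x} ≠ ∞ := by rw [hw.volume_eq]; exact ENNReal.one_ne_top
  have hA1 : A ≤ 1 := by
    have : volume.real {x | 0 < w x} = 1 := by
      rw [measureReal_def, hw.volume_eq, ENNReal.toReal_one]
    rw [← this]
    exact measureReal_mono Set.sdiff_subset hWf
  have hAnn : 0 ≤ A := measureReal_nonneg
  rcases hAnn.eq_or_lt with hA0 | hA0
  · rw [← hA0, Real.zero_rpow (by linarith), mul_zero]
    exact hδ0
  have hAp0 : 0 ≤ A ^ (4 - s) := by positivity
  rcases le_or_gt δ₀ δ with hbig | hsmall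
  · have : A ^ (4 - s) ≤ 1 := Real.rpow_le_one hA0.le hA1 (by linarith)
    calc min c₁ δ₀ * A ^ (4 - s) ≤ δ₀ * 1 := by
          gcongr
          exact min_le_right _ _
      _ ≤ δ := by linarith
  obtain ⟨R, hR⟩ := hw.eq_zero
  obtain ⟨g, hgc, hg0, hgR, hgrad, hglev, hgen⟩ := exists_rearrangement (N := N) (s := s)
    (by positivity) hw.continuous hw.nonneg hR
  have hgcs : HasCompactSupport g := HasCompactSupport.of_support_subset_isCompact
    (isCompact_closedBall 0 R) fun x hx => by
      by_contra hxx
      exact hx (hgR x (by simpa using hxx))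
  have hgI : ∫ x, g x ^ q = 1 := by
    rw [integral_rpow_eq_of_measure_eq hq0 hw.continuous.measurable hgc.measurable hw.nonneg hg0
      hglev, hw.integral_eq]
  have hgv : volume {x | 0 < g x} = 1 := by rw [hglev 0 le_rfl, hw.volume_eq]
  have hball : {x | 0 < g x} = Metric.ball 0 r :=
    posSet_eq_ball_of_radial hN1 hr hB hgc hgR hgrad hgv
  have hℓl := hℓle _ Metric.isOpen_ball hB
  obtain ⟨ha0, hmain⟩ := hw.sup_inf_bound hN1 hs0 hq1 hβ hr hB (hℓ.trans_le hℓl) hgc hgcs hg0 hgen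
    hgI hgv
  rw [hball, ← hA, ← hb, ← hδ] at hmain
  have hD := hDle x₀ r r M (σ / Q) (κ * A) w g hr hB hw hwM
    (fun x hx => hti x₀ r hr hB w hw hwm hsmall x ((le_max_left _ _).trans hx)) hrr
    hgc.measurable hg0 hgrad hglev (by positivity) (by positivity) hM.le
  rw [← hA, ← hδ] at hD
  have ha := integral_sup_rpow_sub_one_le hq1 hM hw.continuous hw.compactSupport hwM hgc hgcs hg0
    hgI (by positivity) hD
  have hfin := mul_rpow_le_of_sup_inf (T := T) (θ := θ) hℓ hℓl hb0 hA0 hA1 hδ0 hθ0 ha0 hmain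
    (ha.trans_eq ?_)
  · rw [show 2 + 2 * θ = 4 - s by rw [hθ]; ring] at hfin
    refine le_trans ?_ hfin
    gcongr
    exact min_le_left _ _
  · rw [← hQ, Real.mul_rpow hκ0.le hA0.le, hT]
    have e1 : Q * (M * (κ * A)) = σ * A := by rw [hκ]; field_simp
    have e2 : Q * (σ / Q * A) = σ * A := by field_simp
    have e3 : √b = 4 * σ := by rw [hσ]; ring
    rw [e3]
    linear_combination e1 + e2

end Stability

section Asymmetry

variable {N : ℕ} {s q : ℝ}

theorem asym_nonneg (Ω : Set (Eu N)) : 0 ≤ asym N Ω := by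
  refine Real.sInf_nonneg ?_
  rintro c ⟨x, r, -, -, rfl⟩
  positivity

theorem asym_le_of_volume_eq {Ω : Set (Eu N)} (hΩ : MeasurableSet Ω) (hv : volume Ω = 1)
    {p : Eu N} {r : ℝ} (hr : 0 < r) (hB : volume (Metric.ball p r) = 1) :
    asym N Ω ≤ 2 * volume.real (Ω \ Metric.ball p r) := by
  have hΩf : volume Ω ≠ ∞ := by rw [hv]; exact ENNReal.one_ne_top
  have hBf : volume (Metric.ball p r) ≠ ∞ := by rw [hB]; exact ENNReal.one_ne_top
  have hBm : MeasurableSet (Metric.ball p r) := measurableSet_ball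
  have h1 := measureReal_sdiff_add_inter (μ := volume) (s := Ω) (t := Metric.ball p r) hBm
    (h := hΩf)
  have h2 := measureReal_sdiff_add_inter (μ := volume) (s := Metric.ball p r) (t := Ω) hΩ
    (h := hBf)
  rw [Set.inter_comm] at h2
  have h3 : volume.real Ω = volume.real (Metric.ball p r) := by
    rw [measureReal_def, measureReal_def, hv, hB]
  have hsymm : volume.real (symmDiff Ω (Metric.ball p r)) =
      2 * volume.real (Ω \ Metric.ball p r) := by
    rw [measureReal_symmDiff_eq (μ := volume) hΩ hBm hΩf hBf]
    linarith
  rw [← hsymm]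
  refine csInf_le ⟨0, ?_⟩ ⟨p, r, hr, by rw [hB, hv], ?_⟩
  · rintro c ⟨x, ρ, -, -, rfl⟩
    positivity
  · rw [hv, ENNReal.toReal_one, div_one, measureReal_def]

theorem isCentered_translate {Ω : Set (Eu N)} (hq : 0 < q)
    (hv : volume Ω = 1) {u : Eu N → ℝ} (hu : Continuous u) (huc : HasCompactSupport u)
    (hu0 : ∀ x, 0 ≤ u x) (hz : ∀ x, x ∉ Ω → u x = 0) (hpos : ∀ x ∈ Ω, 0 < u x)
    (hI : ∫ x in Ω, u x ^ q = 1) (hE : gagliardoSq N s u < ∞) {p : Eu N}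
    (hp : ∀ z, gaussMass (fun x => u (x + z)) ≤ gaussMass (fun x => u (x + p))) :
    IsCentered s q fun x => u (x + p) where
  continuous := hu.comp (continuous_id.add continuous_const)
  compactSupport := huc.comp_homeomorph (Homeomorph.addRight p)
  nonneg x := hu0 _
  integral_eq := by
    rw [integral_add_right_eq_self (fun x => u x ^ q) p, ← hI,
      setIntegral_eq_integral_of_forall_compl_eq_zero]
    intro x hx
    rw [hz x hx, Real.zero_rpow hq.ne']
  volume_eq := by
    have h : {x | 0 < u (x + p)} = (fun x => x + p) ⁻¹' Ω := by
      ext x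
      exact ⟨fun hx => by_contra fun hn => (hz _ hn).not_gt hx, fun hx => hpos _ hx⟩
    rw [h, measure_preimage_add_right, hv]
  energy_lt_top := by rwa [gagliardoSq_comp_add]
  center z := by
    have := hp (z + p)
    simpa only [add_assoc] using this

end Asymmetry

theorem two_mul_rpow_le {c A a s : ℝ} (hc : 0 ≤ c) (hs0 : 0 < s) (hA1 : A ≤ 1) (ha0 : 0 ≤ a)
    (ha : a ≤ 2 * A) : c * 2⁻¹ ^ (2 + 1 / s) * a ^ (2 + 1 / s) ≤ c * A ^ (4 - s) := by
  have he : 4 - s ≤ 2 + 1 / s := by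
    have h : s + 1 / s - 2 = (s - 1) ^ 2 / s := by
      field_simp
      ring
    have : 0 ≤ (s - 1) ^ 2 / s := by positivity
    linarith
  have he0 : 0 < 2 + 1 / s := by positivity
  have hA0 : 0 ≤ A := by linarith
  rw [mul_assoc, ← Real.mul_rpow (by norm_num) ha0]
  refine mul_le_mul_of_nonneg_left ?_ hc
  refine (Real.rpow_le_rpow (by positivity) (show 2⁻¹ * a ≤ A by linarith) he0.le).trans ?_
  rcases hA0.eq_or_lt with h | h
  · rw [← h, Real.zero_rpow he0.ne']
    exact Real.rpow_nonneg le_rfl _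
  · exact Real.rpow_le_rpow_of_exponent_ge h hA1 he

/-- **Improved stability under a uniform `L^∞` closeness bound** (core of Theorem 6.3):
there is `c = c(N,s,q,C₀) > 0` such that for every open bounded `Ω` with `|Ω| = 1`
admitting a continuous first minimizer `u` (vanishing outside `Ω`) whose extension
satisfies `‖U(·,z) - u‖_∞ ≤ C₀ z^s` for all `z > 0`, and every ball `B` with `|B| = 1`,
`λ_{s,q}(Ω) - λ_{s,q}(B) ≥ c A(Ω)^{2+1/s}`. -/
theorem improved_stability_of_Linfty_bound
    (N : ℕ) (hN : 2 ≤ N) (s q : ℝ) (hs0 : 0 < s) (hs1 : s < 1)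
    (hq1 : 1 ≤ q) (hq2 : q < 2 * N / ((N : ℝ) - 2 * s))
    (C₀ : ℝ) (hC₀ : 0 < C₀) :
    ∃ c : ℝ, 0 < c ∧
      ∀ Ω : Set (Eu N), IsOpen Ω → Bornology.IsBounded Ω → volume Ω = 1 →
      ∀ u : Eu N → ℝ, IsFirstMinimizer N s q Ω u → Continuous u →
        (∀ x, x ∉ Ω → u x = 0) →
        (∀ z : ℝ, 0 < z → ∀ x : Eu N, |csExt N s u x z - u x| ≤ C₀ * z ^ s) →
      ∀ (x₀ : Eu N) (r : ℝ), 0 < r → volume (Metric.ball x₀ r) = 1 →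
        sobolevConst N s q Ω - sobolevConst N s q (Metric.ball x₀ r)
          ≥ c * asym N Ω ^ (2 + 1 / s) := by
  have hN1 : 1 ≤ N := by omega
  have hq0 : 0 < q := by linarith
  obtain ⟨ℓ, hℓ, hℓle⟩ := exists_sobolevConst_ge hN hs0 hs1 hq1 hq2
  obtain ⟨M, m, hM, hm, hbounds⟩ := exists_uniform_bounds (N := N) hN1 hs0 hq1 hC₀
  obtain ⟨c, hc, hstab⟩ := exists_centered_stability hN hs0 hs1 hq1 hq2 hM hm
  refine ⟨c * 2⁻¹ ^ (2 + 1 / s), by positivity, ?_⟩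
  rintro Ω hΩ hΩb hΩv u ⟨-, hu0, -, hI, hE, hpos⟩ hu hz hext x₀ r hr hB
  have huc : HasCompactSupport u := HasCompactSupport.of_support_subset_isCompact
    hΩb.isCompact_closure fun x hx => subset_closure (by_contra fun hn => hx (hz x hn))
  obtain ⟨huM, hum⟩ := hbounds Ω hΩ hΩv u hu huc hu0 hz hI hext
  have hEt : gagliardoSq N s u < ∞ := by
    by_contra htop
    rw [not_lt, top_le_iff] at htop
    have h := hℓle Ω hΩ hΩv
    rw [← hE, gagliardoSqR, htop, ENNReal.toReal_top] at h
    linarith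
  obtain ⟨p, hp⟩ := exists_gaussMass_max hu huc hu0
  have hw : IsCentered s q fun x => u (x + p) :=
    isCentered_translate hq0 hΩv hu huc hu0 hz hpos hI hEt hp
  have hmain := hstab x₀ r hr hB _ hw (fun x => huM _) fun η hη x y hxy =>
    hum η hη _ _ (by rwa [add_sub_add_right_eq_sub])
  have hset : {x | 0 < u (x + p)} \ Metric.ball 0 r =
      (fun x => x + p) ⁻¹' (Ω \ Metric.ball p r) := by
    ext x
    have h1 : 0 < u (x + p) ↔ x + p ∈ Ω :=
      ⟨fun hx => by_contra fun hn => (hz _ hn).not_gt hx, hpos _⟩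
    simp [h1]
  rw [hset, measureReal_def, measure_preimage_add_right, ← measureReal_def, gagliardoSqR,
    gagliardoSq_comp_add, ← gagliardoSqR, hE] at hmain
  have hBp : volume (Metric.ball p r) = 1 := by
    rw [volume_ball_eq p hr, ← volume_ball_eq x₀ hr, hB]
  have hA1 : volume.real (Ω \ Metric.ball p r) ≤ 1 := by
    refine (measureReal_mono Set.sdiff_subset (by rw [hΩv]; exact ENNReal.one_ne_top)).trans_eq ?_
    rw [measureReal_def, hΩv, ENNReal.toReal_one]
  exact (two_mul_rpow_le hc.le hs0 hA1 (asym_nonneg Ω)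
    (asym_le_of_volume_eq hΩ.measurableSet hΩv hr hBp)).trans hmain
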